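/- arXiv:1302.2720 — 7 statements merged into one kernel-verified Lean document; each statement's English description precedes it below -/
import Mathlib

section
/- Let K = k(K₁,…,K_{d−1},X,Y) be the field of rational functions in d+1 indeterminates over k, set K_d := −(K₁+⋯+K_{d−1}), and let F(t) = ∏_{i=1}^{d}(t − d·K_i) − X·Y ∈ K[t]. Then the Galois group of F over K (that is, the Galois group of a splitting field of F over K) is isomorphic to the symmetric group 𝔖_d on d letters. -/
set_option maxHeartbeats 1000000
set_option synthInstance.maxHeartbeats 1000000

section

open Polynomial

open scoped Pointwise in
attribute [local instance] Ideal.Quotient.field in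
/-- If a monic `H` over an integrally closed domain `R`, irreducible over the fraction field,
reduces to `X * φ` modulo a maximal ideal and `φ` does not vanish at `0`, then the Galois group of
`H` has order at least `H.natDegree` times that of `φ`: the decomposition group surjects onto the
Galois group of `φ` and fixes the root of `H` lying over `0`. -/
theorem natDegree_mul_card_gal_le {R K : Type*} [CommRing R] [IsDomain R] [IsIntegrallyClosed R]
    [Field K] [CharZero K] [Algebra R K] [IsFractionRing R K] (P : Ideal R) [P.IsMaximal]
    {H : R[X]} (hH : H.Monic) (hirr : Irreducible (H.map (algebraMap R K))) {φ : (R ⧸ P)[X]}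
    (hφ : H.map (Ideal.Quotient.mk P) = X * φ) (hφ0 : φ.eval 0 ≠ 0) :
    H.natDegree * Nat.card φ.Gal ≤ Nat.card (H.map (algebraMap R K)).Gal := by
  set L := (H.map (algebraMap R K)).SplittingField
  have : IsGalois K L := IsGalois.of_separable_splitting_field hirr.separable
  have hinj : Function.Injective (algebraMap R L) := by
    rw [IsScalarTower.algebraMap_eq R K L]
    exact (algebraMap K L).injective.comp (IsFractionRing.injective R K)
  let S := integralClosure R L
  have : IsFractionRing S L := integralClosure.isFractionRing_of_finite_extension K L
  let : MulSemiringAction Gal(L/K) S := IsIntegralClosure.MulSemiringAction R K L S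
  have : Algebra.IsInvariant R S Gal(L/K) := Algebra.isInvariant_of_isGalois R K L S
  have hsmul (g : Gal(L/K)) (x : S) : ((g • x : S) : L) = g x :=
    algebraMap_galRestrict_apply R g x
  have : SMulCommClass Gal(L/K) R S :=
    ⟨fun g r x ↦ map_smul (galRestrict R K L S g) r x⟩
  have : FaithfulSMul R S := (faithfulSMul_iff_algebraMap_injective R S).mpr fun x y h ↦
    hinj (congrArg (algebraMap S L) h)
  obtain ⟨Q, hQ, hQP⟩ := Ideal.exists_maximal_ideal_liesOver_of_isIntegral (S := S) P
  have : Normal (R ⧸ P) (S ⧸ Q) := Ideal.Quotient.normal Gal(L/K) P Q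
  set HS := H.map (algebraMap R S) with hHS
  have hHSL : HS.map (algebraMap S L) = (H.map (algebraMap R K)).map (algebraMap K L) := by
    rw [hHS, map_map, map_map, ← IsScalarTower.algebraMap_eq, ← IsScalarTower.algebraMap_eq]
  have hHSm : HS.Monic := hH.map _
  have hsplit : HS.Splits := by
    refine Splits.of_splits_map_of_injective (i := algebraMap S L) Subtype.val_injective ?_ ?_
    · rw [hHSL]
      exact SplittingField.splits _
    · intro a ha
      refine ⟨⟨a, H, hH, ?_⟩, rfl⟩
      rw [mem_roots', hHS, map_map, IsRoot.def, eval_map] at ha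
      exact ha.2
  have hXφ : HS.map (Ideal.Quotient.mk Q) = X * φ.map (algebraMap (R ⧸ P) (S ⧸ Q)) := by
    have := congrArg (Polynomial.map (algebraMap (R ⧸ P) (S ⧸ Q))) hφ
    rw [Polynomial.map_mul, map_X, map_map] at this
    rw [← this, hHS, map_map]
    rfl
  have : Fact ((φ.map (algebraMap (R ⧸ P) (S ⧸ Q))).Splits) :=
    ⟨(hsplit.map (Ideal.Quotient.mk Q)).of_dvd (hHSm.map _).ne_zero (hXφ ▸ dvd_mul_left _ _)⟩
  have hcard : Nat.card φ.Gal ≤ Nat.card (MulAction.stabilizer Gal(L/K) Q) :=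
    Nat.card_le_card_of_surjective _ ((Gal.restrict_surjective φ (S ⧸ Q)).comp
      (Ideal.Quotient.stabilizerHom_surjective Gal(L/K) P Q))
  obtain ⟨θ, hθ, hθQ⟩ : ∃ θ : S, HS.IsRoot θ ∧ θ ∈ Q := by
    have h0 : HS.eval 0 ∈ Q := by
      rw [← Ideal.Quotient.eq_zero_iff_mem, ← eval₂_at_apply, ← eval_map, hXφ]
      simp
    rw [hsplit.eval_eq_prod_roots_of_monic hHSm,
      hQ.isPrime.multiset_prod_mem_iff_exists_mem] at h0
    obtain ⟨_, hmem, h⟩ := h0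
    obtain ⟨θ, hθ, rfl⟩ := Multiset.mem_map.mp hmem
    exact ⟨θ, isRoot_of_mem_roots hθ, by simpa using h⟩
  have huniq (θ' : S) (h : HS.IsRoot θ') (hQ' : θ' ∈ Q) : θ' = θ := by
    by_contra hne
    obtain ⟨q, hq⟩ := dvd_iff_isRoot.mpr hθ
    have hqr : q.IsRoot θ' := by
      rw [IsRoot.def, hq, eval_mul, mul_eq_zero] at h
      exact h.resolve_left (by simpa [sub_eq_zero] using hne)
    obtain ⟨r, hr⟩ := dvd_iff_isRoot.mpr hqr
    rw [hq, hr] at hXφ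
    simp only [Polynomial.map_mul, Polynomial.map_sub, map_X, map_C,
      Ideal.Quotient.eq_zero_iff_mem.mpr hθQ, Ideal.Quotient.eq_zero_iff_mem.mpr hQ', map_zero,
      sub_zero] at hXφ
    have := congrArg (eval 0) (mul_left_cancel₀ X_ne_zero hXφ)
    rw [eval_mul, eval_X, zero_mul, ← map_zero (algebraMap (R ⧸ P) (S ⧸ Q)), eval_map,
      eval₂_at_apply, map_zero] at this
    exact hφ0 ((map_eq_zero _).mp this.symm)
  have hle : Nat.card (MulAction.stabilizer Gal(L/K) Q) ≤
      Nat.card (IntermediateField.fixingSubgroup (IntermediateField.adjoin K {(θ : L)})) := by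
    refine Subgroup.card_le_of_le ?_
    rw [← IntermediateField.le_iff_le, IntermediateField.adjoin_le_iff, Set.singleton_subset_iff]
    rintro ⟨g, hg⟩
    change g (θ : L) = θ
    rw [← hsmul, huniq (g • θ)]
    · have : (HS.map (algebraMap S L)).IsRoot (θ : L) := hθ.map
      rw [hHSL, IsRoot.def, eval_map_algebraMap] at this
      refine IsRoot.of_map (f := algebraMap S L) ?_ Subtype.val_injective
      rw [hHSL, IsRoot.def, eval_map_algebraMap]
      change aeval ((g • θ : S) : L) _ = 0
      rw [hsmul, aeval_algHom_apply, this, map_zero]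
    · have := Ideal.smul_mem_pointwise_smul g θ Q hθQ
      rwa [MulAction.mem_stabilizer_iff.mp hg] at this
  have hdeg : Module.finrank K (IntermediateField.adjoin K {(θ : L)}) = H.natDegree := by
    have : (HS.map (algebraMap S L)).IsRoot (θ : L) := hθ.map
    rw [hHSL, IsRoot.def, eval_map_algebraMap] at this
    rw [IntermediateField.adjoin.finrank (Algebra.IsIntegral.isIntegral _),
      ← minpoly.eq_of_irreducible_of_monic hirr this (hH.map _), hH.natDegree_map]
  calc _ ≤ H.natDegree * Module.finrank (IntermediateField.adjoin K {(θ : L)}) L := by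
        rw [← IsGalois.card_fixingSubgroup_eq_finrank]
        exact Nat.mul_le_mul_left _ (hcard.trans hle)
    _ = Nat.card Gal(L/K) := by
        rw [IsGalois.card_aut_eq_finrank, ← hdeg, Module.finrank_mul_finrank]


open IntermediateField in
/-- The order of the Galois group does not increase when the base field is extended and the
roots are replaced by elements of the fields they generate. -/
theorem card_gal_le_of_forall_mem_adjoin {K M : Type*} [Field K] [Field M] (f : K →+* M)
    (p : K[X]) (q : M[X])
    (h : ∀ x ∈ q.rootSet (AlgebraicClosure M), ∃ y ∈ (p.map f).rootSet (AlgebraicClosure M),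
      x ∈ adjoin M {y}) :
    Nat.card q.Gal ≤ Nat.card p.Gal := by
  let N := AlgebraicClosure M
  let : Algebra K M := f.toAlgebra
  have : Fact ((p.map (algebraMap K N)).Splits) := ⟨IsAlgClosed.splits _⟩
  have : Fact ((q.map (algebraMap M N)).Splits) := ⟨IsAlgClosed.splits _⟩
  choose g hg using Gal.restrict_surjective q N
  refine Nat.card_le_card_of_injective
    (fun σ ↦ Gal.restrict p N ((g σ).restrictScalars K)) fun σ τ hστ ↦ ?_
  rw [← hg σ, ← hg τ]
  refine Gal.galActionHom_injective q N (Equiv.ext fun x ↦ Subtype.ext ?_)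
  rw [Gal.galActionHom_restrict, Gal.galActionHom_restrict]
  obtain ⟨y, hy, hxy⟩ := h x x.2
  have hyp : y ∈ p.rootSet N := by
    rw [rootSet, show p.map f = p.map (algebraMap K M) from rfl, aroots_map] at hy
    exact hy
  have hgy : g σ y = g τ y := by
    have h1 := Gal.galActionHom_restrict p N ((g σ).restrictScalars K) ⟨y, hyp⟩
    rw [show Gal.restrict p N ((g σ).restrictScalars K) = _ from hστ,
      Gal.galActionHom_restrict] at h1
    exact h1.symm
  have hle : adjoin M {y} ≤ (AlgHom.equalizer (g σ).toAlgHom (g τ).toAlgHom).toIntermediateField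
      (fun z hz ↦ by
        rw [AlgHom.mem_equalizer] at hz
        rw [AlgHom.mem_equalizer, map_inv₀, map_inv₀, hz]) := by
    rw [adjoin_le_iff, Set.singleton_subset_iff]
    exact hgy
  exact hle hxy

/-- The Galois group of `X * φ - T * p` over `B(T)` has order at least `φ.natDegree + 1` times
that of the Galois group of `φ` over `B`, by specialisation at `T = 0`. -/
theorem natDegree_succ_mul_card_gal_le {B K : Type*} [Field B] [CharZero B] [Field K]
    [Algebra B[X] K] [IsFractionRing B[X] K] {φ p : B[X]} (hφ : φ.Monic)
    (hp : p.natDegree ≤ φ.natDegree) (hφ0 : φ.eval 0 ≠ 0) (hcop : IsCoprime (X * φ) p)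
    (hp0 : p ≠ 0) :
    (φ.natDegree + 1) * Nat.card φ.Gal ≤
      Nat.card (((X * φ).map C - C X * p.map C).map (algebraMap B[X] K)).Gal := by
  have : CharZero K := charZero_of_injective_algebraMap (IsFractionRing.injective B[X] K)
  set H : B[X][X] := (X * φ).map C - C X * p.map C with hH
  have hdeg : (X * φ).natDegree = φ.natDegree + 1 := natDegree_X_mul hφ.ne_zero
  have hlt : (C X * p.map C : B[X][X]).degree < ((X * φ).map (C : B →+* B[X])).degree := by
    refine degree_lt_degree ?_
    rw [natDegree_C_mul X_ne_zero, natDegree_map_eq_of_injective C_injective,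
      natDegree_map_eq_of_injective C_injective, hdeg]
    lia
  have hHm : H.Monic := ((monic_X.mul hφ).map _).sub_of_left hlt
  have hHdeg : H.natDegree = φ.natDegree + 1 := by
    rw [hH, natDegree_sub_eq_left_of_natDegree_lt (natDegree_lt_natDegree (by simp [hp0]) hlt),
      natDegree_map_eq_of_injective C_injective, hdeg]
  have hirr : Irreducible H := by
    have : H = Bivariate.swap (C (-p) * X + C (X * φ)) := by
      rw [map_add, map_mul, Bivariate.swap_C, Bivariate.swap_C, Bivariate.swap_Y, hH,
        Polynomial.map_neg]
      ring
    rw [this, MulEquiv.irreducible_iff]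
    exact irreducible_C_mul_X_add_C (neg_ne_zero.mpr hp0) hcop.symm.neg_left.isRelPrime
  let P : Ideal B[X] := RingHom.ker (evalRingHom (0 : B))
  have hsurj : Function.Surjective (evalRingHom (0 : B)) := fun b ↦ ⟨C b, by simp⟩
  have hP : P.IsMaximal := RingHom.ker_isMaximal_of_surjective _ hsurj
  let := Ideal.Quotient.field P
  let e : B[X] ⧸ P ≃+* B := RingHom.quotientKerEquivOfSurjective hsurj
  have hmkX : Ideal.Quotient.mk P X = 0 :=
    Ideal.Quotient.eq_zero_iff_mem.mpr (by simp [P, RingHom.mem_ker])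
  let ψ : (B[X] ⧸ P)[X] := φ.map ((Ideal.Quotient.mk P).comp C)
  have heC : (e : B[X] ⧸ P →+* B).comp ((Ideal.Quotient.mk P).comp C) = RingHom.id B := by
    ext b
    change (C b).eval 0 = b
    simp
  have hψ : ψ.map (e : B[X] ⧸ P →+* B) = φ := by
    rw [map_map, heC, map_id]
  have h1 : Nat.card φ.Gal ≤ Nat.card ψ.Gal := by
    refine card_gal_le_of_forall_mem_adjoin (e : B[X] ⧸ P →+* B) ψ φ fun x hx ↦ ⟨x, ?_, ?_⟩
    · rwa [hψ]
    · exact IntermediateField.mem_adjoin_simple_self B x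
  rw [← hHdeg]
  refine (Nat.mul_le_mul_left _ h1).trans
    (natDegree_mul_card_gal_le P hHm (hHm.irreducible_iff_irreducible_map_fraction_map.mp hirr)
      ?_ ?_)
  · rw [hH, Polynomial.map_sub, Polynomial.map_mul (p := C X), map_C, hmkX, C_0, zero_mul, sub_zero,
      map_map, Polynomial.map_mul, map_X]
  · intro h
    apply hφ0
    rw [← hψ, ← map_zero (e : B[X] ⧸ P →+* B), eval_map, eval₂_at_apply, h, map_zero]

/-- The polynomial `c * ∏ i, (X - (a i)⁻¹) + (1 - c) * X ^ n` has a Galois group of order at least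
`n!` for suitable algebraically independent `a i`. -/
theorem exists_algebraicIndependent_factorial_le_card_gal {B : Type} [Field B] [CharZero B] {c : B}
    (hc0 : c ≠ 0) (hc1 : c ≠ 1) (ι : Type) [Fintype ι] :
    ∃ (M : Type) (_ : Field M) (_ : Algebra B M) (a : ι → M), AlgebraicIndependent B a ∧
      (Fintype.card ι).factorial ≤ Nat.card (C (algebraMap B M c) * ∏ i, (X - C (a i)⁻¹) +
        C (algebraMap B M (1 - c)) * X ^ Fintype.card ι).Gal := by
  refine Fintype.induction_empty_option (P := fun ι _ ↦ ∃ (M : Type) (_ : Field M)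
    (_ : Algebra B M) (a : ι → M), AlgebraicIndependent B a ∧
      (Fintype.card ι).factorial ≤ Nat.card (C (algebraMap B M c) * ∏ i, (X - C (a i)⁻¹) +
        C (algebraMap B M (1 - c)) * X ^ Fintype.card ι).Gal)
    (fun α β _ e ih ↦ ?_) ?_ (fun α _ ih ↦ ?_) ι
  · have : Fintype α := Fintype.ofEquiv β e.symm
    obtain ⟨M, _, _, a, ha, h⟩ := ih
    refine ⟨M, _, _, a ∘ e.symm, ha.comp _ e.symm.injective, ?_⟩
    rw [← Fintype.card_congr e, Function.comp_def, e.symm.prod_comp fun i ↦ X - C (a i)⁻¹]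
    convert h
  · exact ⟨B, _, Algebra.id B, PEmpty.elim, algebraicIndependent_empty_type_iff.mpr
      (algebraMap B B).injective, by simp⟩
  · obtain ⟨M, _, _, a, ha, h⟩ := ih
    have : CharZero M := charZero_of_injective_algebraMap (algebraMap B M).injective
    set n := Fintype.card α with hn
    set P : M[X] := ∏ i, (X - C (a i)⁻¹) with hP
    set φ : M[X] := C (algebraMap B M c) * P + C (algebraMap B M (1 - c)) * X ^ n with hφ
    have hc0' : algebraMap B M c ≠ 0 := (_root_.map_ne_zero _).mpr hc0
    have hPm : P.Monic := monic_prod_X_sub_C _ _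
    have hPd : P.natDegree = n := by rw [hP, natDegree_finsetProd_X_sub_C_eq_card]; rfl
    have hφd : φ.natDegree ≤ n := by
      refine natDegree_add_le_of_degree_le ?_ (natDegree_C_mul_X_pow_le _ _)
      exact (natDegree_C_mul_le _ _).trans hPd.le
    have hcoeff : φ.coeff n = 1 := by
      have := hPm.coeff_natDegree
      rw [hPd] at this
      rw [hφ, coeff_add, coeff_C_mul, coeff_C_mul, this, coeff_X_pow_self, mul_one, mul_one,
        ← map_add, add_sub_cancel, map_one]
    have hφm : φ.Monic := monic_of_natDegree_le_of_coeff_eq_one n hφd hcoeff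
    have hφd' : φ.natDegree = n :=
      natDegree_eq_of_le_of_coeff_ne_zero hφd (hcoeff.trans_ne one_ne_zero)
    have hP0 : P.eval 0 ≠ 0 := by
      rw [hP, eval_prod, Finset.prod_ne_zero_iff]
      intro i _
      simpa using ha.ne_zero i
    have hφ0 : φ.eval 0 ≠ 0 := by
      rcases Nat.eq_zero_or_pos n with h0 | h0
      · rw [h0] at hφd'
        rw [hφm.natDegree_eq_zero.mp hφd']
        simp
      · simp [hφ, h0.ne', hc0, hP0]
    have hXP : IsCoprime X P := by
      rw [← sub_zero X, ← C_0]
      exact (irreducible_X_sub_C (0 : M)).coprime_iff_not_dvd.mpr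
        fun h ↦ hP0 (dvd_iff_isRoot.mp h)
    have hcop : IsCoprime (X * φ) (C (algebraMap B M c) * P) := by
      have hu : IsUnit (C (algebraMap B M c)) := isUnit_C.mpr hc0'.isUnit
      have hu' : IsUnit (C (algebraMap B M (1 - c))) :=
        isUnit_C.mpr ((_root_.map_ne_zero _).mpr (sub_ne_zero.mpr hc1.symm)).isUnit
      rw [isCoprime_mul_unit_left_right hu]
      refine hXP.mul_left ?_
      rw [hφ, add_comm, IsCoprime.add_mul_right_left_iff, isCoprime_mul_unit_left_left hu']
      exact hXP.pow_left
    have key := natDegree_succ_mul_card_gal_le (K := RatFunc M) hφm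
      ((natDegree_C_mul_le _ _).trans (hPd.trans hφd'.symm).le) hφ0 hcop
      (mul_ne_zero (C_ne_zero.mpr hc0') hPm.ne_zero)
    let a' : Option α → RatFunc M :=
      fun o ↦ o.elim (RatFunc.X)⁻¹ (algebraMap M (RatFunc M) ∘ a)
    have hX : Transcendental M (RatFunc.X : RatFunc M)⁻¹ :=
      fun h ↦ RatFunc.transcendental_X (IsAlgebraic.inv_iff.mp h)
    refine ⟨RatFunc M, inferInstance, inferInstance, a', ?_, ?_⟩
    · have := ha.sumElim_comp (y := fun _ : Unit ↦ (RatFunc.X : RatFunc M)⁻¹)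
        (algebraicIndependent_unique_type_iff.mpr hX)
      refine (algebraicIndependent_equiv' ((Equiv.optionEquivSumPUnit α).trans
        (Equiv.sumComm _ _)) ?_).mpr this
      ext (_ | _) <;> rfl
    · rw [Fintype.card_option, Nat.factorial_succ]
      refine (Nat.mul_le_mul_left _ h).trans ?_
      rw [hφd'] at key
      refine key.trans_eq ?_
      congr 2
      rw [Fintype.prod_option]
      have hXm : algebraMap M[X] (RatFunc M) X = RatFunc.X := RatFunc.algebraMap_X
      have hCm (x : M) : algebraMap M[X] (RatFunc M) (C x) = algebraMap M (RatFunc M) x :=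
        (IsScalarTower.algebraMap_apply M M[X] (RatFunc M) x).symm
      have hBm (x : B) : algebraMap M (RatFunc M) (algebraMap B M x) = algebraMap B (RatFunc M) x :=
        (IsScalarTower.algebraMap_apply B M (RatFunc M) x).symm
      simp only [a', Option.elim, inv_inv, Function.comp_apply, Polynomial.map_sub,
        Polynomial.map_mul, Polynomial.map_add, Polynomial.map_pow, map_X, map_C, hXm, hCm, hBm,
        hφ, hP, Polynomial.map_prod, ← map_inv₀, ← hn]
      ring

theorem nonempty_gal_mulEquiv_perm {K : Type*} [Field K] {F : K[X]} {n : ℕ} (hF : F.natDegree ≤ n)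
    (h : n.factorial ≤ Nat.card F.Gal) : Nonempty (F.Gal ≃* Equiv.Perm (Fin n)) := by
  classical
  have hsplit : Fact ((F.map (algebraMap K F.SplittingField)).Splits) := ⟨SplittingField.splits F⟩
  have hcard : Fintype.card (F.rootSet F.SplittingField) ≤ Fintype.card (Fin n) := by
    rw [Fintype.card_fin]
    refine le_trans ?_ hF
    rw [← Nat.card_eq_fintype_card, Nat.card_coe_set_eq]
    exact ncard_rootSet_le F _
  obtain ⟨e⟩ := Function.Embedding.nonempty_of_card_le hcard
  let g : F.Gal →* Equiv.Perm (Fin n) :=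
    (Equiv.Perm.viaEmbeddingHom e).comp (Gal.galActionHom F F.SplittingField)
  have hg : Function.Injective g := (Equiv.Perm.viaEmbeddingHom_injective e).comp
    (Gal.galActionHom_injective F F.SplittingField)
  exact ⟨MulEquiv.ofBijective g (hg.bijective_of_nat_card_le (by
    rwa [Nat.card_perm, Nat.card_fin]))⟩

theorem exists_factorial_le_card_gal (k : Type) [Field k] [CharZero k] (ι : Type) [Fintype ι] :
    ∃ (M : Type) (_ : Field M) (_ : Algebra k M) (a : ι → M) (w : Bool → M),
      AlgebraicIndependent k (Sum.elim a w) ∧ (Fintype.card ι).factorial ≤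
        Nat.card (∏ i, (X - C (a i)⁻¹) - C (w true * w false) * X ^ Fintype.card ι).Gal := by
  let B := FractionRing (MvPolynomial Bool k)
  have : CharZero B := charZero_of_injective_algebraMap (algebraMap k B).injective
  have hinj : Function.Injective (algebraMap (MvPolynomial Bool k) B) :=
    IsFractionRing.injective _ _
  let x : Bool → B := fun b ↦ algebraMap (MvPolynomial Bool k) B (MvPolynomial.X b)
  have hx : AlgebraicIndependent k x := (MvPolynomial.algebraicIndependent_X Bool k).map'
    (f := IsScalarTower.toAlgHom k (MvPolynomial Bool k) B) hinj
  set s := x true * x false with hs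
  have hs0 : s ≠ 0 := mul_ne_zero (hx.ne_zero _) (hx.ne_zero _)
  have hs1 : 1 - s ≠ 0 := by
    intro h
    rw [sub_eq_zero, hs, ← map_mul, ← map_one (algebraMap (MvPolynomial Bool k) B)] at h
    simpa using congrArg MvPolynomial.constantCoeff (hinj h)
  obtain ⟨M, _, _, a, ha, h⟩ := exists_algebraicIndependent_factorial_le_card_gal
    (inv_ne_zero hs1) (fun h ↦ hs0 (by simpa using h)) ι
  let : Algebra k M := ((algebraMap B M).comp (algebraMap k B)).toAlgebra
  have : IsScalarTower k B M := .of_algebraMap_eq' rfl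
  have hs1' : algebraMap B M (1 - s)⁻¹ ≠ 0 := (_root_.map_ne_zero _).mpr (inv_ne_zero hs1)
  have hC (P Q : M[X]) : C (algebraMap B M (1 - s)⁻¹) * P +
      C (algebraMap B M (1 - (1 - s)⁻¹)) * Q =
        C (algebraMap B M (1 - s)⁻¹) * (P - C (algebraMap B M s) * Q) := by
    have h1 : 1 - (1 - s)⁻¹ = -((1 - s)⁻¹ * s) := by
      rw [eq_neg_iff_add_eq_zero, sub_add, ← mul_one_sub, inv_mul_cancel₀ hs1, sub_self]
    rw [h1, map_neg, map_mul, C_neg, C_mul]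
    ring
  rw [hC] at h
  refine ⟨M, _, _, a, algebraMap B M ∘ x, hx.sumElim_comp ha, h.trans ?_⟩
  refine card_gal_le_of_forall_mem_adjoin (RingHom.id M) _ _ fun x hx ↦
    ⟨x, ?_, IntermediateField.mem_adjoin_simple_self M x⟩
  rw [rootSet, aroots_C_mul _ hs1'] at hx
  rwa [map_id, rootSet, Function.comp_apply, Function.comp_apply, ← map_mul]

/-- Algebraically independent `a i`, `w b` in `M` determine an embedding of the rational function
field that sends `n + 1` indeterminates with zero sum to the scaled deviations of the `a i` from
their mean. -/
theorem exists_ringHom_of_algebraicIndependent {k M : Type*} [Field k] [CharZero k] [Field M]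
    [Algebra k M] {n : ℕ} {κ : Fin (n + 1) → MvPolynomial (Fin n ⊕ Bool) k}
    (hκ : ∀ j : Fin n, κ j.castSucc = MvPolynomial.X (Sum.inl j)) (hsum : ∑ i, κ i = 0)
    {a : Fin (n + 1) → M} {w : Bool → M} (haw : AlgebraicIndependent k (Sum.elim a w)) :
    ∃ f : FractionRing (MvPolynomial (Fin n ⊕ Bool) k) →+* M,
      (∀ i, f (algebraMap (MvPolynomial (Fin n ⊕ Bool) k) _ (κ i)) =
        (a i - (∑ i, a i) / (n + 1)) / (n + 1)) ∧
      f (algebraMap (MvPolynomial (Fin n ⊕ Bool) k) _ (MvPolynomial.X (Sum.inr true))) = w true ∧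
      f (algebraMap (MvPolynomial (Fin n ⊕ Bool) k) _ (MvPolynomial.X (Sum.inr false))) =
        w false * ∏ i, -a i := by
  let R := MvPolynomial (Fin n ⊕ Bool) k
  let K := FractionRing R
  let T := MvPolynomial (Fin (n + 1) ⊕ Bool) k
  have hn : (n + 1 : k) ≠ 0 := n.cast_add_one_ne_zero
  let A : Fin (n + 1) → T := fun i ↦ MvPolynomial.X (Sum.inl i)
  let lin : Fin (n + 1) → T := fun i ↦
    (n + 1 : k)⁻¹ • (A i - (n + 1 : k)⁻¹ • ∑ i, A i)
  have hlin : ∑ i, lin i = 0 := by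
    rw [← Finset.smul_sum, Finset.sum_sub_distrib, Finset.sum_const, Finset.card_univ,
      Fintype.card_fin, ← Nat.cast_smul_eq_nsmul k, Nat.cast_succ, smul_inv_smul₀ hn, sub_self,
      smul_zero]
  let ψ : R →ₐ[k] T := MvPolynomial.aeval (Sum.elim (fun j ↦ lin j.castSucc)
    (fun b ↦ cond b (MvPolynomial.X (Sum.inr true))
      (MvPolynomial.X (Sum.inr false) * ∏ i, -A i)))
  have hψl (j) : ψ (MvPolynomial.X (Sum.inl j)) = lin j.castSucc := MvPolynomial.aeval_X _ _
  have hψt : ψ (MvPolynomial.X (Sum.inr true)) = MvPolynomial.X (Sum.inr true) :=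
    MvPolynomial.aeval_X _ _
  have hψf : ψ (MvPolynomial.X (Sum.inr false)) = MvPolynomial.X (Sum.inr false) * ∏ i, -A i :=
    MvPolynomial.aeval_X _ _
  have hψ (i) : ψ (κ i) = lin i := by
    have hcast (j : Fin n) : ψ (κ j.castSucc) = lin j.castSucc :=
      (congrArg ψ (hκ j)).trans (MvPolynomial.aeval_X _ _)
    induction i using Fin.lastCases with
    | cast j => exact hcast j
    | last =>
      have h1 := congrArg ψ hsum
      rw [Fin.sum_univ_castSucc, map_add, map_sum, map_zero, Finset.sum_congr rfl fun j _ ↦ hcast j,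
        ← hlin, Fin.sum_univ_castSucc] at h1
      exact add_left_cancel h1
  have hκ0 (i) : MvPolynomial.constantCoeff (κ i) = 0 := by
    have hcast (j : Fin n) : MvPolynomial.constantCoeff (κ j.castSucc) = 0 := by simp [hκ]
    induction i using Fin.lastCases with
    | cast j => exact hcast j
    | last =>
      have h1 := congrArg MvPolynomial.constantCoeff hsum
      rw [Fin.sum_univ_castSucc, map_add, map_sum, map_zero,
        Finset.sum_congr rfl fun j _ ↦ hcast j] at h1
      simpa using h1
  let v : Fin (n + 1) → R := fun i ↦ (n + 1) * κ i + 1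
  have hv (i) : algebraMap R K (v i) ≠ 0 := by
    intro h
    have := congrArg MvPolynomial.constantCoeff ((map_eq_zero_iff _
      (IsFractionRing.injective R K)).mp h)
    simp [v, hκ0] at this
  let χ : T →ₐ[k] K := MvPolynomial.aeval (Sum.elim (fun i ↦ algebraMap R K (v i))
    (fun b ↦ cond b (algebraMap R K (MvPolynomial.X (Sum.inr true)))
      (algebraMap R K (MvPolynomial.X (Sum.inr false)) / ∏ i, -algebraMap R K (v i))))
  have hχA (i) : χ (A i) = algebraMap R K (v i) := MvPolynomial.aeval_X _ _
  have hχt : χ (MvPolynomial.X (Sum.inr true)) = algebraMap R K (MvPolynomial.X (Sum.inr true)) :=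
    MvPolynomial.aeval_X _ _
  have hχf : χ (MvPolynomial.X (Sum.inr false)) =
      algebraMap R K (MvPolynomial.X (Sum.inr false)) / ∏ i, -algebraMap R K (v i) :=
    MvPolynomial.aeval_X _ _
  have hvsum : ∑ i, algebraMap R K (v i) = (n + 1 : k) • 1 := by
    rw [← map_sum]
    simp only [v, Finset.sum_add_distrib, ← Finset.mul_sum, hsum]
    simp [Algebra.smul_def]
  have hχψ : χ.comp ψ = IsScalarTower.toAlgHom k R K := by
    refine MvPolynomial.algHom_ext fun i ↦ ?_
    change χ (ψ _) = algebraMap R K _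
    rcases i with j | (_ | _)
    · have hvj : algebraMap R K (v j.castSucc) - 1 =
          (n + 1 : k) • algebraMap R K (MvPolynomial.X (Sum.inl j)) := by
        simp [v, hκ, Algebra.smul_def]
      rw [hψl, map_smul, map_sub, map_smul, map_sum]
      simp only [hχA]
      rw [hvsum, inv_smul_smul₀ hn, hvj, inv_smul_smul₀ hn]
    · rw [hψf, map_mul, map_prod, hχf]
      simp only [map_neg, hχA]
      exact div_mul_cancel₀ _ (Finset.prod_ne_zero_iff.mpr fun i _ ↦ neg_ne_zero.mpr (hv i))
    · rw [hψt, hχt]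
  have hψinj : Function.Injective ψ := by
    refine Function.Injective.of_comp (f := χ) ?_
    rw [← AlgHom.coe_comp, hχψ]
    exact IsFractionRing.injective R K
  let α : T →ₐ[k] M := MvPolynomial.aeval (Sum.elim a w)
  have hinj : Function.Injective (α.comp ψ).toRingHom :=
    Function.Injective.comp (g := α) haw hψinj
  have hαA (i) : α (A i) = a i := MvPolynomial.aeval_X _ _
  have hαw (b) : α (MvPolynomial.X (Sum.inr b)) = w b := MvPolynomial.aeval_X _ _
  refine ⟨IsFractionRing.lift hinj, fun i ↦ ?_, ?_, ?_⟩
  · rw [IsFractionRing.lift_algebraMap]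
    change α (ψ (κ i)) = _
    rw [hψ, map_smul, map_sub, map_smul, map_sum]
    simp only [hαA, Algebra.smul_def, map_inv₀, map_add, map_natCast, map_one]
    ring
  · rw [IsFractionRing.lift_algebraMap]
    change α (ψ _) = _
    rw [hψt, hαw]
  · rw [IsFractionRing.lift_algebraMap]
    change α (ψ _) = _
    rw [hψf, map_mul, hαw, map_prod]
    simp only [map_neg, hαA]

theorem factorial_le_card_gal {k : Type} [Field k] [CharZero k] {n : ℕ}
    {κ : Fin (n + 1) → MvPolynomial (Fin n ⊕ Bool) k}
    (hκ : ∀ j : Fin n, κ j.castSucc = MvPolynomial.X (Sum.inl j)) (hsum : ∑ i, κ i = 0)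
    {F : (FractionRing (MvPolynomial (Fin n ⊕ Bool) k))[X]}
    (hF : F = ∏ i, (X - C ((n + 1) * algebraMap (MvPolynomial (Fin n ⊕ Bool) k)
        (FractionRing (MvPolynomial (Fin n ⊕ Bool) k)) (κ i))) -
      C (algebraMap (MvPolynomial (Fin n ⊕ Bool) k) _ (MvPolynomial.X (Sum.inr true)) *
        algebraMap (MvPolynomial (Fin n ⊕ Bool) k) _ (MvPolynomial.X (Sum.inr false)))) :
    (n + 1).factorial ≤ Nat.card F.Gal := by
  obtain ⟨M, _, _, a, w, haw, h⟩ := exists_factorial_le_card_gal k (Fin (n + 1))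
  obtain ⟨f, hf, hft, hff⟩ := exists_ringHom_of_algebraicIndependent hκ hsum haw
  have : CharZero M := charZero_of_injective_algebraMap (algebraMap k M).injective
  have hn : (n + 1 : M) ≠ 0 := n.cast_add_one_ne_zero
  rw [Fintype.card_fin] at h
  refine h.trans (card_gal_le_of_forall_mem_adjoin f F _ fun x hx ↦ ?_)
  set m := (∑ i, a i) / (n + 1)
  have ha0 (i) : a i ≠ 0 := haw.ne_zero (Sum.inl i)
  have hFf : F.map f = ∏ i, (X - C (a i - m)) - C (w true * (w false * ∏ i, -a i)) := by
    have hfκ (i) : f ((n + 1) * algebraMap _ _ (κ i)) = a i - m := by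
      rw [map_mul, hf, map_add, map_natCast, map_one, mul_div_cancel₀ _ hn]
    rw [hF, Polynomial.map_sub, Polynomial.map_prod, map_C, map_mul, hft, hff]
    simp only [Polynomial.map_sub, map_X, map_C, hfκ]
  have hFm : (F.map f).Monic := by
    rw [hFf]
    refine (monic_prod_X_sub_C _ _).sub_of_left (degree_C_le.trans_lt ?_)
    rw [degree_eq_natDegree (monic_prod_X_sub_C _ _).ne_zero,
      natDegree_finsetProd_X_sub_C_eq_card, Finset.card_univ, Fintype.card_fin]
    exact_mod_cast n.succ_pos
  have hxr := (mem_rootSet'.mp hx).2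
  simp only [map_sub, map_mul, map_prod, map_pow, aeval_X, aeval_C] at hxr
  have hx0 : x ≠ 0 := by
    rintro rfl
    simp [Finset.prod_eq_zero_iff, ha0] at hxr
  refine ⟨x⁻¹ - algebraMap M (AlgebraicClosure M) m, ?_, ?_⟩
  · refine mem_rootSet.mpr ⟨hFm.ne_zero, ?_⟩
    simp only [hFf, map_sub, map_mul, map_prod, map_neg, aeval_X, aeval_C]
    simp_rw [sub_sub_sub_cancel_right (x⁻¹)]
    have hprod : ∏ i, (x⁻¹ - algebraMap M (AlgebraicClosure M) (a i)) =
        (∏ i, -algebraMap M (AlgebraicClosure M) (a i)) * x⁻¹ ^ (n + 1) *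
          ∏ i, (x - algebraMap M (AlgebraicClosure M) (a i)⁻¹) := by
      have : x⁻¹ ^ (n + 1) = ∏ _i : Fin (n + 1), x⁻¹ := by simp
      rw [this, ← Finset.prod_mul_distrib, ← Finset.prod_mul_distrib]
      refine Finset.prod_congr rfl fun i _ ↦ ?_
      have : algebraMap M (AlgebraicClosure M) (a i) ≠ 0 := (_root_.map_ne_zero _).mpr (ha0 i)
      rw [map_inv₀]
      field_simp
      ring
    have hxx : x⁻¹ ^ (n + 1) * x ^ (n + 1) = 1 := by
      rw [← mul_pow, inv_mul_cancel₀ hx0, one_pow]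
    rw [hprod, sub_eq_zero.mp hxr]
    linear_combination (∏ i, -algebraMap M (AlgebraicClosure M) (a i)) *
      algebraMap M _ (w true) * algebraMap M _ (w false) * hxx
  · have hy := IntermediateField.mem_adjoin_simple_self M (x⁻¹ - algebraMap M (AlgebraicClosure M) m)
    have := inv_mem (add_mem hy (IntermediateField.algebraMap_mem _ m))
    rwa [sub_add_cancel, inv_inv] at this

end

/-- Let `d ≥ 2` and let `k` be a field of characteristic `0` containing a primitive `d`-th root
of unity.  Let `K = k(K₁, …, K_{d-1}, X, Y)` be the field of rational functions in `d + 1`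
indeterminates over `k` (realized as the fraction field of the polynomial ring in the
indeterminates `K₁, …, K_{d-1}` — indexed by `Sum.inl` — and `X = Sum.inr true`,
`Y = Sum.inr false`), set `K_d := -(K₁ + ⋯ + K_{d-1})`, and let
`F(t) = ∏_{i=1}^{d} (t - d·K_i) - X·Y ∈ K[t]`.  Then the Galois group of `F` over `K`
(the Galois group of a splitting field of `F` over `K`) is isomorphic to the symmetric group
on `d` letters. -/
theorem stmt_0 (k : Type) [Field k] [CharZero k] (d : ℕ) (hd : 2 ≤ d)
    (hζ : ∃ ζ : k, IsPrimitiveRoot ζ d)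
    (KK : Fin d → FractionRing (MvPolynomial (Fin (d - 1) ⊕ Bool) k))
    (hKK : ∀ i : Fin d,
      KK i =
        if h : (i : ℕ) < d - 1 then
          algebraMap (MvPolynomial (Fin (d - 1) ⊕ Bool) k)
            (FractionRing (MvPolynomial (Fin (d - 1) ⊕ Bool) k))
            (MvPolynomial.X (Sum.inl ⟨(i : ℕ), h⟩))
        else
          -∑ j : Fin (d - 1),
              algebraMap (MvPolynomial (Fin (d - 1) ⊕ Bool) k)
                (FractionRing (MvPolynomial (Fin (d - 1) ⊕ Bool) k))
                (MvPolynomial.X (Sum.inl j)))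
    (F : Polynomial (FractionRing (MvPolynomial (Fin (d - 1) ⊕ Bool) k)))
    (hF : F =
      (∏ i : Fin d,
        (Polynomial.X -
          Polynomial.C ((d : FractionRing (MvPolynomial (Fin (d - 1) ⊕ Bool) k)) * KK i))) -
        Polynomial.C
          (algebraMap (MvPolynomial (Fin (d - 1) ⊕ Bool) k)
              (FractionRing (MvPolynomial (Fin (d - 1) ⊕ Bool) k))
              (MvPolynomial.X (Sum.inr true)) *
            algebraMap (MvPolynomial (Fin (d - 1) ⊕ Bool) k)
              (FractionRing (MvPolynomial (Fin (d - 1) ⊕ Bool) k))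
              (MvPolynomial.X (Sum.inr false)))) :
    Nonempty (F.Gal ≃* Equiv.Perm (Fin d)) := by
  revert KK F
  generalize hn : d - 1 = n
  obtain rfl : d = n + 1 := by lia
  intro KK hKK F hF
  let κ : Fin (n + 1) → MvPolynomial (Fin n ⊕ Bool) k :=
    Fin.snoc (fun j ↦ MvPolynomial.X (Sum.inl j)) (-∑ j, MvPolynomial.X (Sum.inl j))
  have hκ (j : Fin n) : κ j.castSucc = MvPolynomial.X (Sum.inl j) :=
    Fin.snoc_castSucc (α := fun _ ↦ MvPolynomial (Fin n ⊕ Bool) k) _ _ j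
  have hκl : κ (Fin.last n) = -∑ j, MvPolynomial.X (Sum.inl j) :=
    Fin.snoc_last (α := fun _ ↦ MvPolynomial (Fin n ⊕ Bool) k) _ _
  have hsum : ∑ i, κ i = 0 := by
    rw [Fin.sum_univ_castSucc, hκl, Finset.sum_congr rfl fun j _ ↦ hκ j, add_neg_cancel]
  have hKκ (i) : KK i =
      algebraMap (MvPolynomial (Fin n ⊕ Bool) k) (FractionRing (MvPolynomial (Fin n ⊕ Bool) k)) (κ i) := by
    rw [hKK]
    induction i using Fin.lastCases with
    | cast j =>
      rw [dif_pos (by simp), hκ]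
      rfl
    | last =>
      rw [dif_neg (by simp), hκl, map_neg, map_sum]
  have hFκ : F = ∏ i, (Polynomial.X - Polynomial.C ((n + 1) *
      algebraMap (MvPolynomial (Fin n ⊕ Bool) k) (FractionRing (MvPolynomial (Fin n ⊕ Bool) k)) (κ i))) -
      Polynomial.C (algebraMap (MvPolynomial (Fin n ⊕ Bool) k) _ (MvPolynomial.X (Sum.inr true)) *
        algebraMap (MvPolynomial (Fin n ⊕ Bool) k) _ (MvPolynomial.X (Sum.inr false))) := by
    rw [hF]
    simp only [hKκ, Nat.cast_succ]
  refine nonempty_gal_mulEquiv_perm ?_ (factorial_le_card_gal hκ hsum hFκ)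
  rw [hFκ]
  rw [Polynomial.natDegree_sub_C, Polynomial.natDegree_finsetProd_X_sub_C_eq_card, Finset.card_univ, Fintype.card_fin]
end

section
/- Let R̃ be the quotient of the polynomial ring k[K₁,…,K_d,E₁,…,E_d,X,Y] in 2d+2 indeterminates by the ideal generated by the elements σ₁(dK₁,…,dK_d), σ₁(E₁,…,E_d), σ_i(dK₁,…,dK_d) − σ_i(E₁,…,E_d) for 2 ≤ i ≤ d−1, and σ_d(dK₁,…,dK_d) − σ_d(E₁,…,E_d) − (−1)^d·X·Y. Then R̃ is an integral domain and is integrally closed in its field of fractions. -/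
set_option maxHeartbeats 1000000
set_option synthInstance.maxHeartbeats 1000000

open Polynomial in
/-- If a monic polynomial over `N` splits in `R` with roots `x i` generating `R`, then `R` is
spanned over `N` by `n!` elements. -/
theorem exists_span_eq_top_of_prod_roots (n : ℕ) : ∀ (N R : Type) [CommRing N] [CommRing R]
    [Algebra N R] (x : Fin n → R) (p : N[X]), p.Monic → p.natDegree = n →
    p.map (algebraMap N R) = ∏ i, (X - C (x i)) → Algebra.adjoin N (Set.range x) = ⊤ →
    ∃ b : Fin n.factorial → R, Submodule.span N (Set.range b) = ⊤ := by
  classical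
  induction n with
  | zero =>
    intro N R _ _ _ x p _ _ _ hx
    have : Nonempty (Fin (Nat.factorial 0)) := ⟨⟨0, by simp⟩⟩
    refine ⟨fun _ => 1, ?_⟩
    have hr : Set.range x = ∅ := Set.range_eq_empty x
    rw [hr, Algebra.adjoin_empty] at hx
    rw [Set.range_const, ← Submodule.one_eq_span, ← Algebra.toSubmodule_bot, hx]
    rfl
  | succ n ih =>
    intro N R _ _ _ x p hp hdeg hprod hx
    let N' := Algebra.adjoin N {x 0}
    let x' : N' := ⟨x 0, Algebra.subset_adjoin rfl⟩
    have hroot : (p.map (algebraMap N N')).IsRoot x' := by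
      rw [Polynomial.IsRoot, eval_map_algebraMap]
      apply Subtype.val_injective
      have : ((aeval x' p : N') : R) = aeval (x 0) p := by
        exact (aeval_algHom_apply (Algebra.adjoin N {x 0}).val x' p).symm
      rw [this, ← eval_map_algebraMap, hprod, Fin.prod_univ_succ]
      simp
    obtain ⟨q, hq⟩ := dvd_iff_isRoot.2 hroot
    have hqm : q.Monic := (monic_X_sub_C x').of_mul_monic_left (hq ▸ hp.map _)
    have hcomp : (p.map (algebraMap N N')).map (algebraMap N' R) = p.map (algebraMap N R) := by
      rw [Polynomial.map_map, ← IsScalarTower.algebraMap_eq]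
    have hqprod : q.map (algebraMap N' R) = ∏ i : Fin n, (X - C (x i.succ)) := by
      have h1 := hcomp
      rw [hq, hprod, Fin.prod_univ_succ, Polynomial.map_mul] at h1
      have h2 : (X - C x').map (algebraMap N' R) = X - C (x 0) := by
        simp only [Polynomial.map_sub, map_X, map_C]; rfl
      rw [h2] at h1
      exact (monic_X_sub_C (x 0)).isRegular.left h1
    by_cases hN : Nontrivial R
    · have hqd : q.natDegree = n := by
        rw [← hqm.natDegree_map (algebraMap N' R), hqprod, natDegree_finsetProd_X_sub_C_eq_card]
        simp
      have hadj : Algebra.adjoin N' (Set.range fun i : Fin n => x i.succ) = ⊤ := by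
        rw [eq_top_iff]
        intro z _
        have hz : z ∈ Algebra.adjoin N (Set.range x) := hx ▸ Algebra.mem_top
        have : Algebra.adjoin N (Set.range x) ≤
            (Algebra.adjoin N' (Set.range fun i : Fin n => x i.succ)).restrictScalars N := by
          rw [Algebra.adjoin_le_iff]
          rintro _ ⟨i, rfl⟩
          refine Fin.cases ?_ (fun j => ?_) i
          · exact Subalgebra.algebraMap_mem _ x'
          · exact Algebra.subset_adjoin ⟨j, rfl⟩
        exact this hz
      obtain ⟨b, hb⟩ := ih N' R (fun i => x i.succ) q hqm hqd hqprod hadj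
      have h0 : aeval (x 0) p = 0 := by
        rw [← eval_map_algebraMap, hprod, Fin.prod_univ_succ]; simp
      have hs := Submodule.span_range_natDegree_eq_adjoin hp h0
      have hs' : Submodule.span N (Set.range fun i : Fin (n + 1) => x' ^ (i : ℕ)) = ⊤ := by
        rw [eq_top_iff]
        rintro ⟨z, hz⟩ -
        have hz' : z ∈ Submodule.span N
            ((Finset.image (x 0 ^ ·) (Finset.range p.natDegree) : Finset R) : Set R) := by
          rw [hs]; exact hz
        have : ((Finset.image (x 0 ^ ·) (Finset.range p.natDegree) : Finset R) : Set R) =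
            (Algebra.adjoin N {x 0}).val.toLinearMap ''
              (Set.range fun i : Fin (n + 1) => x' ^ (i : ℕ)) := by
          ext y
          simp only [hdeg, Finset.coe_image, Set.mem_image, Set.mem_range, exists_exists_eq_and]
          constructor
          · rintro ⟨i, hi, rfl⟩
            exact ⟨⟨i, by simpa using hi⟩, rfl⟩
          · rintro ⟨i, rfl⟩
            exact ⟨i, by simpa using Nat.lt_succ_iff.1 i.2, rfl⟩
        rw [this, Submodule.span_image] at hz'
        obtain ⟨w, hw, hwz⟩ := hz'
        have : w = ⟨z, hz⟩ := Subtype.val_injective hwz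
        rwa [← this]
      have key := Submodule.span_smul_of_span_eq_top hs' (Set.range b)
      rw [hb, Submodule.restrictScalars_top] at key
      let e : Fin (n + 1).factorial ≃ Fin (n + 1) × Fin n.factorial :=
        (finCongr (Nat.factorial_succ n)).trans finProdFinEquiv.symm
      refine ⟨fun i => x' ^ ((e i).1 : ℕ) • b (e i).2, ?_⟩
      rw [eq_top_iff, ← key]
      refine Submodule.span_mono ?_
      rintro _ ⟨_, ⟨i, rfl⟩, _, ⟨j, rfl⟩, rfl⟩
      exact ⟨e.symm (i, j), by simp⟩
    · have : Subsingleton R := not_nontrivial_iff_subsingleton.1 hN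
      exact ⟨fun _ => 0, Subsingleton.elim _ _⟩

/-- Square matrix of characters evaluated at a spanning family: its columns are independent. -/
theorem eq_zero_of_forall_algHom_sum_eq_zero {N R Ω G ι : Type} [CommRing N] [CommRing R]
    [Algebra N R] [Field Ω] [Algebra N Ω] [Fintype G] [Fintype ι]
    (hcard : Fintype.card G = Fintype.card ι) (χ : G → R →ₐ[N] Ω) (hχ : Function.Injective χ)
    (b : ι → R) (hb : Submodule.span N (Set.range b) = ⊤) (c : ι → Ω)
    (hc : ∀ g, ∑ j, c j * χ g (b j) = 0) : c = 0 := by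
  classical
  let e : G ≃ ι := Fintype.equivOfCardEq hcard
  let M : Matrix ι ι Ω := fun i j => χ (e.symm i) (b j)
  have hrow : LinearIndependent Ω M.row := by
    rw [Fintype.linearIndependent_iff]
    intro w hw
    have hz : ∀ z : R, ∑ i, w i * χ (e.symm i) z = 0 := by
      intro z
      have hz : z ∈ Submodule.span N (Set.range b) := hb ▸ Submodule.mem_top
      induction hz using Submodule.span_induction with
      | mem x h =>
        obtain ⟨j, rfl⟩ := h
        simpa [M, Matrix.row] using congrFun hw j
      | zero => simp
      | add x y _ _ hx hy => simp [mul_add, Finset.sum_add_distrib, hx, hy]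
      | smul a x _ hx =>
        simp only [map_smul, Algebra.mul_smul_comm, ← Finset.smul_sum, hx, smul_zero]
    have hli := (linearIndependent_monoidHom R Ω).comp
      (fun i : ι => ((χ (e.symm i) : R →ₐ[N] Ω) : R →* Ω)) (by
        intro i j hij
        apply e.symm.injective
        apply hχ
        ext z
        exact DFunLike.congr_fun hij z)
    rw [Fintype.linearIndependent_iff] at hli
    apply hli w
    ext z
    simpa using hz z
  rw [Matrix.linearIndependent_rows_iff_isUnit] at hrow
  have : M.mulVec c = 0 := by
    ext i
    simpa [Matrix.mulVec, dotProduct, M, mul_comm] using hc (e.symm i)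
  exact (Matrix.mulVec_injective_iff_isUnit.2 hrow) (by rw [this, Matrix.mulVec_zero])

open Polynomial in
/-- `R` is generated over `N` by the roots `x i` of `p`, and every ordering of the roots of `p` in
an extension field is a specialization of `x`. -/
structure IsUniversalSplitting {N R : Type} [CommRing N] [CommRing R] [Algebra N R] {n : ℕ}
    (p : N[X]) (x : Fin n → R) : Prop where
  prod_eq : p.map (algebraMap N R) = ∏ i, (X - C (x i))
  adjoin_eq : Algebra.adjoin N (Set.range x) = ⊤
  exists_lift : ∀ (Ω : Type) [Field Ω] [Algebra N Ω] (r : Fin n → Ω),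
    p.map (algebraMap N Ω) = ∏ i, (X - C (r i)) → ∃ χ : R →ₐ[N] Ω, ∀ i, χ (x i) = r i

open Polynomial in
theorem exists_fin_roots {Ω : Type} [Field Ω] {n : ℕ} (q : Polynomial Ω) (hm : q.Monic)
    (hd : q.natDegree = n) (hs : q.Splits) : ∃ r : Fin n → Ω, q = ∏ i, (X - C (r i)) := by
  have hcard : q.roots.toList.length = n := by
    rw [Multiset.length_toList, ← hd, splits_iff_card_roots.1 hs]
  subst hcard
  refine ⟨fun i => q.roots.toList.get i, ?_⟩
  have h1 := hs.eq_prod_roots_of_monic hm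
  conv_lhs => rw [h1]
  conv_lhs => rw [← Multiset.coe_toList q.roots]
  rw [Multiset.map_coe, Multiset.prod_coe, ← List.ofFn_getElem_eq_map, List.prod_ofFn]
  simp

open Polynomial in
theorem IsUniversalSplitting.exists_characters {N R : Type} [CommRing N] [CommRing R]
    [Algebra N R] [IsDomain N] [CharZero N] [IsIntegrallyClosed N] {n : ℕ} {p : N[X]}
    {x : Fin n → R} (h : IsUniversalSplitting p x) (hp : p.Monic) (hd : p.natDegree = n)
    (δ : N) (hδ0 : δ ≠ 0)
    (hδ : algebraMap N R δ = ∏ i, ∏ j ∈ Finset.univ.erase i, (x i - x j)) :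
    Module.Free N R ∧ Module.Finite N R ∧
    ∃ (Ω : Type) (_ : Field Ω) (_ : Algebra N Ω) (χ : Equiv.Perm (Fin n) → R →ₐ[N] Ω),
      Function.Injective (algebraMap N Ω) ∧ (∀ z, (∀ σ, χ σ z = 0) → z = 0) ∧
      (∀ σ i, χ σ (x i) = χ 1 (x (σ i))) ∧
      ∀ a b : R, (∀ σ, IsIntegral N (χ σ a / χ σ b)) →
        ∀ z, ∃ m : N, algebraMap N Ω m = ∑ σ, χ σ z * (χ σ a / χ σ b) := by
  classical
  let F := FractionRing N
  let pF : F[X] := p.map (algebraMap N F)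
  let Ω := pF.SplittingField
  have : CharZero F := charZero_of_injective_algebraMap (IsFractionRing.injective N F)
  have hinj : Function.Injective (algebraMap N Ω) := by
    rw [IsScalarTower.algebraMap_eq N F Ω]
    exact (algebraMap F Ω).injective.comp (IsFractionRing.injective N F)
  have hmap : pF.map (algebraMap F Ω) = p.map (algebraMap N Ω) := by
    rw [Polynomial.map_map, ← IsScalarTower.algebraMap_eq]
  obtain ⟨r, hr⟩ := exists_fin_roots (n := n) (p.map (algebraMap N Ω)) (hp.map _)
    (by rw [hp.natDegree_map, hd]) (hmap ▸ SplittingField.splits pF)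
  have hperm : ∀ σ : Equiv.Perm (Fin n), p.map (algebraMap N Ω) = ∏ i, (X - C (r (σ i))) := by
    intro σ
    rw [hr, Equiv.prod_comp σ (fun i => X - C (r i))]
  choose χ hχ using fun σ : Equiv.Perm (Fin n) => h.exists_lift Ω (fun i => r (σ i)) (hperm σ)
  have hrinj : Function.Injective r := by
    have h1 : χ 1 (algebraMap N R δ) ≠ 0 := by
      rw [AlgHom.commutes]
      exact fun h0 => hδ0 (hinj (by rw [h0, map_zero]))
    rw [hδ, map_prod, Finset.prod_ne_zero_iff] at h1
    intro i j hij
    by_contra hne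
    have h2 := h1 i (Finset.mem_univ _)
    rw [map_prod, Finset.prod_ne_zero_iff] at h2
    exact h2 j (by simp [Ne.symm hne]) (by simp [hχ, hij])
  have hχinj : Function.Injective χ := by
    intro σ τ hst
    ext i
    have : r (σ i) = r (τ i) := by rw [← hχ, ← hχ, hst]
    rw [hrinj this]
  obtain ⟨b, hb⟩ := exists_span_eq_top_of_prod_roots n N R x p hp hd h.prod_eq h.adjoin_eq
  have hcard : Fintype.card (Equiv.Perm (Fin n)) = Fintype.card (Fin n.factorial) := by
    rw [Fintype.card_perm]; simp
  have hker : ∀ c : Fin n.factorial → N, (∀ σ, χ σ (∑ j, c j • b j) = 0) → c = 0 := by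
    intro c hc
    have := eq_zero_of_forall_algHom_sum_eq_zero hcard χ hχinj b hb
      (fun j => algebraMap N Ω (c j)) (fun σ => by
        simpa [map_sum, Algebra.smul_def] using hc σ)
    ext j
    exact hinj (by simpa using congrFun this j)
  have hli : LinearIndependent N b := by
    rw [Fintype.linearIndependent_iff]
    intro c hc
    exact fun j => congrFun (hker c (fun σ => by rw [hc, map_zero])) j
  have hfin : Module.Finite N R :=
    Module.Finite.of_basis (Module.Basis.mk hli hb.ge)
  refine ⟨Module.Free.of_basis (Module.Basis.mk hli hb.ge), hfin, Ω, inferInstance, inferInstance,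
    χ, hinj, ?_, ?_, ?_⟩
  · intro z hz
    have hzs : z ∈ Submodule.span N (Set.range b) := hb ▸ Submodule.mem_top
    obtain ⟨c, rfl⟩ := (Submodule.mem_span_range_iff_exists_fun N).1 hzs
    simp [hker c hz]
  · intro σ i
    simp [hχ]
  · intro a b hint z
    set y : Ω := ∑ σ, χ σ z * (χ σ a / χ σ b) with hy
    have hyint : IsIntegral N y := by
      refine IsIntegral.sum _ fun σ _ => IsIntegral.mul ?_ (hint σ)
      exact (Algebra.IsIntegral.isIntegral (R := N) z).map (χ σ)
    have : IsGalois F Ω := { }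
    have hfix : ∀ g : Ω ≃ₐ[F] Ω, g y = y := by
      intro g
      have hroot : ∀ i, ∃ j, g (r i) = r j := by
        intro i
        have h1 : aeval (r i) p = 0 := by
          rw [← eval_map_algebraMap, hr, eval_prod]
          exact Finset.prod_eq_zero (Finset.mem_univ i) (by simp)
        have h2 : aeval (g (r i)) p = 0 := by
          have := aeval_algHom_apply ((g : Ω →ₐ[F] Ω).restrictScalars N) (r i) p
          rw [h1, map_zero] at this
          exact this
        rw [← eval_map_algebraMap, hr, eval_prod, Finset.prod_eq_zero_iff] at h2
        obtain ⟨j, -, hj⟩ := h2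
        exact ⟨j, by simpa [sub_eq_zero] using hj⟩
      choose π hπ using hroot
      have hπinj : Function.Injective π := by
        intro i j hij
        apply hrinj
        apply g.injective
        rw [hπ, hπ, hij]
      let π' : Equiv.Perm (Fin n) := Equiv.ofBijective π (Finite.injective_iff_bijective.1 hπinj)
      have hcomp : ∀ σ w, g (χ σ w) = χ (π' * σ) w := by
        intro σ w
        have : ((g : Ω →ₐ[F] Ω).restrictScalars N).comp (χ σ) = χ (π' * σ) := by
          apply AlgHom.ext_of_adjoin_eq_top h.adjoin_eq
          rintro _ ⟨i, rfl⟩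
          simp [hχ, hπ, π']
        exact DFunLike.congr_fun this w
      rw [hy, map_sum]
      simp only [map_mul, map_div₀, hcomp]
      exact Fintype.sum_equiv (Equiv.mulLeft π') _ _ (fun σ => rfl)
    have hmem := (IsGalois.mem_bot_iff_fixed (F := F) (E := Ω) y).2 hfix
    obtain ⟨f, hf⟩ := IntermediateField.mem_bot.1 hmem
    have hfint : IsIntegral N f := by
      rw [← hf] at hyint
      exact (isIntegral_algebraMap_iff (algebraMap F Ω).injective).1 hyint
    obtain ⟨m, hm⟩ := IsIntegrallyClosed.isIntegral_iff.1 hfint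
    exact ⟨m, by rw [IsScalarTower.algebraMap_apply N F Ω, hm, hf]⟩

theorem Equiv.Perm.eq_one_of_forall_le {n : ℕ} (π : Equiv.Perm (Fin n)) (h : ∀ i, π i ≤ i) :
    π = 1 := by
  ext i
  congr 1
  induction i using WellFoundedLT.induction with
  | ind i ih =>
    rcases (h i).lt_or_eq with hlt | heq
    · exact absurd (π.injective (ih _ hlt)) hlt.ne
    · exact heq

/-- The product of the differences `y j - y i` over `i < j`. -/
noncomputable def prodDiffs {R : Type} [CommRing R] {n : ℕ} (y : Fin n → R) : R :=
  ∏ i, ∏ j ∈ Finset.univ.filter (i < ·), (y j - y i)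

open scoped TensorProduct in
theorem dvd_prodDiffs_mul {N R Ω : Type} [CommRing N] [CommRing R] [Algebra N R] [Field Ω]
    [Algebra N Ω] {n : ℕ} (x : Fin n → R) (χ : Equiv.Perm (Fin n) → R →ₐ[N] Ω)
    (hker : ∀ z, (∀ σ, χ σ z = 0) → z = 0) (hχ : ∀ σ i, χ σ (x i) = χ 1 (x (σ i)))
    (a b : R) (hb : ∀ σ, χ σ b ≠ 0)
    (h : ∀ z, ∃ m : N, algebraMap N Ω m = ∑ σ, χ σ z * (χ σ a / χ σ b)) :
    b ∣ prodDiffs x * a := by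
  classical
  have key : ∀ f : R ⊗[N] R, ∃ w : R, ∀ τ, χ τ w =
      ∑ σ, Algebra.TensorProduct.productMap (χ τ) (χ σ) f * (χ σ a / χ σ b) := by
    intro f
    induction f using TensorProduct.induction_on with
    | zero => exact ⟨0, fun τ => by simp⟩
    | tmul u v =>
      obtain ⟨m, hm⟩ := h v
      refine ⟨u * algebraMap N R m, fun τ => ?_⟩
      rw [map_mul, AlgHom.commutes, hm, Finset.mul_sum]
      exact Finset.sum_congr rfl fun σ _ => by
        rw [Algebra.TensorProduct.productMap_apply_tmul, mul_assoc]
    | add f g hf hg =>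
      obtain ⟨w, hw⟩ := hf
      obtain ⟨w', hw'⟩ := hg
      exact ⟨w + w', fun τ => by
        rw [map_add, hw, hw', ← Finset.sum_add_distrib]
        exact Finset.sum_congr rfl fun σ _ => by rw [map_add, add_mul]⟩
  obtain ⟨w, hw⟩ := key (∏ i, ∏ j ∈ Finset.univ.filter (i < ·), (x j ⊗ₜ 1 - 1 ⊗ₜ x i))
  refine ⟨w, ?_⟩
  rw [← sub_eq_zero]
  refine hker _ fun τ => ?_
  rw [map_sub, map_mul, map_mul, hw, Finset.sum_eq_single τ]
  · simp only [map_prod, map_sub, Algebra.TensorProduct.productMap_apply_tmul, map_one, mul_one,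
      one_mul, prodDiffs]
    field_simp [hb τ]
    simp
  · intro σ _ hσ
    have : ∃ i, i < (τ⁻¹ * σ) i := by
      by_contra! hle
      exact hσ (inv_mul_eq_one.1 (Equiv.Perm.eq_one_of_forall_le _ hle)).symm
    obtain ⟨i, hi⟩ := this
    rw [map_prod, Finset.prod_eq_zero (Finset.mem_univ i), zero_mul]
    rw [map_prod, Finset.prod_eq_zero (i := (τ⁻¹ * σ) i) (by simpa using hi)]
    rw [map_sub, Algebra.TensorProduct.productMap_apply_tmul,
      Algebra.TensorProduct.productMap_apply_tmul, hχ τ, hχ σ i]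
    simp
  · simp

open Polynomial in
theorem IsUniversalSplitting.dvd_of_isIntegral {N R : Type} [CommRing N] [CommRing R]
    [Algebra N R] [IsDomain N] [CharZero N] [IsIntegrallyClosed N] {n : ℕ} {p : N[X]}
    {x : Fin n → R} (h : IsUniversalSplitting p x) (hp : p.Monic) (hd : p.natDegree = n)
    (δ : N) (hδ0 : δ ≠ 0)
    (hδ : algebraMap N R δ = ∏ i, ∏ j ∈ Finset.univ.erase i, (x i - x j))
    (a : R) (b : nonZeroDivisors R)
    (hint : IsIntegral R (IsLocalization.mk' (FractionRing R) a b)) :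
    (b : R) ∣ prodDiffs x * a := by
  obtain ⟨_, _, Ω, _, _, χ, hinj, hker, hχ, hm⟩ := h.exists_characters hp hd δ hδ0 hδ
  have hunit : ∀ σ (c : nonZeroDivisors R), χ σ c ≠ 0 := by
    intro σ c
    obtain ⟨r, hr0, hr⟩ :=
      (Algebra.IsIntegral.isIntegral (R := N) (c : R)).isAlgebraic.exists_nonzero_dvd c.2
    obtain ⟨e, he⟩ := hr
    intro hc
    apply hr0
    apply hinj
    rw [← (χ σ).commutes, he, map_mul, hc, zero_mul, map_zero]
  have hN : IsIntegral N (IsLocalization.mk' (FractionRing R) a b) := isIntegral_trans _ hint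
  refine dvd_prodDiffs_mul x χ hker hχ a b (fun σ => hunit σ b)
    (hm a b fun σ => ?_)
  let ψ : FractionRing R →ₐ[N] Ω :=
    IsLocalization.liftAlgHom (M := nonZeroDivisors R) (f := χ σ) (fun c => (hunit σ c).isUnit)
  have hψ : ψ (IsLocalization.mk' (FractionRing R) a b) = χ σ a / χ σ b := by
    rw [eq_div_iff (hunit σ b)]
    have : ψ (algebraMap R (FractionRing R) b) = χ σ b := by simp [ψ]
    rw [← this, ← map_mul, IsLocalization.mk'_spec]
    simp [ψ]
  rw [← hψ]
  exact hN.map ψ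

theorem dvd_of_dvd_mul_of_isRelPrime {N R : Type} [CommRing N] [CommRing R] [Algebra N R]
    [IsDomain N] [UniqueFactorizationMonoid N] [Module.Free N R] {δ D : N} (hD : D ≠ 0)
    (hrel : IsRelPrime δ D) {a b : R} (hb : b ∈ nonZeroDivisors R)
    (h₁ : b ∣ algebraMap N R δ * a) (h₂ : b ∣ algebraMap N R D * a) : b ∣ a := by
  obtain ⟨y, hy⟩ := h₁
  obtain ⟨z, hz⟩ := h₂
  have hyz : D • y = δ • z := by
    rw [Algebra.smul_def, Algebra.smul_def]
    refine (mul_cancel_left_mem_nonZeroDivisors hb).1 ?_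
    linear_combination (-algebraMap N R D) * hy + algebraMap N R δ * hz
  let B := Module.Free.chooseBasis N R
  have hdvd : ∀ i, D ∣ B.repr z i := by
    intro i
    refine hrel.symm.dvd_of_dvd_mul_left (z := B.repr z i) (y := δ) ⟨B.repr y i, ?_⟩
    have := congrArg (fun w => B.repr w i) hyz
    simpa using this.symm
  choose c hc using hdvd
  have hw : ∃ w, z = D • w := by
    refine ⟨∑ i ∈ (B.repr z).support, c i • B i, ?_⟩
    conv_lhs => rw [← B.linearCombination_repr z]
    rw [Finsupp.linearCombination_apply, Finsupp.sum, Finset.smul_sum]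
    exact Finset.sum_congr rfl fun i _ => by rw [smul_smul, ← hc]
  obtain ⟨w, rfl⟩ := hw
  refine ⟨w, ?_⟩
  have : D • a = D • (b * w) := by
    rw [Algebra.smul_def, hz, Algebra.mul_smul_comm]
  exact smul_right_injective R hD this

open Polynomial in
theorem isDomain_and_isIntegrallyClosed_of_isIdempotentElem {N R : Type} [CommRing N] [CommRing R]
    [Algebra N R] [IsDomain N] [Module.Free N R] [Algebra.IsIntegral N R] [Nontrivial R]
    [IsReduced R] (hidem : ∀ e : R, IsIdempotentElem e → e = 0 ∨ e = 1)
    (hdvd : ∀ (a : R) (b : nonZeroDivisors R),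
      IsIntegral R (IsLocalization.mk' (FractionRing R) a b) → (b : R) ∣ a) :
    IsDomain R ∧ IsIntegrallyClosed R := by
  have hnzd : ∀ n : N, n ≠ 0 → algebraMap N R n ∈ nonZeroDivisors R := by
    intro n hn
    rw [mem_nonZeroDivisors_iff_right]
    intro r hr
    rw [mul_comm, ← Algebra.smul_def] at hr
    exact smul_right_injective R hn (by simpa using hr)
  have hdom : IsDomain R := by
    have : NoZeroDivisors R := by
      refine ⟨fun {a a'} haa' => or_iff_not_imp_left.2 fun ha => ?_⟩
      obtain ⟨g, hgm, hg⟩ := Algebra.IsIntegral.isIntegral (R := N) a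
      obtain ⟨h, hgh, hX⟩ := exists_eq_pow_rootMultiplicity_mul_and_not_dvd g hgm.ne_zero 0
      rw [C_0, sub_zero] at hgh hX
      rw [X_dvd_iff] at hX
      set m := rootMultiplicity 0 g
      have hah : a * aeval a h = 0 := by
        have h1 : a ^ m * aeval a h = 0 := by
          have : aeval a g = 0 := hg
          rw [hgh] at this
          simpa using this
        refine eq_zero_of_pow_eq_zero (n := m + 1) ?_
        calc (a * aeval a h) ^ (m + 1) = (a ^ m * aeval a h) * (a * aeval a h ^ m) := by ring
          _ = 0 := by rw [h1, zero_mul]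
      set c : R := algebraMap N R (h.coeff 0)
      have hc := hnzd _ hX
      set w := aeval a h.divX
      have hw : aeval a h = a * w + c := by
        have h2 := congrArg (aeval a) (divX_mul_X_add h)
        rw [← h2, map_add, map_mul, aeval_X, aeval_C, mul_comm]
      rw [hw] at hah
      have hint : IsIntegral R (IsLocalization.mk' (FractionRing R) (-(a * w)) ⟨c, hc⟩) := by
        refine ⟨X ^ 2 - X, ?_, ?_⟩
        · apply monic_X_pow_sub
          simp
        · simp only [eval₂_sub, eval₂_X_pow, eval₂_X, sub_eq_zero]
          rw [pow_two, ← IsLocalization.mk'_mul, IsLocalization.mk'_eq_iff_eq]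
          congr 1
          simp only [Submonoid.mk_mul_mk]
          linear_combination (w * c) * hah
      obtain ⟨e, he⟩ := hdvd _ _ hint
      simp only at he
      have hcancel : ∀ u v : R, c * u = c * v → u = v := fun u v huv =>
        (mul_cancel_left_mem_nonZeroDivisors hc).1 huv
      have hee : IsIdempotentElem e := by
        apply hcancel
        apply hcancel
        linear_combination w * hah - (c * e - a * w - c) * he
      rcases hidem e hee with rfl | rfl
      · refine absurd (hcancel a 0 ?_) ha
        linear_combination hah + a * he
      · apply hcancel
        linear_combination (-w) * haa' - a' * he
    exact NoZeroDivisors.to_isDomain R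
  refine ⟨hdom, (isIntegrallyClosed_iff (FractionRing R)).2 fun {y} hy => ?_⟩
  obtain ⟨a, b, rfl⟩ := IsLocalization.exists_mk'_eq (nonZeroDivisors R) y
  obtain ⟨c, hc⟩ := hdvd a b hy
  refine ⟨c, ?_⟩
  rw [IsLocalization.eq_mk'_iff_mul_eq, ← map_mul, hc, mul_comm]

open Polynomial in
/-- The discriminant of a split monic polynomial is a universal polynomial in its coefficients. -/
theorem exists_mvPolynomial_discriminant (n : ℕ) : ∃ Q : MvPolynomial (Fin n) ℤ,
    ∀ (A : Type) [CommRing A] (y : Fin n → A) (p : A[X]), p = ∏ i, (X - C (y i)) →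
      MvPolynomial.aeval (fun i : Fin n => p.coeff i) Q =
        ∏ i, ∏ j ∈ Finset.univ.erase i, (y i - y j) := by
  let P : MvPolynomial (Fin n) ℤ :=
    ∏ i, ∏ j ∈ Finset.univ.erase i, (MvPolynomial.X i - MvPolynomial.X j)
  have hP : P.IsSymmetric := by
    intro σ
    simp only [P, map_prod, map_sub, MvPolynomial.rename_X]
    refine Fintype.prod_equiv σ _ _ fun i => ?_
    refine Finset.prod_bij (fun j _ => σ j) ?_ ?_ ?_ ?_
    · simp
    · simp
    · intro j hj
      exact ⟨σ.symm j, by simpa [Equiv.symm_apply_eq] using hj, by simp⟩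
    · simp
  obtain ⟨Q, hQ⟩ := MvPolynomial.esymmAlgHom_surjective (R := ℤ) (σ := Fin n) (n := n) (by simp)
    ⟨P, hP⟩
  have hQ' : MvPolynomial.aeval (fun i : Fin n => MvPolynomial.esymm (Fin n) ℤ (i + 1)) Q = P := by
    rw [← MvPolynomial.esymmAlgHom_apply, hQ]
  refine ⟨MvPolynomial.aeval (fun i : Fin n => (-1) ^ ((i : ℕ) + 1) * MvPolynomial.X (Fin.rev i)) Q,
    ?_⟩
  intro A _ y p hp
  have hcoef : ∀ i : Fin n, (-1) ^ ((i : ℕ) + 1) * p.coeff (Fin.rev i) =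
      MvPolynomial.aeval y (MvPolynomial.esymm (Fin n) ℤ (i + 1)) := by
    intro i
    have h1 : p = ∏ j, (X + C (-y j)) := by rw [hp]; simp [sub_eq_add_neg]
    rw [h1, Finset.prod_X_add_C_coeff _ _ (by simp)]
    have h2 : (Finset.univ : Finset (Fin n)).card - (Fin.rev i : ℕ) = i + 1 := by
      simp [Fin.val_rev]; omega
    rw [h2, MvPolynomial.esymm, map_sum, Finset.mul_sum]
    refine Finset.sum_congr rfl fun t ht => ?_
    rw [Finset.prod_neg, (Finset.mem_powersetCard.1 ht).2, ← mul_assoc, ← mul_pow]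
    simp
  have h3 : (MvPolynomial.aeval fun i : Fin n => p.coeff i)
      (MvPolynomial.aeval (fun i : Fin n =>
        (-1) ^ ((i : ℕ) + 1) * MvPolynomial.X (R := ℤ) (Fin.rev i)) Q) =
      MvPolynomial.aeval y (MvPolynomial.aeval
        (fun i : Fin n => MvPolynomial.esymm (Fin n) ℤ (i + 1)) Q) := by
    rw [← AlgHom.comp_apply, ← AlgHom.comp_apply]
    congr 1
    apply MvPolynomial.algHom_ext
    intro i
    simpa using hcoef i
  rw [h3, hQ']
  simp [P]

/-- The `n`-th elementary symmetric function of a finite family. -/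
def esymmFamily {C : Type} [CommRing C] {d : ℕ} (n : ℕ) (y : Fin d → C) : C :=
  ∑ t ∈ Finset.powersetCard n (Finset.univ : Finset (Fin d)), ∏ i ∈ t, y i

theorem map_esymmFamily {C C' G : Type} [CommRing C] [CommRing C'] [FunLike G C C']
    [RingHomClass G C C'] (g : G) {d : ℕ} (n : ℕ) (y : Fin d → C) :
    g (esymmFamily n y) = esymmFamily n (fun i => g (y i)) := by
  simp [esymmFamily, map_sum, map_prod]

theorem esymmFamily_const_mul {C : Type} [CommRing C] {d : ℕ} (n : ℕ) (s : C) (y : Fin d → C) :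
    esymmFamily n (fun i => s * y i) = s ^ n * esymmFamily n y := by
  rw [esymmFamily, esymmFamily, Finset.mul_sum]
  refine Finset.sum_congr rfl fun t ht => ?_
  rw [Finset.prod_mul_distrib, Finset.prod_const, (Finset.mem_powersetCard.1 ht).2]

theorem esymmFamily_one {C : Type} [CommRing C] {d : ℕ} (y : Fin d → C) :
    esymmFamily 1 y = ∑ i, y i := by
  simp [esymmFamily, Finset.powersetCard_one]

open Polynomial in
theorem coeff_prod_X_sub_C {C : Type} [CommRing C] {d : ℕ} (y : Fin d → C) {j : ℕ} (hj : j ≤ d) :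
    (∏ i, (X - Polynomial.C (y i))).coeff j = (-1) ^ (d - j) * esymmFamily (d - j) y := by
  have h := Finset.prod_X_add_C_coeff Finset.univ (fun i => -1 * y i) (k := j) (by simpa using hj)
  have h2 := esymmFamily_const_mul (d - j) (-1) y
  rw [← h2, esymmFamily]
  simpa [sub_eq_add_neg] using h

/-- The relations imposed on the generators `K`, `E`, `X`, `Y`. -/
structure CharPolyRelations {C : Type} [CommRing C] {d : ℕ} (K E : Fin d → C) (X Y : C) :
    Prop where
  left_one : esymmFamily 1 K = 0
  right_one : esymmFamily 1 E = 0
  middle : ∀ i, 2 ≤ i → i ≤ d - 1 → esymmFamily i K = esymmFamily i E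
  top : esymmFamily d K = esymmFamily d E + (-1) ^ d * X * Y

theorem CharPolyRelations.symm {C : Type} [CommRing C] {d : ℕ} {K E : Fin d → C} {X Y : C}
    (h : CharPolyRelations K E X Y) : CharPolyRelations E K (-X) Y where
  left_one := h.right_one
  right_one := h.left_one
  middle i hi hi' := (h.middle i hi hi').symm
  top := by rw [h.top]; ring

open Polynomial in
theorem CharPolyRelations.prod_eq {C : Type} [CommRing C] {d : ℕ} (hd : 2 ≤ d) {K E : Fin d → C}
    {x y : C} (h : CharPolyRelations K E x y) :
    ∏ i, (X - Polynomial.C (K i)) = ∏ i, (X - Polynomial.C (E i)) + Polynomial.C (x * y) := by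
  ext j
  rw [coeff_add, coeff_C]
  rcases lt_or_ge d j with hj | hj
  · rw [coeff_eq_zero_of_natDegree_lt, coeff_eq_zero_of_natDegree_lt, if_neg (by omega), add_zero]
    all_goals exact (natDegree_prod_le _ _).trans_lt ((Finset.sum_le_card_nsmul _ _ 1
      fun i _ => natDegree_X_sub_C_le _).trans_lt (by simpa using hj))
  · rw [coeff_prod_X_sub_C _ hj, coeff_prod_X_sub_C _ hj]
    rcases Nat.eq_zero_or_pos j with rfl | h0
    · rw [Nat.sub_zero, h.top, if_pos rfl, mul_add, ← mul_assoc, ← mul_assoc, ← mul_pow]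
      simp
    · rw [if_neg h0.ne', add_zero]
      rcases Nat.lt_or_ge (d - j) 2 with h2 | h2
      · interval_cases d - j
        · simp [esymmFamily]
        · rw [h.left_one, h.right_one]
      · rw [h.middle _ h2 (by omega)]

open Polynomial in
theorem CharPolyRelations.of_prod_eq {C : Type} [CommRing C] {d : ℕ} (hd : 2 ≤ d)
    {K E : Fin d → C} {x y : C} (hE : ∑ i, E i = 0)
    (h : ∏ i, (X - Polynomial.C (K i)) = ∏ i, (X - Polynomial.C (E i)) + Polynomial.C (x * y)) :
    CharPolyRelations K E x y := by
  have hcoef : ∀ i, i ≤ d → esymmFamily i K =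
      esymmFamily i E + if i = d then (-1) ^ d * x * y else 0 := by
    intro i hi
    have h1 := congrArg (fun q => (-1) ^ i * q.coeff (d - i)) h
    simp only [coeff_add, coeff_C, coeff_prod_X_sub_C _ (Nat.sub_le d i), Nat.sub_sub_self hi,
      mul_add, ← mul_assoc, ← mul_pow] at h1
    simp only [mul_neg, mul_one, neg_neg, one_pow, one_mul] at h1
    rw [h1]
    by_cases hid : i = d
    · subst hid; simp [mul_assoc]
    · rw [if_neg hid, if_neg (by omega), mul_zero]
  have hE' : esymmFamily 1 E = 0 := by rw [esymmFamily_one, hE]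
  refine ⟨?_, hE', fun i _ hi' => ?_, ?_⟩
  · rw [hcoef 1 (by omega), if_neg (by omega), hE', add_zero]
  · rw [hcoef i (by omega), if_neg (by omega), add_zero]
  · rw [hcoef d le_rfl, if_pos rfl]

/-- `R` is the universal `k`-algebra generated by a solution of the relations. -/
structure IsUniversalCharPoly (k : Type) {R : Type} [Field k] [CommRing R] [Algebra k R] {d : ℕ}
    (K E : Fin d → R) (X Y : R) : Prop where
  rel : CharPolyRelations K E X Y
  adjoin_eq : Algebra.adjoin k (Set.range K ∪ Set.range E ∪ {X, Y}) = ⊤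
  exists_lift : ∀ (C : Type) [CommRing C] [Algebra k C] (K' E' : Fin d → C) (X' Y' : C),
    CharPolyRelations K' E' X' Y' → ∃ φ : R →ₐ[k] C, (∀ i, φ (K i) = K' i) ∧
      (∀ i, φ (E i) = E' i) ∧ φ X = X' ∧ φ Y = Y'

theorem IsUniversalCharPoly.symm {k R : Type} [Field k] [CommRing R] [Algebra k R] {d : ℕ}
    {K E : Fin d → R} {X Y : R} (h : IsUniversalCharPoly k K E X Y) :
    IsUniversalCharPoly k E K (-X) Y where
  rel := h.rel.symm
  adjoin_eq := by
    rw [eq_top_iff, ← h.adjoin_eq, Algebra.adjoin_le_iff]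
    rintro z ((hz | hz) | hz | hz)
    · exact Algebra.subset_adjoin (.inl (.inr hz))
    · exact Algebra.subset_adjoin (.inl (.inl hz))
    · have hX : -X ∈ Algebra.adjoin k (Set.range E ∪ Set.range K ∪ {-X, Y}) :=
        Algebra.subset_adjoin (.inr (.inl rfl))
      simpa [hz] using neg_mem hX
    · exact Algebra.subset_adjoin (.inr (.inr hz))
  exists_lift C _ _ K' E' X' Y' h' := by
    obtain ⟨φ, hK, hE, hX, hY⟩ := h.exists_lift C E' K' (-X') Y' h'.symm
    exact ⟨φ, hE, hK, by rw [map_neg, hX, neg_neg], hY⟩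

open Polynomial in
theorem isIdempotentElem_polynomial_eq_C {R : Type} [CommRing R] {f : R[X]}
    (hf : IsIdempotentElem f) : f = Polynomial.C (f.coeff 0) := by
  have h0 : IsIdempotentElem (Polynomial.C (f.coeff 0)) := by
    rw [IsIdempotentElem, ← C_mul, ← mul_coeff_zero, hf.eq]
  set g := f - Polynomial.C (f.coeff 0) with hg
  have hg3 : g ^ 3 = g := by
    rw [hg]
    have h1 := hf.eq
    have h2 := h0.eq
    generalize Polynomial.C (f.coeff 0) = c at *
    linear_combination (f + 1 - 3 * c) * h1 + (3 * f - c - 1) * h2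
  have hX : X ∣ g := by rw [X_dvd_iff, hg]; simp
  have hpow : ∀ n : ℕ, X ^ (n + 1) ∣ g := by
    intro n
    induction n with
    | zero => simpa using hX
    | succ n ih =>
      rw [← hg3]
      calc X ^ (n + 1 + 1) = X ^ (n + 1) * X := pow_succ _ _
        _ ∣ g * g := mul_dvd_mul ih hX
        _ ∣ g ^ 3 := ⟨g, by ring⟩
  have hz : g = 0 := by
    ext n
    exact X_pow_dvd_iff.1 (hpow n) n (Nat.lt_succ_self n)
  exact sub_eq_zero.1 hz

open Polynomial in
theorem IsUniversalCharPoly.nontrivial {k R : Type} [Field k] [CommRing R] [Algebra k R] {d : ℕ}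
    (hd : 2 ≤ d) {K E : Fin d → R} {x y : R} (h : IsUniversalCharPoly k K E x y) :
    Nontrivial R := by
  obtain ⟨φ, -⟩ := h.exists_lift k (fun _ => 0) (fun _ => 0) 0 0
    (.of_prod_eq hd (by simp) (by simp))
  exact φ.toRingHom.domain_nontrivial

open Polynomial in
theorem IsUniversalCharPoly.eq_zero_or_eq_one {k R : Type} [Field k] [CommRing R] [Algebra k R]
    {d : ℕ} (hd : 2 ≤ d) {K E : Fin d → R} {x y : R} (h : IsUniversalCharPoly k K E x y)
    (e : R) (he : IsIdempotentElem e) : e = 0 ∨ e = 1 := by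
  have := h.nontrivial hd
  have hC : ∀ n (w : Fin d → R), esymmFamily n (fun i => (X : R[X]) ^ 2 * Polynomial.C (w i)) =
      X ^ (2 * n) * Polynomial.C (esymmFamily n w) := by
    intro n w
    rw [esymmFamily_const_mul, map_esymmFamily, pow_mul]
  have hrel : CharPolyRelations (fun i => (X : R[X]) ^ 2 * Polynomial.C (K i))
      (fun i => X ^ 2 * Polynomial.C (E i)) (X ^ d * Polynomial.C x) (X ^ d * Polynomial.C y) := by
    refine ⟨?_, ?_, fun i hi hi' => ?_, ?_⟩
    · rw [hC, h.rel.left_one]; simp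
    · rw [hC, h.rel.right_one]; simp
    · rw [hC, hC, h.rel.middle i hi hi']
    · rw [hC, hC, h.rel.top]
      simp only [map_add, map_mul, map_pow, map_neg, map_one]
      ring
  obtain ⟨φ, hφK, hφE, hφx, hφy⟩ := h.exists_lift _ _ _ _ _ hrel
  have hd0 : d ≠ 0 := by omega
  have h1 : ∀ z, (φ z).eval 1 = z := by
    intro z
    have : ((aeval (1 : R)).restrictScalars k).comp φ = AlgHom.id k R := by
      apply AlgHom.ext_of_adjoin_eq_top h.adjoin_eq
      rintro _ ((⟨i, rfl⟩ | ⟨i, rfl⟩) | rfl | rfl) <;> simp [hφK, hφE, hφx, hφy]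
    simpa [aeval_def, eval₂_eq_eval_map] using DFunLike.congr_fun this z
  have h0 : ∀ z, ∃ c : k, (φ z).eval 0 = algebraMap k R c := by
    intro z
    have hz : z ∈ Algebra.adjoin k (Set.range K ∪ Set.range E ∪ {x, y}) :=
      h.adjoin_eq ▸ Algebra.mem_top
    induction hz using Algebra.adjoin_induction with
    | mem z hz =>
      refine ⟨0, ?_⟩
      obtain ((⟨i, rfl⟩ | ⟨i, rfl⟩) | rfl | rfl) := hz <;> simp [hφK, hφE, hφx, hφy, hd0]
    | algebraMap c =>
      exact ⟨c, by rw [AlgHom.commutes, IsScalarTower.algebraMap_apply k R R[X]]; simp⟩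
    | add z w _ _ hz hw =>
      obtain ⟨c, hc⟩ := hz
      obtain ⟨c', hc'⟩ := hw
      exact ⟨c + c', by simp [hc, hc']⟩
    | mul z w _ _ hz hw =>
      obtain ⟨c, hc⟩ := hz
      obtain ⟨c', hc'⟩ := hw
      exact ⟨c * c', by simp [hc, hc']⟩
  have hconst := isIdempotentElem_polynomial_eq_C (he.map φ)
  obtain ⟨c, hc⟩ := h0 e
  have hec : e = algebraMap k R c := by
    rw [← hc, ← coeff_zero_eq_eval_zero]
    conv_lhs => rw [← h1 e, hconst, eval_C]
  have hcc : IsIdempotentElem c := by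
    apply (algebraMap k R).injective
    rw [map_mul, ← hec, he.eq]
  rcases IsIdempotentElem.iff_eq_zero_or_one.1 hcc with rfl | rfl
  · left; rw [hec, map_zero]
  · right; rw [hec, map_one]

/-- The coefficients of the `m + 1` linear forms `-∑ X j, X 0, …, X (m - 1)` of sum zero. -/
noncomputable def zeroSumCoeffs (k : Type) [Field k] (m : ℕ) : Fin (m + 1) → (Fin m ⊕ Bool →₀ k) :=
  Fin.cons (-∑ j, Finsupp.single (Sum.inl j) 1) fun j => Finsupp.single (Sum.inl j) 1

theorem sum_zeroSumCoeffs (k : Type) [Field k] (m : ℕ) : ∑ i, zeroSumCoeffs k m i = 0 := by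
  rw [Fin.sum_univ_succ]; simp [zeroSumCoeffs]

theorem zeroSumCoeffs_injective (k : Type) [Field k] [CharZero k] (m : ℕ) :
    Function.Injective (zeroSumCoeffs k m) := by
  have h0 : ∀ j a : Fin m, zeroSumCoeffs k m j.succ (Sum.inl a) = if j = a then 1 else 0 := by
    intro j a
    simp [zeroSumCoeffs, Finsupp.single_apply]
  have h1 : ∀ a : Fin m, zeroSumCoeffs k m 0 (Sum.inl a) = -1 := by
    intro a
    simp [zeroSumCoeffs, Finsupp.single_apply]
  have h2 : (1 : k) ≠ -1 := by norm_num
  intro i j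
  refine Fin.cases ?_ (fun i => ?_) i <;> refine Fin.cases ?_ (fun j => ?_) j
  · simp
  · intro h
    have := DFunLike.congr_fun h (Sum.inl j)
    rw [h1, h0, if_pos rfl] at this
    exact absurd this.symm h2
  · intro h
    have := DFunLike.congr_fun h (Sum.inl i)
    rw [h1, h0, if_pos rfl] at this
    exact absurd this h2
  · intro h
    have := DFunLike.congr_fun h (Sum.inl j)
    rw [h0, h0, if_pos rfl] at this
    by_contra hne
    rw [if_neg (fun h => hne (by rw [h]))] at this
    exact one_ne_zero this.symm

/-- Linear forms of sum zero in `m` variables. -/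
noncomputable def zeroSumForm (k : Type) [Field k] (m : ℕ) (i : Fin (m + 1)) :
    MvPolynomial (Fin m ⊕ Bool) k :=
  MvPolynomial.sumSMulX (zeroSumCoeffs k m i)

theorem zeroSumForm_succ (k : Type) [Field k] (m : ℕ) (j : Fin m) :
    zeroSumForm k m j.succ = MvPolynomial.X (Sum.inl j) := by
  simp [zeroSumForm, zeroSumCoeffs, MvPolynomial.sumSMulX]

theorem sum_zeroSumForm (k : Type) [Field k] (m : ℕ) : ∑ i, zeroSumForm k m i = 0 := by
  simp only [zeroSumForm]
  rw [← map_sum, sum_zeroSumCoeffs, map_zero]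

theorem irreducible_zeroSumForm_sub (k : Type) [Field k] [CharZero k] (m : ℕ) {i j : Fin (m + 1)}
    (hij : i ≠ j) : Irreducible (zeroSumForm k m i - zeroSumForm k m j) := by
  rw [zeroSumForm, zeroSumForm, ← map_sub]
  have hne : zeroSumCoeffs k m i - zeroSumCoeffs k m j ≠ 0 :=
    sub_ne_zero.2 ((zeroSumCoeffs_injective k m).ne hij)
  apply MvPolynomial.irreducible_sumSMulX
  · rwa [Finsupp.support_nonempty_iff]
  · intro r hr
    obtain ⟨a, ha⟩ := Finsupp.ne_iff.1 hne
    exact isUnit_of_dvd_unit (hr a) (isUnit_iff_ne_zero.2 ha)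

open Polynomial in
/-- The polynomial `∏ (T - E i) + X * Y` over the polynomial ring in `E`, `X`, `Y`. -/
noncomputable def shiftedPoly (k : Type) [Field k] (m : ℕ) :
    Polynomial (MvPolynomial (Fin m ⊕ Bool) k) :=
  ∏ i, (X - C (zeroSumForm k m i)) +
    C (MvPolynomial.X (Sum.inr true) * MvPolynomial.X (Sum.inr false))

open Polynomial in
theorem shiftedPoly_monic_natDegree (k : Type) [Field k] (m : ℕ) :
    (shiftedPoly k m).Monic ∧ (shiftedPoly k m).natDegree = m + 1 := by
  set q : Polynomial (MvPolynomial (Fin m ⊕ Bool) k) := ∏ i, (X - C (zeroSumForm k m i)) with hq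
  have hqm : q.Monic := monic_prod_X_sub_C _ _
  have hqd : q.natDegree = m + 1 := by
    rw [hq, natDegree_finsetProd_X_sub_C_eq_card]; simp
  have hlt : (C (MvPolynomial.X (R := k) (Sum.inr true : Fin m ⊕ Bool) *
      MvPolynomial.X (Sum.inr false))).degree < q.degree := by
    refine degree_C_le.trans_lt ?_
    rw [degree_eq_natDegree hqm.ne_zero, hqd]
    exact_mod_cast Nat.succ_pos m
  refine ⟨hqm.add_of_left hlt, ?_⟩
  rw [shiftedPoly, natDegree_add_eq_left_of_degree_lt hlt, hqd]

open Polynomial in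
theorem map_shiftedPoly {k A : Type} [Field k] [CommRing A] {m : ℕ}
    (f : MvPolynomial (Fin m ⊕ Bool) k →+* A) : (shiftedPoly k m).map f =
      ∏ i, (X - Polynomial.C (f (zeroSumForm k m i))) +
        Polynomial.C (f (MvPolynomial.X (Sum.inr true)) * f (MvPolynomial.X (Sum.inr false))) := by
  simp [shiftedPoly, Polynomial.map_prod]

open Polynomial in
theorem IsUniversalCharPoly.isUniversalSplitting {k R : Type} [Field k] [CommRing R] [Algebra k R]
    {m : ℕ} (hm : 1 ≤ m) {K E : Fin (m + 1) → R} {x y : R} (h : IsUniversalCharPoly k K E x y)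
    [Algebra (MvPolynomial (Fin m ⊕ Bool) k) R] [IsScalarTower k (MvPolynomial (Fin m ⊕ Bool) k) R]
    (hE : ∀ i, algebraMap (MvPolynomial (Fin m ⊕ Bool) k) R (zeroSumForm k m i) = E i)
    (hx : algebraMap (MvPolynomial (Fin m ⊕ Bool) k) R (MvPolynomial.X (Sum.inr true)) = x)
    (hy : algebraMap (MvPolynomial (Fin m ⊕ Bool) k) R (MvPolynomial.X (Sum.inr false)) = y) :
    IsUniversalSplitting (shiftedPoly k m) K where
  prod_eq := by
    rw [map_shiftedPoly, h.rel.prod_eq (by omega), hx, hy]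
    simp only [hE]
  adjoin_eq := by
    rw [eq_top_iff]
    intro z _
    have hz : z ∈ Algebra.adjoin k (Set.range K ∪ Set.range E ∪ {x, y}) :=
      h.adjoin_eq ▸ Algebra.mem_top
    have hle : Algebra.adjoin k (Set.range K ∪ Set.range E ∪ {x, y}) ≤
        (Algebra.adjoin (MvPolynomial (Fin m ⊕ Bool) k) (Set.range K)).restrictScalars k := by
      rw [Algebra.adjoin_le_iff]
      rintro _ ((⟨i, rfl⟩ | ⟨i, rfl⟩) | rfl | rfl)
      · exact Algebra.subset_adjoin ⟨i, rfl⟩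
      · rw [← hE]; exact (Algebra.adjoin (MvPolynomial (Fin m ⊕ Bool) k) (Set.range K)).algebraMap_mem _
      · rw [← hx]; exact (Algebra.adjoin (MvPolynomial (Fin m ⊕ Bool) k) (Set.range K)).algebraMap_mem _
      · rw [← hy]; exact (Algebra.adjoin (MvPolynomial (Fin m ⊕ Bool) k) (Set.range K)).algebraMap_mem _
    exact hle hz
  exists_lift Ω _ _ r hr := by
    let _ : Algebra k Ω := ((algebraMap (MvPolynomial (Fin m ⊕ Bool) k) Ω).comp
      (algebraMap k (MvPolynomial (Fin m ⊕ Bool) k))).toAlgebra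
    have : IsScalarTower k (MvPolynomial (Fin m ⊕ Bool) k) Ω := .of_algebraMap_eq' rfl
    rw [map_shiftedPoly] at hr
    obtain ⟨φ, hφK, hφE, hφx, hφy⟩ := h.exists_lift Ω r _ _ _
      (.of_prod_eq (by omega) (by rw [← map_sum, sum_zeroSumForm, map_zero]) hr.symm)
    have hcomm : φ.comp (IsScalarTower.toAlgHom k (MvPolynomial (Fin m ⊕ Bool) k) R) =
        IsScalarTower.toAlgHom k (MvPolynomial (Fin m ⊕ Bool) k) Ω := by
      apply MvPolynomial.algHom_ext
      rintro (j | _ | _)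
      · simp [← zeroSumForm_succ, hE, hφE]
      · simp [hy, hφy]
      · simp [hx, hφx]
    exact ⟨{ φ.toRingHom with commutes' := fun n => DFunLike.congr_fun hcomm n }, hφK⟩

theorem prodDiffs_dvd {R : Type} [CommRing R] {n : ℕ} (y : Fin n → R) :
    prodDiffs y ∣ ∏ i, ∏ j ∈ Finset.univ.erase i, (y i - y j) := by
  refine Finset.prod_dvd_prod_of_dvd _ _ fun i _ => ?_
  refine dvd_trans (Finset.prod_dvd_prod_of_dvd _ (fun j => y i - y j) fun j _ => ?_)
    (Finset.prod_dvd_prod_of_subset _ _ _ fun j hj => ?_)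
  · rw [← neg_dvd, neg_sub]
  · have : i < j := by simpa using hj
    simpa using this.ne'

open Polynomial in
theorem exists_discriminant_isRelPrime (k : Type) [Field k] [CharZero k] (m : ℕ) (ζ : k)
    (hζ : IsPrimitiveRoot ζ (m + 1)) : ∃ δ : MvPolynomial (Fin m ⊕ Bool) k,
      δ ≠ 0 ∧ prodDiffs (zeroSumForm k m) ≠ 0 ∧ IsRelPrime δ (prodDiffs (zeroSumForm k m)) ∧
      ∀ (R : Type) [CommRing R] [Algebra (MvPolynomial (Fin m ⊕ Bool) k) R] (K : Fin (m + 1) → R),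
        (shiftedPoly k m).map (algebraMap (MvPolynomial (Fin m ⊕ Bool) k) R) =
          ∏ i, (X - C (K i)) →
        algebraMap (MvPolynomial (Fin m ⊕ Bool) k) R δ =
          ∏ i, ∏ j ∈ Finset.univ.erase i, (K i - K j) := by
  obtain ⟨Q, hQ⟩ := exists_mvPolynomial_discriminant (m + 1)
  let δ := MvPolynomial.aeval (fun i : Fin (m + 1) => (shiftedPoly k m).coeff i) Q
  have hδ : ∀ (A : Type) [CommRing A] (f : MvPolynomial (Fin m ⊕ Bool) k →+* A)
      (y : Fin (m + 1) → A), (shiftedPoly k m).map f = ∏ i, (X - Polynomial.C (y i)) →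
      f δ = ∏ i, ∏ j ∈ Finset.univ.erase i, (y i - y j) := by
    intro A _ f y hy
    rw [← hQ A y _ hy]
    have := MvPolynomial.map_aeval (fun i : Fin (m + 1) => (shiftedPoly k m).coeff i) f Q
    simp only [δ, this, coeff_map]
    rw [MvPolynomial.aeval_def, MvPolynomial.coe_eval₂Hom]
    congr 1
    exact RingHom.ext_int _ _
  let ev : MvPolynomial (Fin m ⊕ Bool) k →ₐ[k] k :=
    MvPolynomial.aeval (Sum.elim (fun _ => 0) fun b => if b then 1 else -1)
  have hevE : ∀ i, ev (zeroSumForm k m i) = 0 := by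
    have hs : ∀ j : Fin m, ev (zeroSumForm k m j.succ) = 0 := by
      intro j
      rw [zeroSumForm_succ]; simp [ev]
    intro i
    refine Fin.cases ?_ hs i
    have := congrArg ev (sum_zeroSumForm k m)
    rwa [Fin.sum_univ_succ, map_add, map_sum, Finset.sum_eq_zero fun j _ => hs j, add_zero,
      map_zero] at this
  have hevp : (shiftedPoly k m).map (ev : MvPolynomial (Fin m ⊕ Bool) k →+* k) =
      X ^ (m + 1) - 1 := by
    rw [map_shiftedPoly]
    have hev : ∀ i, (ev : MvPolynomial (Fin m ⊕ Bool) k →+* k) (zeroSumForm k m i) = 0 := hevE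
    simp only [hev]
    simp [ev, sub_eq_add_neg]
  let e : Fin (m + 1) ≃ nthRootsFinset (m + 1) (1 : k) :=
    (Finset.equivFinOfCardEq hζ.card_nthRootsFinset).symm
  have hroots : (X ^ (m + 1) - 1 : k[X]) = ∏ i, (X - Polynomial.C (e i : k)) := by
    rw [X_pow_sub_one_eq_prod (Nat.succ_pos m) hζ, ← Finset.prod_coe_sort]
    exact (Equiv.prod_comp e fun w => X - Polynomial.C (w : k)).symm
  have hevδ : ev δ ≠ 0 := by
    have := hδ k ev (fun i => (e i : k)) (hevp.trans hroots)
    change ev δ = _ at this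
    rw [this, Finset.prod_ne_zero_iff]
    intro i _
    rw [Finset.prod_ne_zero_iff]
    intro j hj
    rw [sub_ne_zero]
    intro hij
    exact (Finset.ne_of_mem_erase hj) (e.injective (Subtype.val_injective hij)).symm
  have hne : ∀ i j : Fin (m + 1), j ∈ Finset.univ.filter (i < ·) → i ≠ j := by
    intro i j hj
    have : i < j := by simpa using hj
    exact this.ne
  refine ⟨δ, fun h0 => hevδ (by rw [h0, map_zero]), ?_, ?_, fun R _ _ K hK => hδ R _ K hK⟩
  · rw [prodDiffs, Finset.prod_ne_zero_iff]
    intro i _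
    rw [Finset.prod_ne_zero_iff]
    intro j hj
    exact (irreducible_zeroSumForm_sub k m (hne i j hj).symm).ne_zero
  · refine IsRelPrime.prod_right fun i _ => IsRelPrime.prod_right fun j hj => ?_
    refine ((irreducible_zeroSumForm_sub k m (hne i j hj).symm).isRelPrime_iff_not_dvd.2 ?_).symm
    rintro ⟨q, hq⟩
    apply hevδ
    rw [hq, map_mul, map_sub, hevE, hevE, sub_zero, zero_mul]

/-- The structure map from the polynomial ring in `E`, `X`, `Y`. -/
noncomputable def baseHom {k R : Type} [Field k] [CommRing R] [Algebra k R] {m : ℕ}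
    (E : Fin (m + 1) → R) (x y : R) : MvPolynomial (Fin m ⊕ Bool) k →ₐ[k] R :=
  MvPolynomial.aeval (Sum.elim (fun j => E j.succ) fun b => if b then x else y)

theorem baseHom_zeroSumForm {k R : Type} [Field k] [CommRing R] [Algebra k R] {m : ℕ}
    {E : Fin (m + 1) → R} (x y : R) (hE : ∑ i, E i = 0) (i : Fin (m + 1)) :
    baseHom (k := k) E x y (zeroSumForm k m i) = E i := by
  have hs : ∀ j : Fin m, baseHom (k := k) E x y (zeroSumForm k m j.succ) = E j.succ := by
    intro j
    rw [zeroSumForm_succ]; simp [baseHom]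
  refine Fin.cases ?_ hs i
  have := congrArg (baseHom (k := k) E x y) (sum_zeroSumForm k m)
  rw [map_zero, ← hE, map_sum, Fin.sum_univ_succ, Fin.sum_univ_succ] at this
  simpa only [hs, add_left_inj] using this

theorem IsUniversalCharPoly.exists_splitting {k R : Type} [Field k] [CharZero k] [CommRing R]
    [Algebra k R] {m : ℕ} (hm : 1 ≤ m) {ζ : k} (hζ : IsPrimitiveRoot ζ (m + 1))
    {K E : Fin (m + 1) → R} {x y : R} (h : IsUniversalCharPoly k K E x y) :
    ∃ (_ : Algebra (MvPolynomial (Fin m ⊕ Bool) k) R) (δ : MvPolynomial (Fin m ⊕ Bool) k),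
      δ ≠ 0 ∧ prodDiffs (zeroSumForm k m) ≠ 0 ∧ IsRelPrime δ (prodDiffs (zeroSumForm k m)) ∧
      IsUniversalSplitting (shiftedPoly k m) K ∧
      algebraMap (MvPolynomial (Fin m ⊕ Bool) k) R δ =
        ∏ i, ∏ j ∈ Finset.univ.erase i, (K i - K j) ∧
      algebraMap (MvPolynomial (Fin m ⊕ Bool) k) R (prodDiffs (zeroSumForm k m)) =
        prodDiffs E := by
  let _ : Algebra (MvPolynomial (Fin m ⊕ Bool) k) R := (baseHom E x y).toAlgebra
  have : IsScalarTower k (MvPolynomial (Fin m ⊕ Bool) k) R :=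
    .of_algebraMap_eq fun c => ((baseHom E x y).commutes c).symm
  have hE : ∀ i, algebraMap (MvPolynomial (Fin m ⊕ Bool) k) R (zeroSumForm k m i) = E i :=
    baseHom_zeroSumForm x y (by rw [← esymmFamily_one, h.rel.right_one])
  obtain ⟨δ, hδ0, hD, hrel, hδ⟩ := exists_discriminant_isRelPrime k m ζ hζ
  have hspl : IsUniversalSplitting (shiftedPoly k m) K := by
    refine h.isUniversalSplitting hm hE ?_ ?_
    · change baseHom E x y _ = _
      simp [baseHom]
    · change baseHom E x y _ = _
      simp [baseHom]
  exact ⟨_, δ, hδ0, hD, hrel, hspl, hδ R K hspl.prod_eq, by simp [prodDiffs, map_prod, hE]⟩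

theorem IsUniversalCharPoly.dvd_prodDiffs_mul_of_isIntegral {k R : Type} [Field k] [CharZero k]
    [CommRing R] [Algebra k R] {m : ℕ} (hm : 1 ≤ m) {ζ : k} (hζ : IsPrimitiveRoot ζ (m + 1))
    {K E : Fin (m + 1) → R} {x y : R} (h : IsUniversalCharPoly k K E x y) (a : R)
    (b : nonZeroDivisors R) (hint : IsIntegral R (IsLocalization.mk' (FractionRing R) a b)) :
    (b : R) ∣ prodDiffs K * a := by
  obtain ⟨_, δ, hδ0, -, -, hspl, hδ, -⟩ := h.exists_splitting hm hζ
  exact hspl.dvd_of_isIntegral (shiftedPoly_monic_natDegree k m).1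
    (shiftedPoly_monic_natDegree k m).2 δ hδ0 hδ a b hint

theorem IsUniversalCharPoly.isDomain_and_isIntegrallyClosed {k R : Type} [Field k] [CharZero k]
    [CommRing R] [Algebra k R] {m : ℕ} (hm : 1 ≤ m) {ζ : k} (hζ : IsPrimitiveRoot ζ (m + 1))
    {K E : Fin (m + 1) → R} {x y : R} (h : IsUniversalCharPoly k K E x y) :
    IsDomain R ∧ IsIntegrallyClosed R := by
  obtain ⟨_, δ, hδ0, hD, hrel, hspl, hδ, hDE⟩ := h.exists_splitting hm hζ
  obtain ⟨_, _, Ω, _, _, χ, -, hχ, -⟩ := hspl.exists_characters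
    (shiftedPoly_monic_natDegree k m).1 (shiftedPoly_monic_natDegree k m).2 δ hδ0 hδ
  have : Nontrivial R := h.nontrivial (by omega)
  have : IsReduced R := ⟨fun z hz => hχ z fun σ => (hz.map (χ σ)).eq_zero⟩
  refine isDomain_and_isIntegrallyClosed_of_isIdempotentElem
    (N := MvPolynomial (Fin m ⊕ Bool) k) (h.eq_zero_or_eq_one (by omega)) fun a b hint => ?_
  refine dvd_of_dvd_mul_of_isRelPrime hD hrel b.2 ?_ ?_
  · rw [hδ]
    exact (h.dvd_prodDiffs_mul_of_isIntegral hm hζ a b hint).trans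
      (mul_dvd_mul_right (prodDiffs_dvd K) a)
  · rw [hDE]
    exact h.symm.dvd_prodDiffs_mul_of_isIntegral hm hζ a b hint

/-- The defining ideal of the ring generated by `K`, `E`, `X`, `Y` with `d * K i` in place of
`K i`. -/
noncomputable def charPolyIdeal (k : Type) [Field k] (d : ℕ) :
    Ideal (MvPolynomial (Fin d ⊕ (Fin d ⊕ Bool)) k) :=
  Ideal.span
    ({esymmFamily 1 (fun i : Fin d =>
        (d : MvPolynomial (Fin d ⊕ (Fin d ⊕ Bool)) k) * MvPolynomial.X (Sum.inl i)),
      esymmFamily 1 (fun i : Fin d => MvPolynomial.X (Sum.inr (Sum.inl i))),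
      esymmFamily d (fun i : Fin d =>
        (d : MvPolynomial (Fin d ⊕ (Fin d ⊕ Bool)) k) * MvPolynomial.X (Sum.inl i)) -
      esymmFamily d (fun i : Fin d => MvPolynomial.X (Sum.inr (Sum.inl i))) -
        (-1) ^ d * MvPolynomial.X (Sum.inr (Sum.inr true)) *
          MvPolynomial.X (Sum.inr (Sum.inr false))} ∪
      (fun n => esymmFamily n (fun i : Fin d =>
        (d : MvPolynomial (Fin d ⊕ (Fin d ⊕ Bool)) k) * MvPolynomial.X (Sum.inl i)) -
      esymmFamily n (fun i : Fin d => MvPolynomial.X (Sum.inr (Sum.inl i)))) ''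
        {n : ℕ | 2 ≤ n ∧ n ≤ d - 1})

theorem charPolyIdeal_le_ker_iff {k C : Type} [Field k] [CommRing C] [Algebra k C] {d : ℕ}
    (f : MvPolynomial (Fin d ⊕ (Fin d ⊕ Bool)) k →ₐ[k] C) :
    charPolyIdeal k d ≤ RingHom.ker f ↔
      CharPolyRelations (fun i => (d : C) * f (MvPolynomial.X (Sum.inl i)))
        (fun i => f (MvPolynomial.X (Sum.inr (Sum.inl i))))
        (f (MvPolynomial.X (Sum.inr (Sum.inr true))))
        (f (MvPolynomial.X (Sum.inr (Sum.inr false)))) := by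
  rw [charPolyIdeal, Ideal.span_le, Set.union_subset_iff, Set.image_subset_iff,
    Set.insert_subset_iff, Set.insert_subset_iff, Set.singleton_subset_iff]
  simp only [SetLike.mem_coe, RingHom.mem_ker, map_sub, map_add, map_mul, map_pow, map_neg, map_one,
    map_natCast, map_esymmFamily, sub_sub, sub_eq_zero, Set.subset_def, Set.mem_ofPred_eq,
    Set.mem_preimage]
  exact ⟨fun ⟨⟨h1, h2, h3⟩, h4⟩ => ⟨h1, h2, fun i hi hi' => h4 i ⟨hi, hi'⟩, h3⟩,
    fun h => ⟨⟨h.left_one, h.right_one, h.top⟩, fun i hi => h.middle i hi.1 hi.2⟩⟩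

theorem isUniversalCharPoly_quotient (k : Type) [Field k] [CharZero k] {d : ℕ} (hd : d ≠ 0) :
    IsUniversalCharPoly k (R := MvPolynomial (Fin d ⊕ (Fin d ⊕ Bool)) k ⧸ charPolyIdeal k d)
      (fun i : Fin d => (d : MvPolynomial (Fin d ⊕ (Fin d ⊕ Bool)) k ⧸ charPolyIdeal k d) *
        Ideal.Quotient.mkₐ k (charPolyIdeal k d) (MvPolynomial.X (Sum.inl i)))
      (fun i => Ideal.Quotient.mkₐ k (charPolyIdeal k d) (MvPolynomial.X (Sum.inr (Sum.inl i))))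
      (Ideal.Quotient.mkₐ k (charPolyIdeal k d) (MvPolynomial.X (Sum.inr (Sum.inr true))))
      (Ideal.Quotient.mkₐ k (charPolyIdeal k d) (MvPolynomial.X (Sum.inr (Sum.inr false)))) where
  rel := (charPolyIdeal_le_ker_iff _).1 (Ideal.Quotient.mkₐ_ker k _).ge
  adjoin_eq := by
    have hd' : (d : k) ≠ 0 := Nat.cast_ne_zero.2 hd
    rw [eq_top_iff, ← (AlgHom.range_eq_top _).2 (Ideal.Quotient.mkₐ_surjective k
      (charPolyIdeal k d)), ← Algebra.map_top, ← MvPolynomial.adjoin_range_X, AlgHom.map_adjoin,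
      Algebra.adjoin_le_iff]
    rintro _ ⟨_, ⟨(i | i | _ | _), rfl⟩, rfl⟩
    · have hi : Ideal.Quotient.mkₐ k (charPolyIdeal k d) (MvPolynomial.X (Sum.inl i)) =
          (d : k)⁻¹ • ((d : MvPolynomial (Fin d ⊕ (Fin d ⊕ Bool)) k ⧸ charPolyIdeal k d) *
            Ideal.Quotient.mkₐ k (charPolyIdeal k d) (MvPolynomial.X (Sum.inl i))) := by
        rw [← map_natCast (algebraMap k (_ ⧸ charPolyIdeal k d)), ← Algebra.smul_def, inv_smul_smul₀ hd']
      refine SetLike.mem_coe.2 ?_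
      rw [hi]
      exact Subalgebra.smul_mem _ (Algebra.subset_adjoin (.inl (.inl ⟨i, rfl⟩))) _
    · exact Algebra.subset_adjoin (.inl (.inr ⟨i, rfl⟩))
    · exact Algebra.subset_adjoin (.inr (.inr rfl))
    · exact Algebra.subset_adjoin (.inr (.inl rfl))
  exists_lift C _ _ K E x y h := by
    have hd' : (d : k) ≠ 0 := Nat.cast_ne_zero.2 hd
    have hdK : ∀ i, (d : C) * ((d : k)⁻¹ • K i) = K i := by
      intro i
      rw [← map_natCast (algebraMap k C), ← Algebra.smul_def, smul_inv_smul₀ hd']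
    let f : MvPolynomial (Fin d ⊕ (Fin d ⊕ Bool)) k →ₐ[k] C :=
      MvPolynomial.aeval (Sum.elim (fun i => (d : k)⁻¹ • K i)
        (Sum.elim E fun b => if b then x else y))
    have hf : charPolyIdeal k d ≤ RingHom.ker f := by
      rw [charPolyIdeal_le_ker_iff]
      simpa [f, hdK] using h
    have hlift : ∀ z, Ideal.Quotient.liftₐ (charPolyIdeal k d) f (fun z hz => hf hz)
        (Ideal.Quotient.mkₐ k (charPolyIdeal k d) z) = f z := fun z => rfl
    refine ⟨Ideal.Quotient.liftₐ _ f fun z hz => hf hz, fun i => ?_, fun i => ?_, ?_, ?_⟩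
    · rw [map_mul, map_natCast, hlift]
      simp [f, hdK]
    all_goals rw [hlift]; simp [f]

/-- Let `d ≥ 2` and `k` a field of characteristic `0` containing a primitive `d`-th root of
unity.  Let `R̃` be the quotient of the polynomial ring `k[K₁,…,K_d,E₁,…,E_d,X,Y]` (variables
`K_i = Sum.inl i`, `E_i = Sum.inr (Sum.inl i)`, `X = Sum.inr (Sum.inr true)`,
`Y = Sum.inr (Sum.inr false)`) by the ideal generated by
`σ₁(dK)`, `σ₁(E)`, `σ_i(dK) - σ_i(E)` for `2 ≤ i ≤ d-1`, and
`σ_d(dK) - σ_d(E) - (-1)^d·X·Y`, where `σ_i` denotes the `i`-th elementary symmetric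
polynomial (here `eK i = σ_i(d·K₁,…,d·K_d)` and `eE i = σ_i(E₁,…,E_d)`).
Then `R̃` is an integral domain and is integrally closed in its field of fractions. -/
theorem stmt_1 (k : Type) [Field k] [CharZero k] (d : ℕ) (hd : 2 ≤ d)
    (hζ : ∃ ζ : k, IsPrimitiveRoot ζ d)
    (eK eE : ℕ → MvPolynomial (Fin d ⊕ (Fin d ⊕ Bool)) k)
    (heK : ∀ n : ℕ, eK n =
      ∑ t ∈ Finset.powersetCard n (Finset.univ : Finset (Fin d)),
        ∏ i ∈ t, ((d : MvPolynomial (Fin d ⊕ (Fin d ⊕ Bool)) k) * MvPolynomial.X (Sum.inl i)))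
    (heE : ∀ n : ℕ, eE n =
      ∑ t ∈ Finset.powersetCard n (Finset.univ : Finset (Fin d)),
        ∏ i ∈ t, MvPolynomial.X (Sum.inr (Sum.inl i)))
    (I : Ideal (MvPolynomial (Fin d ⊕ (Fin d ⊕ Bool)) k))
    (hI : I = Ideal.span
      ({eK 1, eE 1,
        eK d - eE d -
          (-1) ^ d * MvPolynomial.X (Sum.inr (Sum.inr true)) *
            MvPolynomial.X (Sum.inr (Sum.inr false))} ∪
        (fun i => eK i - eE i) '' {i : ℕ | 2 ≤ i ∧ i ≤ d - 1})) :
    IsDomain (MvPolynomial (Fin d ⊕ (Fin d ⊕ Bool)) k ⧸ I) ∧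
      IsIntegrallyClosed (MvPolynomial (Fin d ⊕ (Fin d ⊕ Bool)) k ⧸ I) := by
  obtain ⟨ζ, hζ⟩ := hζ
  have hI' : I = charPolyIdeal k d := by
    obtain rfl := funext heK
    obtain rfl := funext heE
    exact hI
  subst hI'
  obtain ⟨m, rfl⟩ := Nat.exists_eq_succ_of_ne_zero (show d ≠ 0 by omega)
  exact (isUniversalCharPoly_quotient k (Nat.succ_ne_zero m)).isDomain_and_isIntegrallyClosed
    (by omega) hζ
end

section
/- Let K = k(A,B,σ,π,Σ,Π) be the field of rational functions in six indeterminates over k and let F(t) = t⁸ − 2(σΣ + 4A² + 4B²)t⁶ + (σ²Σ² + 2(σ²Π + Σ²π − 8πΠ) + 8(A² + B²)σΣ + 16(A² − B²)²)t⁴ − 2((σΣ + 4A² − 4B²)(σ²Π + Σ²π) − 8σΣπΠ + 2B²σ²Σ²)t² + (σ²Π − Σ²π)² ∈ K[t]. Then the Galois group of F over K (the Galois group of a splitting field of F over K) has order 192 (it is isomorphic to the Weyl group of type D₄, the group of even-signed permutations of 4 objects). -/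
open Polynomial Module IntermediateField

/-- Specialising the coefficients of a monic polynomial along a surjection of domains can only
shrink its Galois group, and the order of the new group divides that of the old one. -/
theorem card_gal_map_dvd_card_gal {R R' : Type*} [CommRing R] [IsDomain R] [IsIntegrallyClosed R]
    [CommRing R'] [IsDomain R'] [CharZero R] (φ : R →+* R') (hφ : Function.Surjective φ)
    {f : R[X]} (hf : f.Monic) :
    Nat.card ((f.map φ).map (algebraMap R' (FractionRing R'))).Gal ∣
      Nat.card (f.map (algebraMap R (FractionRing R))).Gal := by
  let K := FractionRing R
  let K' := FractionRing R'
  let N := (f.map (algebraMap R K)).SplittingField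
  let B := integralClosure R N
  let G := B ≃ₐ[R] B
  have : CharZero K := IsFractionRing.charZero R
  have : IsGalois K N := ⟨⟩
  have : IsFractionRing B N := integralClosure.isFractionRing_of_finite_extension K N
  have : Algebra.IsInvariant R B G := Algebra.isInvariant_of_isGalois' R K N B
  have cardG : Nat.card G = Nat.card (f.map (algebraMap R K)).Gal :=
    Nat.card_congr (galRestrict R K N B).toEquiv.symm
  have : Finite G := Finite.of_equiv _ (galRestrict R K N B).toEquiv
  let P := RingHom.ker φ
  have : P.IsPrime := RingHom.ker_isPrime φ
  have : FaithfulSMul R N := by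
    rw [faithfulSMul_iff_algebraMap_injective, IsScalarTower.algebraMap_eq R K N]
    exact (algebraMap K N).injective.comp (IsFractionRing.injective R K)
  obtain ⟨Q, hQ, hQP⟩ := Ideal.exists_ideal_over_prime_of_isIntegral_of_isDomain (S := B) P
    (by rw [(RingHom.injective_iff_ker_eq_bot _).1 (FaithfulSMul.algebraMap_injective R B)]
        exact bot_le)
  have : Q.LiesOver P := ⟨hQP.symm⟩
  let L := FractionRing (B ⧸ Q)
  let e : (R ⧸ P) ≃+* R' := RingHom.quotientKerEquivOfSurjective hφ
  let ψ : R' →+* L := ((algebraMap (B ⧸ Q) L).comp (algebraMap (R ⧸ P) (B ⧸ Q))).comp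
    e.symm.toRingHom
  have hψ : Function.Injective ψ :=
    ((IsFractionRing.injective (B ⧸ Q) L).comp
      (FaithfulSMul.algebraMap_injective (R ⧸ P) (B ⧸ Q))).comp e.symm.injective
  let _ : Algebra (R ⧸ P) K' := ((algebraMap R' K').comp e.toRingHom).toAlgebra
  let _ : Algebra K' L := (IsFractionRing.lift hψ).toAlgebra
  have hK' : ∀ x, algebraMap K' L (algebraMap R' K' x) = ψ x := fun x =>
    IsFractionRing.lift_algebraMap hψ x
  have : IsFractionRing (R ⧸ P) K' :=
    .of_ringEquiv_left e fun _ => rfl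
  have : IsScalarTower (R ⧸ P) K' L := .of_algebraMap_eq fun x => by
    change _ = algebraMap K' L (algebraMap R' K' (e x))
    rw [hK']
    simp [ψ, IsScalarTower.algebraMap_apply (R ⧸ P) (B ⧸ Q) L]
  have : Normal K' L := Ideal.IsFractionRing.normal G P Q K' L
  have hs : (((f.map φ).map (algebraMap R' K')).map (algebraMap K' L)).Splits := by
    have hB : (f.map (algebraMap R B)).Splits := by
      refine Splits.of_splits_map_of_injective (i := algebraMap B N)
        (FaithfulSMul.algebraMap_injective B N) ?_ ?_
      · have := SplittingField.splits (f.map (algebraMap R K))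
        rwa [Polynomial.map_map, ← IsScalarTower.algebraMap_eq] at this ⊢
      · intro x hx
        rw [Polynomial.map_map, ← IsScalarTower.algebraMap_eq, mem_roots (hf.map _).ne_zero, IsRoot,
          eval_map] at hx
        exact ⟨⟨x, f, hf, hx⟩, rfl⟩
    have hcomp : ((algebraMap K' L).comp (algebraMap R' K')).comp φ =
        ((algebraMap (B ⧸ Q) L).comp (algebraMap B (B ⧸ Q))).comp (algebraMap R B) := by
      ext x
      have hx : e (Ideal.Quotient.mk P x) = φ x := rfl
      have hx' : e.symm (φ x) = Ideal.Quotient.mk P x := by rw [← hx, e.symm_apply_apply]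
      simp only [RingHom.comp_apply, hK']
      simp [ψ, hx']
    rw [Polynomial.map_map, Polynomial.map_map, hcomp, ← Polynomial.map_map]
    exact hB.map _
  have : Fact (((f.map φ).map (algebraMap R' K')).map (algebraMap K' L)).Splits := ⟨hs⟩
  rw [← cardG]
  exact ((Subgroup.card_dvd_of_surjective _ (Polynomial.Gal.restrict_surjective _ L)).trans
    (Subgroup.card_dvd_of_surjective _
      (IsFractionRing.stabilizerHom_surjective G P Q K' L))).trans (Subgroup.card_subgroup_dvd_card _)

theorem finrank_le_natDegree_mul_finrank_adjoin_simple {K N : Type*} [Field K] [Field N]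
    [Algebra K N] {p : K[X]} (hp : p.Monic) {t : N} (ht : aeval t p = 0) :
    finrank K N ≤ p.natDegree * finrank K⟮t⟯ N := by
  have hint : IsIntegral K t := ⟨p, hp, ht⟩
  rw [← finrank_mul_finrank K K⟮t⟯ N, adjoin.finrank hint]
  exact Nat.mul_le_mul_right _ (natDegree_le_of_dvd (minpoly.dvd K t ht) hp.ne_zero)

/-- An even octic whose constant term is a nonzero square has a splitting field of degree at most
`8 * 6 * 4`. -/
theorem finrank_splittingField_even_octic_le {K N : Type*} [Field K] [Field N] [Algebra K N]
    {f : K[X]} {a b d c : K} [IsSplittingField K N f]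
    (h : f = X ^ 8 - C a * X ^ 6 + C b * X ^ 4 - C d * X ^ 2 + C (c ^ 2)) (hc : c ≠ 0) :
    finrank K N ≤ 192 := by
  obtain ⟨a, rfl⟩ := neg_surjective a
  obtain ⟨d, rfl⟩ := neg_surjective d
  have hf : f = X ^ 8 + C a * X ^ 6 + C b * X ^ 4 + C d * X ^ 2 + C (c ^ 2) := by
    rw [h, C_neg, C_neg]; ring
  have hfdeg : f.natDegree = 8 := by rw [hf]; compute_degree!
  have hfm : f.Monic := by rw [hf]; monicity!
  let ι := algebraMap K N
  have hfN : f.map ι = X ^ 8 + C (ι a) * X ^ 6 + C (ι b) * X ^ 4 + C (ι d) * X ^ 2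
      + C (ι c ^ 2) := by simp [hf, ι]
  have hs : (f.map ι).Splits := IsSplittingField.splits N f
  have hne : f.map ι ≠ 0 := (hfm.map _).ne_zero
  obtain ⟨t₁, h₁⟩ := hs.exists_eval_eq_zero (by
    rw [degree_map, degree_eq_natDegree hfm.ne_zero, hfdeg]; decide)
  have e₁ : t₁ ^ 8 + ι a * t₁ ^ 6 + ι b * t₁ ^ 4 + ι d * t₁ ^ 2 + ι c ^ 2 = 0 := by
    simpa [hfN] using h₁
  obtain ⟨a₁, ha₁⟩ : ∃ x, x = ι a + t₁ ^ 2 := ⟨_, rfl⟩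
  obtain ⟨b₁, hb₁⟩ : ∃ x, x = ι b + t₁ ^ 2 * a₁ := ⟨_, rfl⟩
  obtain ⟨d₁, hd₁⟩ : ∃ x, x = ι d + t₁ ^ 2 * b₁ := ⟨_, rfl⟩
  let F₁ : N[X] := X ^ 6 + C a₁ * X ^ 4 + C b₁ * X ^ 2 + C d₁
  have hc₁ : ι c ^ 2 = - (t₁ ^ 2 * d₁) := by rw [hd₁, hb₁, ha₁]; linear_combination e₁
  have f₁ : f.map ι = (X ^ 2 - C (t₁ ^ 2)) * F₁ := by
    rw [hfN, hc₁, (by rw [ha₁]; ring : ι a = a₁ - t₁ ^ 2),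
      (by rw [hb₁]; ring : ι b = b₁ - t₁ ^ 2 * a₁), (by rw [hd₁]; ring : ι d = d₁ - t₁ ^ 2 * b₁)]
    simp only [F₁, C_sub, C_mul, C_neg]
    ring
  have hs₁ : F₁.Splits := hs.of_dvd hne (f₁ ▸ dvd_mul_left _ _)
  obtain ⟨t₂, h₂⟩ := hs₁.exists_eval_eq_zero (by
    rw [show F₁.degree = 6 by simp only [F₁]; compute_degree!]; decide)
  have e₂ : t₂ ^ 6 + a₁ * t₂ ^ 4 + b₁ * t₂ ^ 2 + d₁ = 0 := by simpa [F₁] using h₂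
  obtain ⟨a₂, ha₂⟩ : ∃ x, x = a₁ + t₂ ^ 2 := ⟨_, rfl⟩
  obtain ⟨b₂, hb₂⟩ : ∃ x, x = b₁ + t₂ ^ 2 * a₂ := ⟨_, rfl⟩
  let F₂ : N[X] := X ^ 4 + C a₂ * X ^ 2 + C b₂
  have hd₂ : d₁ = - (t₂ ^ 2 * b₂) := by rw [hb₂, ha₂]; linear_combination e₂
  have f₂ : F₁ = (X ^ 2 - C (t₂ ^ 2)) * F₂ := by
    simp only [F₁, F₂]
    rw [hd₂, (by rw [ha₂]; ring : a₁ = a₂ - t₂ ^ 2),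
      (by rw [hb₂]; ring : b₁ = b₂ - t₂ ^ 2 * a₂)]
    simp only [C_sub, C_mul, C_neg]
    ring
  have hF₁ : F₁ ≠ 0 := fun h => hne (by rw [f₁, h, mul_zero])
  have hs₂ : F₂.Splits := hs₁.of_dvd hF₁ (f₂ ▸ dvd_mul_left _ _)
  obtain ⟨t₃, h₃⟩ := hs₂.exists_eval_eq_zero (by
    rw [show F₂.degree = 4 by simp only [F₂]; compute_degree!]; decide)
  have e₃ : t₃ ^ 4 + a₂ * t₃ ^ 2 + b₂ = 0 := by simpa [F₂] using h₃
  obtain ⟨a₃, ha₃⟩ : ∃ x, x = a₂ + t₃ ^ 2 := ⟨_, rfl⟩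
  let F₃ : N[X] := X ^ 2 + C a₃
  have hb₃ : b₂ = - (t₃ ^ 2 * a₃) := by rw [ha₃]; linear_combination e₃
  have f₃ : F₂ = (X ^ 2 - C (t₃ ^ 2)) * F₃ := by
    simp only [F₂, F₃]
    rw [hb₃, (by rw [ha₃]; ring : a₂ = a₃ - t₃ ^ 2)]
    simp only [C_sub, C_mul, C_neg]
    ring
  have hF₂ : F₂ ≠ 0 := fun h => hF₁ (by rw [f₂, h, mul_zero])
  have hs₃ : F₃.Splits := hs₂.of_dvd hF₂ (f₃ ▸ dvd_mul_left _ _)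
  obtain ⟨t₄, h₄⟩ := hs₃.exists_eval_eq_zero (by
    rw [show F₃.degree = 2 by simp only [F₃]; compute_degree!]; decide)
  have e₄ : a₃ = - t₄ ^ 2 := by
    have : t₄ ^ 2 + a₃ = 0 := by simpa [F₃] using h₄
    linear_combination this
  have hprod : (t₁ * t₂ * t₃ * t₄) ^ 2 = ι c ^ 2 := by
    rw [hc₁, hd₂, hb₃, e₄]; ring
  let K₁ := K⟮t₁⟯
  let K₂ := K₁⟮t₂⟯
  let K₃ := K₂⟮t₃⟯
  let τ₁ : K₁ := AdjoinSimple.gen K t₁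
  let τ₂ : K₂ := AdjoinSimple.gen K₁ t₂
  let τ₃ : K₃ := AdjoinSimple.gen K₂ t₃
  have step₁ : finrank K N ≤ 8 * finrank K₁ N := by
    rw [← hfdeg]
    exact finrank_le_natDegree_mul_finrank_adjoin_simple hfm
      (by rw [aeval_def, ← eval_map]; exact h₁)
  have step₂ : finrank K₁ N ≤ 6 * finrank K₂ N := by
    obtain ⟨α, hα⟩ : ∃ α : K₁, algebraMap K₁ N α = a₁ :=
      ⟨algebraMap K K₁ a + τ₁ ^ 2, by rw [ha₁]; rfl⟩
    obtain ⟨β, hβ⟩ : ∃ β : K₁, algebraMap K₁ N β = b₁ :=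
      ⟨algebraMap K K₁ b + τ₁ ^ 2 * α, by rw [hb₁, ← hα]; rfl⟩
    obtain ⟨δ, hδ⟩ : ∃ δ : K₁, algebraMap K₁ N δ = d₁ :=
      ⟨algebraMap K K₁ d + τ₁ ^ 2 * β, by rw [hd₁, ← hβ]; rfl⟩
    convert finrank_le_natDegree_mul_finrank_adjoin_simple
      (p := X ^ 6 + C α * X ^ 4 + C β * X ^ 2 + C δ) (t := t₂) (by monicity!) ?_ using 2
    · symm; compute_degree!
    · simpa [hα, hβ, hδ] using e₂
  have step₃ : finrank K₂ N ≤ 4 * finrank K₃ N := by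
    obtain ⟨α, hα⟩ : ∃ α : K₂, algebraMap K₂ N α = a₂ :=
      ⟨algebraMap K₁ K₂ (algebraMap K K₁ a + τ₁ ^ 2) + τ₂ ^ 2, by rw [ha₂, ha₁]; rfl⟩
    obtain ⟨β, hβ⟩ : ∃ β : K₂, algebraMap K₂ N β = b₂ :=
      ⟨algebraMap K₁ K₂ (algebraMap K K₁ b + τ₁ ^ 2 * (algebraMap K K₁ a + τ₁ ^ 2)) + τ₂ ^ 2 * α,
        by rw [hb₂, hb₁, ha₁, ← hα]; rfl⟩
    convert finrank_le_natDegree_mul_finrank_adjoin_simple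
      (p := X ^ 4 + C α * X ^ 2 + C β) (t := t₃) (by monicity!) ?_ using 2
    · symm; compute_degree!
    · simpa [hα, hβ] using e₃
  let S : Subalgebra K N := ((K₃.restrictScalars K₁).restrictScalars K).toSubalgebra
  have m₃ : t₃ ∈ S := τ₃.2
  have m₂ : t₂ ∈ S := K₃.algebraMap_mem τ₂
  have m₁ : t₁ ∈ S := K₃.algebraMap_mem (algebraMap K₁ K₂ τ₁)
  have hp0 : t₁ * t₂ * t₃ * t₄ ≠ 0 := by
    intro h
    rw [h] at hprod
    have : ι c = 0 := by simpa using hprod.symm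
    exact hc ((map_eq_zero _).1 this)
  have m₄ : t₄ ∈ S := by
    have hx : t₁ * t₂ * t₃ ∈ K₃ := S.mul_mem (S.mul_mem m₁ m₂) m₃
    have hy : t₁ * t₂ * t₃ * t₄ ∈ K₃ := by
      change _ ∈ S
      rcases sq_eq_sq_iff_eq_or_eq_neg.1 hprod with h | h
      · exact h ▸ S.algebraMap_mem c
      · exact h ▸ S.neg_mem (S.algebraMap_mem c)
    have := K₃.div_mem hy hx
    rwa [mul_div_cancel_left₀ _ (left_ne_zero_of_mul hp0)] at this
  have hS : S = ⊤ := by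
    rw [eq_top_iff, ← IsSplittingField.adjoin_rootSet N f]
    refine Algebra.adjoin_le fun x hx => ?_
    have hx : (f.map ι).eval x = 0 := by
      rw [eval_map]; exact (mem_rootSet.1 hx).2
    rw [f₁, f₂, f₃] at hx
    simp only [F₃, e₄, eval_mul, eval_sub, eval_pow, eval_X, eval_C, eval_add, mul_eq_zero,
      ← sub_eq_add_neg, sub_eq_zero, sq_eq_sq_iff_eq_or_eq_neg] at hx
    rcases hx with (rfl | rfl) | (rfl | rfl) | (rfl | rfl) | (rfl | rfl) <;>
      first
      | assumption
      | exact S.neg_mem (by assumption)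
  have hfin : finrank K₃ N ≤ 1 := by
    refine finrank_le_one (1 : N) fun x => ?_
    have hx : x ∈ S := hS ▸ Algebra.mem_top
    exact ⟨⟨x, hx⟩, by rw [Algebra.smul_def, mul_one]; rfl⟩
  omega

theorem exists_eq_add_mul_of_mem_adjoin_sqrt {M E : Type*} [Field M] [Field E] [Algebra M E]
    {r : E} {y : M} (hr : r ^ 2 = algebraMap M E y) {w : E} (hw : w ∈ M⟮r⟯) :
    ∃ u v : M, w = algebraMap M E u + algebraMap M E v * r := by
  have hint : IsIntegral M r := ⟨X ^ 2 - C y, by monicity!, by simp [hr]⟩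
  have hw' : w ∈ Algebra.adjoin M {r} := by
    rwa [← adjoin_simple_toSubalgebra_of_isAlgebraic hint.isAlgebraic]
  induction hw' using Algebra.adjoin_induction with
  | mem x hx => exact ⟨0, 1, by simpa using hx⟩
  | algebraMap a => exact ⟨a, 0, by simp⟩
  | add x x' hx hx' h h' =>
    have mem : ∀ z ∈ Algebra.adjoin M {r}, z ∈ M⟮r⟯ := fun z hz => algebra_adjoin_le_adjoin _ _ hz
    obtain ⟨u, v, rfl⟩ := h (mem _ hx)
    obtain ⟨u', v', rfl⟩ := h' (mem _ hx')
    exact ⟨u + u', v + v', by simp only [map_add]; ring⟩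
  | mul x x' hx hx' h h' =>
    have mem : ∀ z ∈ Algebra.adjoin M {r}, z ∈ M⟮r⟯ := fun z hz => algebra_adjoin_le_adjoin _ _ hz
    obtain ⟨u, v, rfl⟩ := h (mem _ hx)
    obtain ⟨u', v', rfl⟩ := h' (mem _ hx')
    exact ⟨u * u' + v * v' * y, u * v' + v * u', by
      simp only [map_add, map_mul, ← hr]; ring⟩

section Kummer

variable {M E ι : Type*} [Field M] [Field E] [Algebra M E] {r : ι → E} {y : ι → M}

theorem exists_isSquare_mul_prod_of_sq_mem_adjoin [DecidableEq ι] (h2 : (2 : E) ≠ 0)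
    (hr : ∀ i, r i ^ 2 = algebraMap M E (y i)) (T : Finset ι) {z : M} {w : E}
    (hw : w ∈ adjoin M (r '' T)) (hwz : w ^ 2 = algebraMap M E z) :
    ∃ S ⊆ T, IsSquare (z * ∏ i ∈ S, y i) := by
  induction T using Finset.induction_on generalizing z w with
  | empty =>
    simp only [Finset.coe_empty, Set.image_empty, adjoin_empty, mem_bot, Set.mem_range] at hw
    obtain ⟨m, rfl⟩ := hw
    refine ⟨∅, le_rfl, m, ?_⟩
    rw [← map_pow] at hwz
    simpa [sq] using ((algebraMap M E).injective hwz).symm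
  | insert i T hi ih =>
    rw [Finset.coe_insert, Set.image_insert_eq, Set.insert_eq, Set.union_comm,
      ← adjoin_adjoin_left, mem_restrictScalars] at hw
    obtain ⟨u, v, rfl⟩ := exists_eq_add_mul_of_mem_adjoin_sqrt
      (y := algebraMap M (adjoin M (r '' T)) (y i)) (hr i) hw
    have up : ∀ z' : M, (∃ w' : adjoin M (r '' T), (w' : E) ^ 2 = algebraMap M E z') →
        ∃ S ⊆ T, IsSquare (z' * ∏ i ∈ S, y i) := fun z' ⟨w', h⟩ => ih w'.2 h
    change ((u : E) + (v : E) * r i) ^ 2 = _ at hwz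
    have weak : (∃ w' : adjoin M (r '' T), (w' : E) ^ 2 = algebraMap M E z) →
        ∃ S ⊆ insert i T, IsSquare (z * ∏ i ∈ S, y i) := fun h => by
      obtain ⟨S, hS, h⟩ := up z h
      exact ⟨S, hS.trans (Finset.subset_insert _ _), h⟩
    by_cases hv : v = 0
    · exact weak ⟨u, by simpa [hv] using hwz⟩
    by_cases hu : u = 0
    · obtain ⟨S, hS, h⟩ := up (z * y i) ⟨v * algebraMap M _ (y i), by
        change ((v : E) * algebraMap M E (y i)) ^ 2 = _
        rw [map_mul, ← hwz, ← hr i, hu]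
        push_cast
        ring⟩
      refine ⟨insert i S, Finset.insert_subset_insert _ hS, ?_⟩
      rwa [Finset.prod_insert (fun h => hi (hS h)), ← mul_assoc]
    · have hu' : (u : E) ≠ 0 := by simpa using hu
      have hv' : (v : E) ≠ 0 := by simpa using hv
      have hri : r i ∈ adjoin M (r '' T) := by
        have key : r i = (algebraMap M E z - (u : E) ^ 2 - (v : E) ^ 2 * algebraMap M E (y i)) /
            (((u : E) * v) + u * v) := by
          rw [← hwz, ← hr i, ← two_mul, eq_div_iff (mul_ne_zero h2 (mul_ne_zero hu' hv'))]
          ring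
        rw [key]
        have hA := fun a : M => (adjoin M (r '' T)).algebraMap_mem a
        exact div_mem (sub_mem (sub_mem (hA _) (pow_mem u.2 _)) (mul_mem (pow_mem v.2 _) (hA _)))
          (add_mem (mul_mem u.2 v.2) (mul_mem u.2 v.2))
      exact weak ⟨u + v * ⟨r i, hri⟩, hwz⟩

/-- Adjoining square roots of elements that are independent modulo squares. -/
theorem finrank_adjoin_image_sqrt [DecidableEq ι] (h2 : (2 : E) ≠ 0)
    (hr : ∀ i, r i ^ 2 = algebraMap M E (y i)) (T : Finset ι)
    (hy : ∀ S ⊆ T, S.Nonempty → ¬ IsSquare (∏ i ∈ S, y i)) :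
    finrank M (adjoin M (r '' T)) = 2 ^ T.card := by
  induction T using Finset.induction_on with
  | empty => simp
  | insert i T hi ih =>
    have hri : r i ∉ adjoin M (r '' T) := fun h => by
      obtain ⟨S, hS, hsq⟩ := exists_isSquare_mul_prod_of_sq_mem_adjoin h2 hr T h (hr i)
      rw [← Finset.prod_insert (fun h => hi (hS h))] at hsq
      exact hy _ (Finset.insert_subset_insert _ hS) (Finset.insert_nonempty _ _) hsq
    rw [Finset.coe_insert, Set.image_insert_eq, Set.insert_eq, Set.union_comm,
      ← adjoin_adjoin_left, Finset.card_insert_of_notMem hi, pow_succ,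
      ← ih fun S hS => hy S (hS.trans (Finset.subset_insert _ _))]
    set K := adjoin M (r '' T)
    change finrank M K⟮r i⟯ = _
    rw [← finrank_mul_finrank M K K⟮r i⟯]
    congr 1
    let p : K[X] := X ^ 2 - C (algebraMap M K (y i))
    have hpm : p.Monic := by simp only [p]; monicity!
    have hpd : p.natDegree = 2 := by simp only [p]; compute_degree!
    have hp0 : aeval (r i) p = 0 := by
      simp only [p, map_sub, map_pow, aeval_X, aeval_C, hr i, sub_eq_zero]; rfl
    have hint : IsIntegral K (r i) := ⟨p, hpm, hp0⟩
    rw [adjoin.finrank hint]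
    refine le_antisymm (hpd ▸ natDegree_le_of_dvd (minpoly.dvd K _ hp0) hpm.ne_zero) ?_
    rw [minpoly.two_le_natDegree_iff hint]
    rintro ⟨x, hx⟩
    exact hri (hx ▸ x.2)

end Kummer

/-- If each `d i` can be specialised to a polynomial of degree one in such a way that the other
`d j` become nonzero constants, then the `d i` are independent modulo squares. -/
theorem not_isSquare_prod_of_specialization {D M k ι : Type*} [CommRing D] [IsDomain D]
    [IsIntegrallyClosed D] [Field M] [Algebra D M] [IsFractionRing D M] [Field k]
    {d : ι → D} (ψ : ι → D →+* k[X])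
    (h₁ : ∀ i, (ψ i (d i)).natDegree = 1)
    (h₀ : ∀ i j, i ≠ j → (ψ i (d j)).natDegree = 0 ∧ ψ i (d j) ≠ 0)
    {S : Finset ι} (hS : S.Nonempty) : ¬ IsSquare (∏ i ∈ S, algebraMap D M (d i)) := by
  classical
  rintro ⟨w, hw⟩
  rw [← map_prod] at hw
  have hint : IsIntegral D w :=
    IsIntegral.of_pow (n := 2) two_pos (by rw [sq, ← hw]; exact isIntegral_algebraMap)
  obtain ⟨v, rfl⟩ := IsIntegrallyClosed.algebraMap_eq_of_integral hint
  rw [← map_mul] at hw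
  replace hw := IsFractionRing.injective D M hw
  obtain ⟨i, hi⟩ := hS
  have hne : ∀ j ∈ S, ψ i (d j) ≠ 0 := fun j _ => by
    rcases eq_or_ne i j with rfl | h
    · exact ne_zero_of_natDegree_gt (n := 0) (by rw [h₁]; exact one_pos)
    · exact (h₀ i j h).2
  have hdeg := congrArg (fun x => (ψ i x).natDegree) hw
  simp only [map_prod, map_mul] at hdeg
  rw [natDegree_prod _ _ hne, Finset.sum_eq_single_of_mem i hi
    (fun j _ hj => (h₀ i j hj.symm).1), h₁, ← sq, natDegree_pow] at hdeg
  omega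

/-- The octic `F`, with coefficients in an arbitrary commutative ring. -/
noncomputable def octic {R : Type*} [CommRing R] (A B s p S P : R) : R[X] :=
  X ^ 8
    - C (2 * (s * S + 4 * A ^ 2 + 4 * B ^ 2)) * X ^ 6
    + C (s ^ 2 * S ^ 2 + 2 * (s ^ 2 * P + S ^ 2 * p - 8 * p * P)
        + 8 * (A ^ 2 + B ^ 2) * s * S + 16 * (A ^ 2 - B ^ 2) ^ 2) * X ^ 4
    - C (2 * ((s * S + 4 * A ^ 2 - 4 * B ^ 2) * (s ^ 2 * P + S ^ 2 * p)
        - 8 * s * S * p * P + 2 * B ^ 2 * s ^ 2 * S ^ 2)) * X ^ 2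
    + C ((s ^ 2 * P - S ^ 2 * p) ^ 2)

section octic

variable {R R' : Type*} [CommRing R] [CommRing R']

theorem map_octic (φ : R →+* R') (A B s p S P : R) :
    (octic A B s p S P).map φ = octic (φ A) (φ B) (φ s) (φ p) (φ S) (φ P) := by
  simp only [octic, Polynomial.map_add, Polynomial.map_sub, Polynomial.map_mul, Polynomial.map_pow,
    map_X, map_C, map_add, map_sub, map_mul, map_pow, map_ofNat, Polynomial.map_ofNat]

theorem monic_octic [Nontrivial R] (A B s p S P : R) : (octic A B s p S P).Monic := by
  simp only [octic]; monicity!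

/-- For `B = 0`, `A = 1`, `p = x²`, `P = y²`, the roots of the octic are half sums of square roots
of `4 + (s ± 2x)(S ± 2y)`. -/
theorem eval_octic_eq_zero {E : Type*} [Field E] [CharZero E] {s x S y a b : E}
    (ha : a ^ 2 = 4 + (s + 2 * x) * (S + 2 * y)) (hb : b ^ 2 = 4 + (s - 2 * x) * (S - 2 * y)) :
    (octic 1 0 s (x ^ 2) S (y ^ 2)).eval ((a + b) / 2) = 0 := by
  obtain ⟨t, ht⟩ : ∃ t, t = (a + b) / 2 := ⟨_, rfl⟩
  have hu : (4 * t ^ 2 - (a ^ 2 + b ^ 2)) ^ 2 = 4 * a ^ 2 * b ^ 2 := by rw [ht]; ring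
  rw [ha, hb] at hu
  rw [← ht]
  simp only [octic, eval_add, eval_sub, eval_mul, eval_pow, eval_X, eval_C]
  linear_combination (t ^ 4 - (s * S + 4 - 4 * x * y) * t ^ 2 + (s * y - S * x) ^ 2) / 16 * hu

theorem sqrt_mem_adjoin_rootSet_octic {L E : Type*} [Field L] [Field E] [Algebra L E] [CharZero E]
    {s p S P : L} (hs : s ≠ 0) (hS : S ≠ 0) {x y : E} (hx : x ^ 2 = algebraMap L E p)
    (hy : y ^ 2 = algebraMap L E P) {r : Fin 4 → E}
    (h₀ : r 0 ^ 2 = 4 + (algebraMap L E s + 2 * x) * (algebraMap L E S + 2 * y))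
    (h₁ : r 1 ^ 2 = 4 + (algebraMap L E s - 2 * x) * (algebraMap L E S - 2 * y))
    (h₂ : r 2 ^ 2 = 4 + (algebraMap L E s + 2 * x) * (algebraMap L E S - 2 * y))
    (h₃ : r 3 ^ 2 = 4 + (algebraMap L E s - 2 * x) * (algebraMap L E S + 2 * y)) :
    (∀ i, r i ∈ adjoin L ((octic 1 0 s p S P).rootSet E)) ∧
      x ∈ adjoin L ((octic 1 0 s p S P).rootSet E) ∧
      y ∈ adjoin L ((octic 1 0 s p S P).rootSet E) := by
  set N := adjoin L ((octic 1 0 s p S P).rootSet E)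
  set σ := algebraMap L E s
  set τ := algebraMap L E S
  have root_mem : ∀ t : E, (octic 1 0 σ (x ^ 2) τ (y ^ 2)).eval t = 0 → t ∈ N := fun t ht => by
    refine subset_adjoin _ _ ((mem_rootSet_of_ne (monic_octic ..).ne_zero).2 ?_)
    rw [aeval_def, ← eval_map, map_octic, map_one, map_zero, ← hx, ← hy]
    exact ht
  have sqrt_mem : ∀ a b z : E, a ^ 2 = 4 + (σ + 2 * x) * (τ + 2 * z) →
      b ^ 2 = 4 + (σ - 2 * x) * (τ - 2 * z) → z ^ 2 = y ^ 2 → a ∈ N ∧ b ∈ N :=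
    fun a b z ha hb hz => by
      have m₁ := root_mem _ (hz ▸ eval_octic_eq_zero ha hb)
      have m₂ := root_mem _ (hz ▸ eval_octic_eq_zero ha (b := -b) (by rwa [neg_sq]))
      constructor
      · convert add_mem m₁ m₂ using 1; ring
      · convert sub_mem m₁ m₂ using 1; ring
  have m₀₁ := sqrt_mem (r 0) (r 1) y h₀ h₁ rfl
  have m₂₃ := sqrt_mem (r 2) (r 3) (-y) (by rw [h₂]; ring) (by rw [h₃]; ring) (neg_sq _)
  have hr : ∀ i, r i ∈ N := by
    intro i
    fin_cases i
    exacts [m₀₁.1, m₀₁.2, m₂₃.1, m₂₃.2]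
  have comb : ∀ i j i' j', r i ^ 2 - r j ^ 2 + (r i' ^ 2 - r j' ^ 2) ∈ N := fun i j i' j' =>
    add_mem (sub_mem (pow_mem (hr i) 2) (pow_mem (hr j) 2))
      (sub_mem (pow_mem (hr i') 2) (pow_mem (hr j') 2))
  have eight : ∀ z : L, 8 * algebraMap L E z ∈ N := fun z =>
    mul_mem (ofNat_mem N 8) (N.algebraMap_mem z)
  have eight_ne : ∀ z : L, z ≠ 0 → 8 * algebraMap L E z ≠ 0 := fun z hz =>
    mul_ne_zero (by norm_num) (by simpa using hz)
  refine ⟨hr, ?_, ?_⟩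
  · have : x = (r 0 ^ 2 - r 3 ^ 2 + (r 2 ^ 2 - r 1 ^ 2)) / (8 * algebraMap L E S) := by
      rw [eq_div_iff (eight_ne S hS), h₀, h₁, h₂, h₃]
      ring
    rw [this]
    exact div_mem (comb 0 3 2 1) (eight S)
  · have : y = (r 0 ^ 2 - r 2 ^ 2 + (r 3 ^ 2 - r 1 ^ 2)) / (8 * algebraMap L E s) := by
      rw [eq_div_iff (eight_ne s hs), h₀, h₁, h₂, h₃]
      ring
    rw [this]
    exact div_mem (comb 0 2 3 1) (eight s)

end octic

/-- The four elements whose square roots generate the splitting field of the octic for `A = 1`,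
`B = 0`, `p = x²`, `P = y²`. -/
def octicRadicand {R : Type*} [CommRing R] (s x S y : R) : Fin 4 → R :=
  ![4 + (s + 2 * x) * (S + 2 * y), 4 + (s - 2 * x) * (S - 2 * y),
    4 + (s + 2 * x) * (S - 2 * y), 4 + (s - 2 * x) * (S + 2 * y)]

theorem map_octicRadicand {R R' : Type*} [CommRing R] [CommRing R'] (φ : R →+* R') (s x S y : R)
    (i : Fin 4) : φ (octicRadicand s x S y i) = octicRadicand (φ s) (φ x) (φ S) (φ y) i := by
  have h₂ : φ 2 = 2 := map_ofNat φ 2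
  have h₄ : φ 4 = 4 := map_ofNat φ 4
  fin_cases i <;> simp [octicRadicand, h₂, h₄]

theorem not_isSquare_prod_octicRadicand {k M : Type*} [Field k] [CharZero k] [Field M]
    [Algebra (MvPolynomial (Fin 4) k) M] [IsFractionRing (MvPolynomial (Fin 4) k) M]
    {T : Finset (Fin 4)} (hT : T.Nonempty) :
    ¬ IsSquare (∏ i ∈ T, algebraMap (MvPolynomial (Fin 4) k) M
      (octicRadicand (.X 0) (.X 1) (.X 2) (.X 3) i)) := by
  let w : Fin 4 → Fin 4 → k[X] := ![![2, 1, 2 * X, X], ![2, -1, 2 * X, -X],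
    ![2, 1, 2 * X, -X], ![2, -1, 2 * X, X]]
  have eval_w : ∀ i j : Fin 4, octicRadicand (w i 0) (w i 1) (w i 2) (w i 3) j =
      if i = j then C 16 * X + C 4 else C 4 := by
    intro i j
    rw [C_ofNat, C_ofNat]
    fin_cases i <;> fin_cases j <;> simp [octicRadicand, w] <;> ring
  refine not_isSquare_prod_of_specialization (k := k)
    (fun i => (MvPolynomial.aeval (w i) : MvPolynomial (Fin 4) k →ₐ[k] k[X]).toRingHom)
    (fun i => ?_) (fun i j hij => ?_) hT
  · simp only [map_octicRadicand, AlgHom.toRingHom_eq_coe, RingHom.coe_coe, MvPolynomial.aeval_X,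
      eval_w, if_pos]
    exact natDegree_linear (by norm_num)
  · simp only [map_octicRadicand, AlgHom.toRingHom_eq_coe, RingHom.coe_coe, MvPolynomial.aeval_X,
      eval_w, if_neg hij]
    exact ⟨natDegree_C _, by rw [Ne, C_eq_zero]; norm_num⟩

theorem algebraicIndependent_sq_pair (k : Type*) [Field k] :
    AlgebraicIndependent k
      (![MvPolynomial.X 0, MvPolynomial.X 1 ^ 2, MvPolynomial.X 2, MvPolynomial.X 3 ^ 2] :
        Fin 4 → MvPolynomial (Fin 4) k) := by
  have h := (MvPolynomial.algebraicIndependent_X (Fin 4) k).polynomial_aeval_of_transcendental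
    (f := ![X, X ^ 2, X, X ^ 2]) (by
      have hX := Polynomial.transcendental_X k
      intro i
      fin_cases i
      exacts [hX, hX.pow two_pos, hX, hX.pow two_pos])
  convert h using 1
  funext i
  fin_cases i <;> simp

theorem sixtyFour_dvd_card_gal_octic {k L : Type*} [Field k] [CharZero k] [Field L]
    [Algebra (MvPolynomial (Fin 4) k) L] [IsFractionRing (MvPolynomial (Fin 4) k) L] :
    64 ∣ Nat.card ((octic (1 : MvPolynomial (Fin 4) k) 0 (.X 0) (.X 1) (.X 2) (.X 3)).map
      (algebraMap _ L)).Gal := by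
  let D := MvPolynomial (Fin 4) k
  let M := FractionRing D
  let E := AlgebraicClosure M
  have : CharZero D := inferInstance
  have : CharZero L := charZero_of_injective_algebraMap (IsFractionRing.injective D L)
  have : CharZero M := IsFractionRing.charZero D
  have : CharZero E := charZero_of_injective_algebraMap (algebraMap M E).injective
  let θ : D →ₐ[k] D := MvPolynomial.aeval
    ![MvPolynomial.X 0, MvPolynomial.X 1 ^ 2, MvPolynomial.X 2, MvPolynomial.X 3 ^ 2]
  have hθ : Function.Injective ((algebraMap D M).comp θ.toRingHom) :=
    (IsFractionRing.injective D M).comp (algebraicIndependent_sq_pair k)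
  let _ : Algebra L M := (IsFractionRing.lift hθ).toAlgebra
  have hLM : ∀ z : D, algebraMap L M (algebraMap D L z) = algebraMap D M (θ z) :=
    fun z => IsFractionRing.lift_algebraMap hθ z
  let v : Fin 4 → D := MvPolynomial.X
  have hθv : ∀ i, θ (v i) = ![v 0, v 1 ^ 2, v 2, v 3 ^ 2] i := MvPolynomial.aeval_X _
  -- adjoin the square roots of `p` and `P`
  let g : Fin 2 → M := ![algebraMap D M (v 1), algebraMap D M (v 3)]
  let G : Fin 2 → D := ![v 1, v 3]
  have hg : ∀ i, g i ^ 2 = algebraMap L M (algebraMap D L (G i)) := by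
    intro i
    rw [hLM]
    fin_cases i
    · exact (map_pow (algebraMap D M) _ 2).symm.trans (congrArg _ (hθv 1).symm)
    · exact (map_pow (algebraMap D M) _ 2).symm.trans (congrArg _ (hθv 3).symm)
  let K₁ := adjoin L (g '' (Finset.univ : Finset (Fin 2)))
  have rank₁ : finrank L K₁ = 4 := by
    refine (finrank_adjoin_image_sqrt two_ne_zero hg Finset.univ fun S _ hS => ?_).trans (by simp)
    refine not_isSquare_prod_of_specialization (k := k)
      (fun i => (MvPolynomial.aeval (![![0, X, 0, 1], ![0, 1, 0, X]] i) : D →ₐ[k] k[X]).toRingHom)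
      ?_ ?_ hS
    · intro i
      fin_cases i <;> simp [G, v]
    · intro i j hij
      fin_cases i <;> fin_cases j <;> simp [G, v] at hij ⊢
  -- adjoin the square roots of the four conjugate elements
  let H : Fin 4 → D := octicRadicand (v 0) (v 1) (v 2) (v 3)
  have mem₁ : ∀ z : D, algebraMap D M z ∈ K₁ := by
    have mem_of_eq : ∀ z : D, θ z = z → algebraMap D M z ∈ K₁ := fun z hz => by
      rw [← hz, ← hLM]
      exact K₁.algebraMap_mem _
    have mem_g : ∀ i, g i ∈ K₁ := fun i => subset_adjoin _ _ ⟨i, by simp, rfl⟩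
    intro z
    induction z using MvPolynomial.induction_on with
    | C a => exact mem_of_eq _ (θ.commutes a)
    | add z w hz hw => rw [map_add]; exact add_mem hz hw
    | mul_X z i hz =>
      rw [map_mul]
      refine mul_mem hz ?_
      fin_cases i
      exacts [mem_of_eq _ (hθv 0), mem_g 0, mem_of_eq _ (hθv 2), mem_g 1]
  let h : Fin 4 → K₁ := fun i => ⟨algebraMap D M (H i), mem₁ _⟩
  have hr : ∀ i, ∃ r : E, r ^ 2 = algebraMap K₁ E (h i) := fun i =>
    IsAlgClosed.exists_pow_nat_eq _ two_pos
  choose r hr using hr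
  let K₂ := adjoin K₁ (r '' (Finset.univ : Finset (Fin 4)))
  have rank₂ : finrank K₁ K₂ = 16 := by
    refine (finrank_adjoin_image_sqrt two_ne_zero hr Finset.univ fun S _ hS hsq => ?_).trans
      (by simp)
    have := hsq.map (algebraMap K₁ M)
    rw [map_prod] at this
    exact not_isSquare_prod_octicRadicand (k := k) (M := M) hS this
  have rank₂L : finrank L (K₂.restrictScalars L) = 64 := by
    have := finrank_mul_finrank L K₁ K₂
    rw [rank₁, rank₂] at this
    exact this.symm
  -- the splitting field contains all these square roots
  let o : D[X] := octic 1 0 (v 0) (v 1) (v 2) (v 3)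
  let f : L[X] := o.map (algebraMap D L)
  have hf : f.Monic := (monic_octic ..).map _
  let N := adjoin L (f.rootSet E)
  have : IsSplittingField L N f := adjoin_rootSet_isSplittingField (IsAlgClosed.splits _)
  let ι : D →+* E := (algebraMap M E).comp (algebraMap D M)
  have hι : ∀ z : D, algebraMap L E (algebraMap D L z) = ι (θ z) := fun z => by
    rw [IsScalarTower.algebraMap_apply L M E, hLM]; rfl
  have hLne : ∀ i, algebraMap D L (v i) ≠ 0 := fun i =>
    (map_ne_zero_iff _ (IsFractionRing.injective D L)).2 (MvPolynomial.X_ne_zero i)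
  have hs : algebraMap L E (algebraMap D L (v 0)) = ι (v 0) := by rw [hι, hθv]; rfl
  have hS : algebraMap L E (algebraMap D L (v 2)) = ι (v 2) := by rw [hι, hθv]; rfl
  have hp : ι (v 1) ^ 2 = algebraMap L E (algebraMap D L (v 1)) := by
    rw [hι, hθv]; exact (map_pow ι _ 2).symm
  have hP : ι (v 3) ^ 2 = algebraMap L E (algebraMap D L (v 3)) := by
    rw [hι, hθv]; exact (map_pow ι _ 2).symm
  have hrι : ∀ i, r i ^ 2 = octicRadicand (ι (v 0)) (ι (v 1)) (ι (v 2)) (ι (v 3)) i := fun i =>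
    (hr i).trans (map_octicRadicand ι ..)
  rw [← hs, ← hS] at hrι
  obtain ⟨hrN, hxN, hyN⟩ := sqrt_mem_adjoin_rootSet_octic (hLne 0) (hLne 2) hp hP (hrι 0) (hrι 1)
    (hrι 2) (hrι 3)
  have hfN : adjoin L ((octic 1 0 (algebraMap D L (v 0)) (algebraMap D L (v 1))
      (algebraMap D L (v 2)) (algebraMap D L (v 3))).rootSet E) = N := by
    simp only [N, f, o, map_octic, map_one, map_zero]
  rw [hfN] at hrN hxN hyN
  have hK₁ : K₁ ≤ N.comap (IsScalarTower.toAlgHom L M E) := by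
    rw [adjoin_le_iff]
    rintro _ ⟨i, -, rfl⟩
    fin_cases i
    exacts [hxN, hyN]
  let N' : IntermediateField K₁ E := N.toSubfield.toIntermediateField fun x => hK₁ x.2
  have hK₂ : K₂ ≤ N' := by
    rw [adjoin_le_iff]
    rintro _ ⟨i, -, rfl⟩
    exact hrN i
  have hle : K₂.restrictScalars L ≤ N := hK₂
  have : IsGalois L f.SplittingField := ⟨⟩
  change 64 ∣ Nat.card (f.SplittingField ≃ₐ[L] f.SplittingField)
  rw [IsGalois.card_aut_eq_finrank, ← (IsSplittingField.algEquiv N f).toLinearEquiv.finrank_eq]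
  exact rank₂L ▸ finrank_dvd_of_le_right hle

theorem no_monomial_root_octicResolventCubic {k : Type*} [Field k] [CharZero k] {c : k}
    (hc : c ≠ 0) {i : ℕ} (hi : i ≤ 2)
    (h : ∀ x : k, (c * x ^ i) ^ 3 - 2 * (x + 8) * (c * x ^ i) ^ 2 + (x ^ 2 + 16 * x) * (c * x ^ i)
      - 4 * x ^ 2 = 0) : False := by
  have h₁ := h 1
  interval_cases i
  · have h₀ := h 0
    have : c = 16 := by
      apply mul_left_cancel₀ (pow_ne_zero 2 hc)
      linear_combination h₀
    subst this
    norm_num at h₁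
  · have h₀ := h (-1)
    have h₂ : (2 * c - 1) ^ 2 = 0 := by linear_combination (- h₀ - h₁) / 8
    have : c = 1 / 2 := by linear_combination (pow_eq_zero_iff two_ne_zero).1 h₂ / 2
    subst this
    norm_num at h₁
  · have h₀ := h (-1)
    have : c = 8 := by
      apply mul_left_cancel₀ hc
      linear_combination (h₀ - h₁) / 4
    subst this
    norm_num at h₁

theorem three_dvd_card_gal_octic {k L : Type*} [Field k] [CharZero k] [Field L]
    [Algebra k[X] L] [IsFractionRing k[X] L] :
    3 ∣ Nat.card ((octic (1 : k[X]) 1 1 0 X 0).map (algebraMap _ L)).Gal := by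
  have : CharZero L := charZero_of_injective_algebraMap (IsFractionRing.injective k[X] L)
  let q : k[X][X] := X ^ 3 - C (2 * (X + 8)) * X ^ 2 + C (X ^ 2 + 16 * X) * X - C (4 * X ^ 2)
  have hqm : q.Monic := by simp only [q]; monicity!
  have hqd : q.natDegree = 3 := by simp only [q]; compute_degree!
  have hq : Irreducible q := by
    rw [hqm.irreducible_iff_roots_eq_zero_of_degree_le_three (by rw [hqd]; decide) hqd.le,
      Multiset.eq_zero_iff_forall_notMem]
    intro v hv
    have hv : v ^ 3 - 2 * (X + 8) * v ^ 2 + (X ^ 2 + 16 * X) * v - 4 * X ^ 2 = 0 := by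
      simpa [q] using (mem_roots'.1 hv).2
    have h4 : IsUnit (4 : k[X]) := by
      rw [← C_ofNat]
      exact isUnit_C.2 (by norm_num)
    have hdvd : v ∣ X ^ 2 := by
      rw [← h4.dvd_mul_left]
      exact ⟨v ^ 2 - 2 * (X + 8) * v + (X ^ 2 + 16 * X), by linear_combination -hv⟩
    obtain ⟨i, hi, w, hw⟩ := (dvd_prime_pow prime_X 2).1 hdvd
    obtain ⟨c, hc, hcw⟩ := Polynomial.isUnit_iff.1 w⁻¹.isUnit
    have hvc : v = C c * X ^ i := by
      rw [hcw, ← hw, mul_comm v, w.inv_mul_cancel_left]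
    refine no_monomial_root_octicResolventCubic hc.ne_zero hi fun x => ?_
    simpa [hvc] using congrArg (eval x) hv
  set f : L[X] := (octic (1 : k[X]) 1 1 0 X 0).map (algebraMap _ L) with hf
  let Q : L[X] := q.map (algebraMap _ L)
  have hQm : Q.Monic := hqm.map _
  have hQ : Irreducible Q := hqm.irreducible_iff_irreducible_map_fraction_map.1 hq
  have hQd : Q.natDegree = 3 := (hqm.natDegree_map _).trans hqd
  have hfq : octic (1 : k[X]) 1 1 0 X 0 = X ^ 2 * q.comp (X ^ 2) := by
    simp only [octic, q, add_comp, sub_comp, mul_comp, pow_comp, X_comp, C_comp, ofNat_comp, C_add,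
      C_mul, C_sub, C_pow, C_ofNat, C_1, C_0]
    ring
  have hfQ : Q.comp (X ^ 2) ∣ f := by
    rw [hf, hfq, Polynomial.map_mul, Polynomial.map_comp, Polynomial.map_pow, map_X]
    exact dvd_mul_left _ _
  let N := f.SplittingField
  have hsplit : (f.map (algebraMap L N)).Splits := SplittingField.splits f
  have hfm : f.Monic := (monic_octic ..).map _
  have : ((Q.comp (X ^ 2)).map (algebraMap L N)).Splits :=
    hsplit.of_dvd (hfm.map _).ne_zero (Polynomial.map_dvd _ hfQ)
  obtain ⟨t, ht⟩ := this.exists_eval_eq_zero (by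
    rw [degree_map]
    exact degree_ne_of_natDegree_ne (by rw [natDegree_comp, hQd, natDegree_X_pow]; decide))
  have hu : aeval (t ^ 2) Q = 0 := by
    simpa [aeval_def, eval_map, eval₂_comp] using ht
  have hfin : finrank L L⟮t ^ 2⟯ = 3 := by
    rw [adjoin.finrank ⟨Q, hQm, hu⟩, ← minpoly.eq_of_irreducible_of_monic hQ hu hQm, hQd]
  have : IsGalois L N := ⟨⟩
  change 3 ∣ Nat.card (N ≃ₐ[L] N)
  rw [IsGalois.card_aut_eq_finrank, ← finrank_mul_finrank L L⟮t ^ 2⟯ N, hfin]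
  exact dvd_mul_right _ _

/-- Let `k` be a field of characteristic `0`, let `K = k(A,B,σ,π,Σ,Π)` be the field of rational
functions in six indeterminates over `k`, and let
`F(t) = t⁸ − 2(σΣ + 4A² + 4B²)t⁶ + (σ²Σ² + 2(σ²Π + Σ²π − 8πΠ) + 8(A² + B²)σΣ + 16(A² − B²)²)t⁴
  − 2((σΣ + 4A² − 4B²)(σ²Π + Σ²π) − 8σΣπΠ + 2B²σ²Σ²)t² + (σ²Π − Σ²π)²`.
Then the Galois group of `F` over `K` (the Galois group of a splitting field of `F` over `K`)
has order `192`. -/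
theorem stmt_2 (k : Type) [Field k] [CharZero k]
    (A B s p S P : FractionRing (MvPolynomial (Fin 6) k))
    (hA : A = algebraMap (MvPolynomial (Fin 6) k) (FractionRing (MvPolynomial (Fin 6) k))
      (MvPolynomial.X 0))
    (hB : B = algebraMap (MvPolynomial (Fin 6) k) (FractionRing (MvPolynomial (Fin 6) k))
      (MvPolynomial.X 1))
    (hs : s = algebraMap (MvPolynomial (Fin 6) k) (FractionRing (MvPolynomial (Fin 6) k))
      (MvPolynomial.X 2))
    (hp : p = algebraMap (MvPolynomial (Fin 6) k) (FractionRing (MvPolynomial (Fin 6) k))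
      (MvPolynomial.X 3))
    (hS : S = algebraMap (MvPolynomial (Fin 6) k) (FractionRing (MvPolynomial (Fin 6) k))
      (MvPolynomial.X 4))
    (hP : P = algebraMap (MvPolynomial (Fin 6) k) (FractionRing (MvPolynomial (Fin 6) k))
      (MvPolynomial.X 5))
    (F : Polynomial (FractionRing (MvPolynomial (Fin 6) k)))
    (hF : F =
      Polynomial.X ^ 8
        - Polynomial.C (2 * (s * S + 4 * A ^ 2 + 4 * B ^ 2)) * Polynomial.X ^ 6
        + Polynomial.C (s ^ 2 * S ^ 2 + 2 * (s ^ 2 * P + S ^ 2 * p - 8 * p * P)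
            + 8 * (A ^ 2 + B ^ 2) * s * S + 16 * (A ^ 2 - B ^ 2) ^ 2) * Polynomial.X ^ 4
        - Polynomial.C (2 * ((s * S + 4 * A ^ 2 - 4 * B ^ 2) * (s ^ 2 * P + S ^ 2 * p)
            - 8 * s * S * p * P + 2 * B ^ 2 * s ^ 2 * S ^ 2)) * Polynomial.X ^ 2
        + Polynomial.C ((s ^ 2 * P - S ^ 2 * p) ^ 2)) :
    Nat.card F.Gal = 192 := by
  have : CharZero (FractionRing (MvPolynomial (Fin 6) k)) :=
    IsFractionRing.charZero (MvPolynomial (Fin 6) k)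
  let f : (MvPolynomial (Fin 6) k)[X] := octic (.X 0) (.X 1) (.X 2) (.X 3) (.X 4) (.X 5)
  have hf : f.Monic := monic_octic ..
  have hfF : f.map (algebraMap _ (FractionRing (MvPolynomial (Fin 6) k))) = F := by
    rw [map_octic, ← hA, ← hB, ← hs, ← hp, ← hS, ← hP, hF, octic]
  have hc : s ^ 2 * P - S ^ 2 * p ≠ 0 := by
    have hne : (MvPolynomial.X 2 ^ 2 * MvPolynomial.X 5 - MvPolynomial.X 4 ^ 2 * MvPolynomial.X 3 :
        MvPolynomial (Fin 6) k) ≠ 0 := fun h => by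
      simpa using congrArg (MvPolynomial.eval ![0, 0, 1, 0, 0, 1]) h
    rw [hs, hp, hS, hP, ← map_pow, ← map_pow, ← map_mul, ← map_mul, ← map_sub]
    exact (map_ne_zero_iff _ (IsFractionRing.injective _ _)).2 hne
  have upper : Nat.card F.Gal ≤ 192 := by
    have : IsGalois (FractionRing (MvPolynomial (Fin 6) k)) F.SplittingField := ⟨⟩
    change Nat.card (F.SplittingField ≃ₐ[_] F.SplittingField) ≤ _
    rw [IsGalois.card_aut_eq_finrank]
    exact finrank_splittingField_even_octic_le hF hc
  have h64 : 64 ∣ Nat.card F.Gal := by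
    let φ : MvPolynomial (Fin 6) k →ₐ[k] MvPolynomial (Fin 4) k :=
      MvPolynomial.aeval ![1, 0, .X 0, .X 1, .X 2, .X 3]
    have hφ : Function.Surjective φ := by
      rw [← AlgHom.range_eq_top, eq_top_iff, ← MvPolynomial.adjoin_range_X, Algebra.adjoin_le_iff]
      rintro _ ⟨i, rfl⟩
      fin_cases i
      exacts [⟨.X 2, by simp [φ]⟩, ⟨.X 3, by simp [φ]⟩, ⟨.X 4, by simp [φ]⟩, ⟨.X 5, by simp [φ]⟩]
    have h := card_gal_map_dvd_card_gal φ.toRingHom hφ hf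
    rw [hfF, map_octic] at h
    refine Dvd.dvd.trans ?_ h
    simpa [φ] using sixtyFour_dvd_card_gal_octic (k := k)
      (L := FractionRing (MvPolynomial (Fin 4) k))
  have h3 : 3 ∣ Nat.card F.Gal := by
    let φ : MvPolynomial (Fin 6) k →ₐ[k] k[X] := MvPolynomial.aeval ![1, 1, 1, 0, X, 0]
    have hφ : Function.Surjective φ := by
      rw [← AlgHom.range_eq_top, eq_top_iff, ← Polynomial.adjoin_X, Algebra.adjoin_le_iff,
        Set.singleton_subset_iff]
      exact ⟨.X 4, by simp [φ]⟩
    have h := card_gal_map_dvd_card_gal φ.toRingHom hφ hf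
    rw [hfF, map_octic] at h
    refine Dvd.dvd.trans ?_ h
    simpa [φ] using three_dvd_card_gal_octic (k := k) (L := FractionRing k[X])
  have hpos : 0 < Nat.card F.Gal := Nat.card_pos
  omega
end

section
/- The invariant algebra k[x,y,X,Y]^W (the set of polynomials fixed by every element of W, equivalently fixed by both s and t) equals the k-subalgebra generated by σ, π, Σ, Π, eu₀, eu₀′, eu₀″ and δ₀. Moreover, k[x,y,X,Y]^W is a free module over the subalgebra P = k[σ,π,Σ,Π] with basis 1, eu₀, eu₀², δ₀, δ₀·eu₀, δ₀·eu₀², eu₀′, eu₀″; that is, k[x,y,X,Y]^W = P ⊕ P·eu₀ ⊕ P·eu₀² ⊕ P·δ₀ ⊕ P·δ₀eu₀ ⊕ P·δ₀eu₀² ⊕ P·eu₀′ ⊕ P·eu₀″. -/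
set_option maxHeartbeats 1000000
set_option synthInstance.maxHeartbeats 1000000

namespace DihedralInvariants

variable {k R : Type*}

/-- The module generators `1, eu₀, eu₀², δ₀, δ₀eu₀, δ₀eu₀², eu₀′, eu₀″`. -/
def moduleGen [CommRing R] (x y X Y : R) : Fin 8 → R :=
  ![1, x * X + y * Y, (x * X + y * Y) ^ 2, x * y * (X * Y),
    x * y * (X * Y) * (x * X + y * Y), x * y * (X * Y) * (x * X + y * Y) ^ 2,
    (x * Y + y * X) * (X * Y), x * y * (x * Y + y * X)]

lemma sum_mul_moduleGen [CommRing R] (x y X Y : R) (c : Fin 8 → R) :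
    ∑ i, c i * moduleGen x y X Y i =
      c 0 + c 1 * (x * X + y * Y) + c 2 * (x * X + y * Y) ^ 2 +
        c 3 * (x * y * (X * Y)) +
        c 4 * (x * y * (X * Y)) * (x * X + y * Y) +
        c 5 * (x * y * (X * Y)) * (x * X + y * Y) ^ 2 +
        c 6 * ((x * Y + y * X) * (X * Y)) +
        c 7 * (x * y * (x * Y + y * X)) := by
  simp [Fin.sum_univ_eight, moduleGen, mul_assoc]

lemma mem_span_moduleGen_iff [CommRing k] [CommRing R] [Algebra k R] (P : Subalgebra k R)
    (x y X Y f : R) :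
    f ∈ Submodule.span P (Set.range (moduleGen x y X Y)) ↔
      ∃ c : Fin 8 → R, (∀ i, c i ∈ P) ∧ f = ∑ i, c i * moduleGen x y X Y i := by
  rw [Submodule.mem_span_range_iff_exists_fun]
  constructor
  · rintro ⟨c, rfl⟩
    exact ⟨fun i => c i, fun i => (c i).2, by simp [Algebra.smul_def]⟩
  · rintro ⟨c, hc, rfl⟩
    exact ⟨fun i => ⟨c i, hc i⟩, by simp [Algebra.smul_def]⟩

/-- Vanishing of the coefficients of a relation, obtained by separating parities in `x` and `y`
and then using the two independent swaps. -/
lemma eq_zero_of_sum_mul_moduleGen_eq_zero [CommRing R] [IsDomain R] {x y X Y : R}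
    (h2 : (2 : R) ≠ 0) (hx : x ≠ 0) (hy : y ≠ 0) (hX : X ≠ 0) (hY : Y ≠ 0)
    (hxy : x ^ 2 - y ^ 2 ≠ 0) (hXY : X ^ 2 - Y ^ 2 ≠ 0) (t u v w : R →+* R)
    (ht : t x = -x ∧ t y = y ∧ t X = X ∧ t Y = Y)
    (hu : u x = x ∧ u y = -y ∧ u X = X ∧ u Y = Y)
    (hv : v x = y ∧ v y = x ∧ v X = X ∧ v Y = Y)
    (hw : w x = x ∧ w y = y ∧ w X = Y ∧ w Y = X)
    (d : Fin 8 → R) (hd : ∀ i, t (d i) = d i ∧ u (d i) = d i ∧ v (d i) = d i ∧ w (d i) = d i)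
    (h : ∑ i, d i * moduleGen x y X Y i = 0) : d = 0 := by
  obtain ⟨ht1, ht2, ht3, ht4⟩ := ht
  obtain ⟨hu1, hu2, hu3, hu4⟩ := hu
  obtain ⟨hv1, hv2, hv3, hv4⟩ := hv
  obtain ⟨hw1, hw2, hw3, hw4⟩ := hw
  have td i := (hd i).1
  have ud i := (hd i).2.1
  have vd i := (hd i).2.2.1
  have wd i := (hd i).2.2.2
  have h4 : (4 : R) ≠ 0 := by
    rw [show (4 : R) = 2 * 2 by norm_num]
    exact mul_ne_zero h2 h2
  rw [sum_mul_moduleGen] at h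
  have ht := congrArg t h
  have hu := congrArg u h
  have hut := congrArg u (congrArg t h)
  simp only [map_add, map_mul, map_pow, map_zero, map_neg, td, ud, ht1, ht2, ht3, ht4, hu1, hu2,
    hu3, hu4] at ht hu hut
  have e0 : d 0 + d 2 * (x ^ 2 * X ^ 2 + y ^ 2 * Y ^ 2) +
      2 * d 5 * (x ^ 2 * y ^ 2 * X ^ 2 * Y ^ 2) = 0 := by
    apply mul_left_cancel₀ h4
    linear_combination h + ht + hu + hut
  have e1 : 2 * d 2 + d 3 + d 5 * (x ^ 2 * X ^ 2 + y ^ 2 * Y ^ 2) = 0 := by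
    apply mul_left_cancel₀ (mul_ne_zero h4 (mul_ne_zero (mul_ne_zero hx hy) (mul_ne_zero hX hY)))
    linear_combination h - ht - hu + hut
  have e2 : d 1 + d 4 * (y ^ 2 * Y ^ 2) + d 6 * Y ^ 2 + d 7 * y ^ 2 = 0 := by
    apply mul_left_cancel₀ (mul_ne_zero h4 (mul_ne_zero hx hX))
    linear_combination h - ht + hu - hut
  have hD := mul_ne_zero hxy hXY
  have e0v := congrArg v e0
  have e1v := congrArg v e1
  have e2v := congrArg v e2
  have e2w := congrArg w e2
  have e2vw := congrArg w (congrArg v e2)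
  simp only [map_add, map_mul, map_pow, map_zero, map_ofNat, vd, wd, hv1, hv2, hv3, hv4, hw1, hw2,
    hw4] at e0v e1v e2v e2w e2vw
  have d2 : d 2 = 0 := by
    apply mul_left_cancel₀ hD
    linear_combination e0 - e0v
  have d5 : d 5 = 0 := by
    apply mul_left_cancel₀ hD
    linear_combination e1 - e1v
  have d4 : d 4 = 0 := by
    apply mul_left_cancel₀ hD
    linear_combination e2 - e2v - e2w + e2vw
  have d6 : d 6 = 0 := by
    apply mul_left_cancel₀ hXY
    linear_combination e2w - e2 - y ^ 2 * (X ^ 2 - Y ^ 2) * d4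
  have d7 : d 7 = 0 := by
    apply mul_left_cancel₀ hxy
    linear_combination e2v - e2 - Y ^ 2 * (x ^ 2 - y ^ 2) * d4
  have d0 : d 0 = 0 := by simpa [d2, d5] using e0
  have d3 : d 3 = 0 := by simpa [d2, d5] using e1
  have d1 : d 1 = 0 := by simpa [d4, d6, d7] using e2
  funext i
  fin_cases i <;> assumption

/-- Over a subalgebra containing `u + v` and `u * v`, monomials in `u, v` reduce to `1, u`,
compatibly with the swap of `u` and `v`. -/
lemma exists_pow_mul_pow_eq [CommRing k] [CommRing R] [Algebra k R] (P : Subalgebra k R) {u v : R}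
    (hadd : u + v ∈ P) (hmul : u * v ∈ P) (a b : ℕ) :
    ∃ p ∈ P, ∃ q ∈ P, u ^ a * v ^ b = p + q * u ∧ v ^ a * u ^ b = p + q * v := by
  induction a with
  | zero =>
    induction b with
    | zero => exact ⟨1, P.one_mem, 0, P.zero_mem, by simp, by simp⟩
    | succ b ih =>
      obtain ⟨p, hp, q, hq, h, h'⟩ := ih
      refine ⟨(u + v) * p + q * (u * v), P.add_mem (P.mul_mem hadd hp) (P.mul_mem hq hmul),
        -p, P.neg_mem hp, ?_, ?_⟩
      · linear_combination v * h
      · linear_combination u * h'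
  | succ a ih =>
    obtain ⟨p, hp, q, hq, h, h'⟩ := ih
    refine ⟨-(q * (u * v)), P.neg_mem (P.mul_mem hq hmul), p + q * (u + v),
      P.add_mem hp (P.mul_mem hq hadd), ?_, ?_⟩
    · linear_combination u * h
    · linear_combination v * h'

lemma exists_two_mul_of_even_add {a c : ℕ} (h : Even (a + c)) :
    ∃ i j : ℕ, (a = 2 * i ∧ c = 2 * j) ∨ (a = 2 * i + 1 ∧ c = 2 * j + 1) := by
  rw [Nat.even_add] at h
  by_cases ha : Even a
  · obtain ⟨i, hi⟩ := ha.exists_two_nsmul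
    obtain ⟨j, hj⟩ := (h.1 ha).exists_two_nsmul
    exact ⟨i, j, .inl ⟨by simpa using hi, by simpa using hj⟩⟩
  · obtain ⟨i, hi⟩ := Nat.not_even_iff_odd.1 ha
    obtain ⟨j, hj⟩ := Nat.not_even_iff_odd.1 (mt h.2 ha)
    exact ⟨i, j, .inr ⟨hi, hj⟩⟩

/-- The symmetrization of a monomial invariant under both sign changes lies in the span of the
module generators. -/
lemma monomial_add_swap_mem_span [CommRing k] [CommRing R] [Algebra k R] (P : Subalgebra k R)
    {x y X Y : R} (hσ : x ^ 2 + y ^ 2 ∈ P) (hπ : x ^ 2 * y ^ 2 ∈ P) (hS : X ^ 2 + Y ^ 2 ∈ P)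
    (hT : X ^ 2 * Y ^ 2 ∈ P) {a b c d : ℕ} (hac : Even (a + c)) (hbd : Even (b + d)) :
    x ^ a * y ^ b * X ^ c * Y ^ d + y ^ a * x ^ b * Y ^ c * X ^ d ∈
      Submodule.span P (Set.range (moduleGen x y X Y)) := by
  obtain ⟨a, c, hac⟩ := exists_two_mul_of_even_add hac
  obtain ⟨b, d, hbd⟩ := exists_two_mul_of_even_add hbd
  obtain ⟨p, hp, q, hq, e₁, e₂⟩ := exists_pow_mul_pow_eq P hσ hπ a b
  obtain ⟨p', hp', q', hq', e₃, e₄⟩ := exists_pow_mul_pow_eq P hS hT c d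
  lift p to P using hp
  lift q to P using hq
  lift p' to P using hp'
  lift q' to P using hq'
  obtain ⟨σ, hσ'⟩ : ∃ σ : P, (σ : R) = x ^ 2 + y ^ 2 := ⟨⟨_, hσ⟩, rfl⟩
  obtain ⟨π, hπ'⟩ : ∃ π : P, (π : R) = x ^ 2 * y ^ 2 := ⟨⟨_, hπ⟩, rfl⟩
  obtain ⟨S, hS'⟩ : ∃ S : P, (S : R) = X ^ 2 + Y ^ 2 := ⟨⟨_, hS⟩, rfl⟩
  obtain ⟨T, hT'⟩ : ∃ T : P, (T : R) = X ^ 2 * Y ^ 2 := ⟨⟨_, hT⟩, rfl⟩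
  have h2 : ((2 : P) : R) = 2 := rfl
  have key : ∀ m m' : R,
      (∃ c : Fin 8 → P, ∑ i, (c i : R) * moduleGen x y X Y i =
        m * ((p + q * x ^ 2) * (p' + q' * X ^ 2)) + m' * ((p + q * y ^ 2) * (p' + q' * Y ^ 2))) →
      m * (((x ^ 2) ^ a * (y ^ 2) ^ b) * ((X ^ 2) ^ c * (Y ^ 2) ^ d)) +
        m' * (((y ^ 2) ^ a * (x ^ 2) ^ b) * ((Y ^ 2) ^ c * (X ^ 2) ^ d)) ∈
        Submodule.span P (Set.range (moduleGen x y X Y)) := by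
    rintro m m' ⟨c, hc⟩
    rw [e₁, e₂, e₃, e₄, mem_span_moduleGen_iff]
    exact ⟨fun i => c i, fun i => (c i).2, hc.symm⟩
  rcases hac with ⟨rfl, rfl⟩ | ⟨rfl, rfl⟩ <;> rcases hbd with ⟨rfl, rfl⟩ | ⟨rfl, rfl⟩
  · convert key 1 1 ⟨![2 * p * p' + p * q' * S + q * p' * σ, 0, q * q', -2 * q * q', 0, 0, 0, 0],
      ?_⟩ using 1
    · ring
    · simp [sum_mul_moduleGen, hσ', hS', h2]
      ring
  · convert key (y * Y) (x * X) ⟨![0, p * p', 0, 0, q * q', 0, p * q', q * p'], ?_⟩ using 1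
    · ring
    · simp [sum_mul_moduleGen]
      ring
  · convert key (x * X) (y * Y) ⟨![0, p * p' + p * q' * S + q * p' * σ + q * q' * σ * S, 0, 0,
      q * q', 0, -(p * q') - q * q' * σ, -(q * p') - q * q' * S], ?_⟩ using 1
    · ring
    · simp [sum_mul_moduleGen, hσ', hS']
      ring
  · convert key (x * y * (X * Y)) (x * y * (X * Y)) ⟨![-2 * q * q' * π * T, 0, 0,
      2 * p * p' + p * q' * S + q * p' * σ, 0, q * q', 0, 0], ?_⟩ using 1
    · ring
    · simp [sum_mul_moduleGen, hσ', hS', hπ', hT', h2]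
      ring

open MvPolynomial in
/-- The full symmetrization of any polynomial lies in the span of the module generators. -/
lemma symmetrize_mem_span [CommRing k] (P : Subalgebra k (MvPolynomial (Fin 4) k))
    {x y Z W : MvPolynomial (Fin 4) k} (hx : x = X 0) (hy : y = X 1) (hZ : Z = X 2) (hW : W = X 3)
    (hσ : x ^ 2 + y ^ 2 ∈ P) (hπ : x ^ 2 * y ^ 2 ∈ P) (hS : Z ^ 2 + W ^ 2 ∈ P)
    (hT : Z ^ 2 * W ^ 2 ∈ P) (s t u : MvPolynomial (Fin 4) k →ₐ[k] MvPolynomial (Fin 4) k)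
    (hs : s = aeval ![y, x, W, Z]) (ht : t = aeval ![-x, y, -Z, W])
    (hu : u = aeval ![x, -y, Z, -W]) (f : MvPolynomial (Fin 4) k) :
    (f + t f + u f + t (u f)) + s (f + t f + u f + t (u f)) ∈
      Submodule.span P (Set.range (moduleGen x y Z W)) := by
  induction f using MvPolynomial.induction_on' with
  | add p q hp hq =>
    convert Submodule.add_mem _ hp hq using 1
    simp only [map_add]
    ring
  | monomial e r =>
    have hm : monomial e r = r • (x ^ e 0 * y ^ e 1 * Z ^ e 2 * W ^ e 3) := by
      rw [monomial_eq, Finsupp.prod_fintype _ _ (by simp), Fin.prod_univ_four, smul_eq_C_mul,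
        hx, hy, hZ, hW]
    have hsx : s x = y ∧ s y = x ∧ s Z = W ∧ s W = Z := by simp [hs, hx, hy, hZ, hW]
    have htx : t x = -x ∧ t y = y ∧ t Z = -Z ∧ t W = W := by simp [ht, hx, hy, hZ, hW]
    have hux : u x = x ∧ u y = -y ∧ u Z = Z ∧ u W = -W := by simp [hu, hx, hy, hZ, hW]
    have hL : ∀ m, m = x ^ e 0 * y ^ e 1 * Z ^ e 2 * W ^ e 3 → m + t m + u m + t (u m) =
        (1 + (-1) ^ (e 0 + e 2)) * (1 + (-1) ^ (e 1 + e 3)) * m := by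
      rintro m rfl
      simp only [map_mul, map_pow, map_neg, htx, hux, neg_pow x, neg_pow y, neg_pow Z, neg_pow W]
      simp only [map_one]
      ring
    rw [hm]
    simp only [map_smul, ← smul_add]
    refine Submodule.smul_of_tower_mem _ r ?_
    rw [hL _ rfl]
    rcases Nat.even_or_odd (e 0 + e 2) with h | h
    · rcases Nat.even_or_odd (e 1 + e 3) with h' | h'
      · rw [h.neg_one_pow, h'.neg_one_pow]
        convert Submodule.smul_mem _ (4 : P) (monomial_add_swap_mem_span P hσ hπ hS hT h h') using 1
        simp only [map_mul, map_add, map_pow, map_one, hsx, Algebra.smul_def, map_ofNat]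
        ring
      · simp [h'.neg_one_pow]
    · simp [h.neg_one_pow]

end DihedralInvariants

open DihedralInvariants

/-- Let `k` be a field of characteristic `0`, `k[x,y,X,Y]` the polynomial ring in four
indeterminates, and `W = ⟨s,t⟩` the group of `k`-algebra automorphisms generated by
`s : x ↦ y, y ↦ x, X ↦ Y, Y ↦ X` and `t : x ↦ -x, y ↦ y, X ↦ -X, Y ↦ Y` (so a polynomial is
`W`-invariant iff it is fixed by both `s` and `t`).  With `σ = x²+y²`, `π = x²y²`, `Σ = X²+Y²`,
`Π = X²Y²`, `eu₀ = xX+yY`, `eu₀′ = (xY+yX)XY`, `eu₀″ = xy(xY+yX)` and `δ₀ = xyXY`: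
the invariant algebra `k[x,y,X,Y]^W` equals the `k`-subalgebra generated by
`σ, π, Σ, Π, eu₀, eu₀′, eu₀″, δ₀`, and moreover it is a free module over `P = k[σ,π,Σ,Π]`
with basis `1, eu₀, eu₀², δ₀, δ₀·eu₀, δ₀·eu₀², eu₀′, eu₀″` (expressed below as the existence
and uniqueness of the coefficients of this decomposition). -/
theorem stmt_3 (k : Type) [Field k] [CharZero k]
    (x y X Y : MvPolynomial (Fin 4) k)
    (hx : x = MvPolynomial.X 0) (hy : y = MvPolynomial.X 1)
    (hX : X = MvPolynomial.X 2) (hY : Y = MvPolynomial.X 3)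
    (s t : MvPolynomial (Fin 4) k →ₐ[k] MvPolynomial (Fin 4) k)
    (hs : s = MvPolynomial.aeval ![y, x, Y, X])
    (ht : t = MvPolynomial.aeval ![-x, y, -X, Y]) :
    (∀ f : MvPolynomial (Fin 4) k,
      (s f = f ∧ t f = f) ↔
        f ∈ Algebra.adjoin k
          ({x ^ 2 + y ^ 2, x ^ 2 * y ^ 2, X ^ 2 + Y ^ 2, X ^ 2 * Y ^ 2,
            x * X + y * Y, (x * Y + y * X) * (X * Y), x * y * (x * Y + y * X),
            x * y * (X * Y)} : Set (MvPolynomial (Fin 4) k))) ∧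
      (∀ f : MvPolynomial (Fin 4) k,
        (s f = f ∧ t f = f) ↔
          ∃! c : Fin 8 → MvPolynomial (Fin 4) k,
            (∀ i : Fin 8, c i ∈ Algebra.adjoin k
              ({x ^ 2 + y ^ 2, x ^ 2 * y ^ 2, X ^ 2 + Y ^ 2, X ^ 2 * Y ^ 2} :
                Set (MvPolynomial (Fin 4) k))) ∧
            f = c 0 + c 1 * (x * X + y * Y) + c 2 * (x * X + y * Y) ^ 2 +
                c 3 * (x * y * (X * Y)) +
                c 4 * (x * y * (X * Y)) * (x * X + y * Y) +
                c 5 * (x * y * (X * Y)) * (x * X + y * Y) ^ 2 +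
                c 6 * ((x * Y + y * X) * (X * Y)) +
                c 7 * (x * y * (x * Y + y * X))) := by
  set G : Set (MvPolynomial (Fin 4) k) :=
    {x ^ 2 + y ^ 2, x ^ 2 * y ^ 2, X ^ 2 + Y ^ 2, X ^ 2 * Y ^ 2} with hG
  set P := Algebra.adjoin k G
  have hsx : s x = y ∧ s y = x ∧ s X = Y ∧ s Y = X := by simp [hs, hx, hy, hX, hY]
  have htx : t x = -x ∧ t y = y ∧ t X = -X ∧ t Y = Y := by simp [ht, hx, hy, hX, hY]
  have hGP : ∀ g ∈ G, g ∈ P := fun g hg => Algebra.subset_adjoin hg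
  have hσ : x ^ 2 + y ^ 2 ∈ P := hGP _ (by simp [hG])
  have hπ : x ^ 2 * y ^ 2 ∈ P := hGP _ (by simp [hG])
  have hS : X ^ 2 + Y ^ 2 ∈ P := hGP _ (by simp [hG])
  have hT : X ^ 2 * Y ^ 2 ∈ P := hGP _ (by simp [hG])
  have exists_coeffs : ∀ f, s f = f → t f = f → ∃ c : Fin 8 → MvPolynomial (Fin 4) k,
      (∀ i, c i ∈ P) ∧ f = ∑ i, c i * moduleGen x y X Y i := by
    intro f hsf htf
    obtain ⟨u, hu⟩ : ∃ u : MvPolynomial (Fin 4) k →ₐ[k] MvPolynomial (Fin 4) k,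
      u = MvPolynomial.aeval ![x, -y, X, -Y] := ⟨_, rfl⟩
    have huf : u f = f := by
      have : u = s.comp (t.comp s) := by
        apply MvPolynomial.algHom_ext
        intro i
        fin_cases i <;> simp [hu, hs, ht, hx, hy, hX, hY]
      simp [this, hsf, htf]
    have h := symmetrize_mem_span P hx hy hX hY hσ hπ hS hT s t u hs ht hu f
    rw [huf, htf] at h
    simp only [map_add, hsf] at h
    rw [← mem_span_moduleGen_iff]
    convert Submodule.smul_of_tower_mem _ ((8 : k)⁻¹) h using 1
    rw [show f + f + f + f + (f + f + f + f) = (8 : k) • f by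
      rw [MvPolynomial.smul_eq_C_mul, map_ofNat]
      ring, inv_smul_smul₀ (by norm_num)]
  have hA : ∀ f ∈ Algebra.adjoin k ({x ^ 2 + y ^ 2, x ^ 2 * y ^ 2, X ^ 2 + Y ^ 2, X ^ 2 * Y ^ 2,
      x * X + y * Y, (x * Y + y * X) * (X * Y), x * y * (x * Y + y * X),
      x * y * (X * Y)} : Set (MvPolynomial (Fin 4) k)), s f = f ∧ t f = f := by
    intro f hf
    have hle : Algebra.adjoin k ({x ^ 2 + y ^ 2, x ^ 2 * y ^ 2, X ^ 2 + Y ^ 2, X ^ 2 * Y ^ 2,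
        x * X + y * Y, (x * Y + y * X) * (X * Y), x * y * (x * Y + y * X),
        x * y * (X * Y)} : Set (MvPolynomial (Fin 4) k)) ≤
        AlgHom.equalizer s (AlgHom.id k _) ⊓ AlgHom.equalizer t (AlgHom.id k _) := by
      rw [Algebra.adjoin_le_iff]
      rintro g (rfl | rfl | rfl | rfl | rfl | rfl | rfl | rfl) <;>
      · simp only [Algebra.coe_inf, Set.mem_inter_iff, SetLike.mem_coe, AlgHom.mem_equalizer,
          map_add, map_mul, map_pow, hsx, htx, AlgHom.id_apply]
        constructor <;> ring
    simpa using hle hf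
  have hmem : ∀ c : Fin 8 → MvPolynomial (Fin 4) k, (∀ i, c i ∈ P) →
      ∑ i, c i * moduleGen x y X Y i ∈ Algebra.adjoin k
        ({x ^ 2 + y ^ 2, x ^ 2 * y ^ 2, X ^ 2 + Y ^ 2, X ^ 2 * Y ^ 2,
        x * X + y * Y, (x * Y + y * X) * (X * Y), x * y * (x * Y + y * X),
        x * y * (X * Y)} : Set (MvPolynomial (Fin 4) k)) := by
    intro c hc
    refine Subalgebra.sum_mem _ fun i _ => Subalgebra.mul_mem _ ?_ ?_
    · refine Algebra.adjoin_mono ?_ (hc i)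
      rintro g (rfl | rfl | rfl | rfl) <;> simp
    · have heu := Algebra.subset_adjoin (R := k) (s := ({x ^ 2 + y ^ 2, x ^ 2 * y ^ 2,
        X ^ 2 + Y ^ 2, X ^ 2 * Y ^ 2, x * X + y * Y, (x * Y + y * X) * (X * Y),
        x * y * (x * Y + y * X), x * y * (X * Y)} : Set (MvPolynomial (Fin 4) k)))
      have h1 := heu (show x * X + y * Y ∈ _ by simp)
      have h2 := heu (show x * y * (X * Y) ∈ _ by simp)
      have h3 := heu (show (x * Y + y * X) * (X * Y) ∈ _ by simp)
      have h4 := heu (show x * y * (x * Y + y * X) ∈ _ by simp)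
      fin_cases i
      exacts [one_mem _, h1, pow_mem h1 2, h2, mul_mem h2 h1, mul_mem h2 (pow_mem h1 2), h3, h4]
  have eq_zero : ∀ d : Fin 8 → MvPolynomial (Fin 4) k, (∀ i, d i ∈ P) →
      ∑ i, d i * moduleGen x y X Y i = 0 → d = 0 := by
    have sub_ne : ∀ i j : Fin 4, i ≠ j →
        (MvPolynomial.X i ^ 2 - MvPolynomial.X j ^ 2 : MvPolynomial (Fin 4) k) ≠ 0 := by
      intro i j hij h
      simpa [hij.symm] using congrArg (MvPolynomial.aeval (Pi.single i (1 : k))) h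
    intro d hd hd0
    let φ (v : Fin 4 → MvPolynomial (Fin 4) k) := MvPolynomial.aeval (R := k) v
    have hφ : ∀ v, (∀ g ∈ G, φ v g = g) → ∀ i, φ v (d i) = d i := by
      intro v hv i
      have hle : P ≤ AlgHom.equalizer (φ v) (AlgHom.id k _) := Algebra.adjoin_le hv
      exact hle (hd i)
    have action : ∀ a b c d, φ ![a, b, c, d] x = a ∧ φ ![a, b, c, d] y = b ∧
        φ ![a, b, c, d] X = c ∧ φ ![a, b, c, d] Y = d := by
      simp [φ, hx, hy, hX, hY]
    refine eq_zero_of_sum_mul_moduleGen_eq_zero (x := x) (y := y) (X := X) (Y := Y) two_ne_zero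
      (by simp [hx]) (by simp [hy]) (by simp [hX]) (by simp [hY])
      (hx ▸ hy ▸ sub_ne 0 1 (by decide)) (hX ▸ hY ▸ sub_ne 2 3 (by decide))
      (φ ![-x, y, X, Y]) (φ ![x, -y, X, Y]) (φ ![y, x, X, Y]) (φ ![x, y, Y, X])
      (action ..) (action ..) (action ..) (action ..) d
      (fun i => ⟨hφ _ ?_ i, hφ _ ?_ i, hφ _ ?_ i, hφ _ ?_ i⟩) hd0 <;>
    · rintro g (rfl | rfl | rfl | rfl) <;> simp only [map_add, map_mul, map_pow, action] <;> ring
  refine ⟨fun f => ⟨fun ⟨hsf, htf⟩ => ?_, hA f⟩, fun f => ⟨fun ⟨hsf, htf⟩ => ?_, ?_⟩⟩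
  · obtain ⟨c, hc, rfl⟩ := exists_coeffs f hsf htf
    exact hmem c hc
  · obtain ⟨c, hc, hf⟩ := exists_coeffs f hsf htf
    refine ⟨c, ⟨hc, by rw [hf, sum_mul_moduleGen]⟩, ?_⟩
    rintro c' ⟨hc', hf'⟩
    rw [← sum_mul_moduleGen] at hf'
    refine sub_eq_zero.1 (eq_zero (c' - c) (fun i => sub_mem (hc' i) (hc i)) ?_)
    simp [sub_mul, ← hf, ← hf']
  · rintro ⟨c, ⟨hc, hf⟩, -⟩
    rw [← sum_mul_moduleGen] at hf
    exact hA f (hf ▸ hmem c hc)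
end

section
/- Inside the field of fractions k(x,y,X,Y) of k[x,y,X,Y], the minimal polynomial of eu₀ = xX+yY over the subfield k(σ,π,Σ,Π) generated by σ, π, Σ, Π is t⁸ − 2σΣ·t⁶ + (σ²Σ² + 2(σ²Π + Σ²π − 8πΠ))·t⁴ − 2σΣ(σ²Π + Σ²π − 8πΠ)·t² + (σ²Π − Σ²π)². In particular eu₀ has degree 8 over k(σ,π,Σ,Π). -/
set_option maxHeartbeats 1000000
set_option synthInstance.maxHeartbeats 1000000

open MvPolynomial in
/-- An involutive substitution of polynomials extends to an endomorphism of the field of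
rational functions. -/
theorem exists_algHom_fractionRing_of_involutive {ι k : Type*} [Field k]
    (g : ι → MvPolynomial ι k) (hg : ∀ i, aeval g (g i) = X i) :
    ∃ φ : FractionRing (MvPolynomial ι k) →ₐ[k] FractionRing (MvPolynomial ι k),
      ∀ p, φ (algebraMap (MvPolynomial ι k) _ p) =
        algebraMap (MvPolynomial ι k) _ (aeval g p) := by
  have hinv : (aeval g).comp (aeval g) = AlgHom.id k (MvPolynomial ι k) := by
    refine algHom_ext fun i => ?_
    rw [AlgHom.comp_apply, aeval_X, hg, AlgHom.id_apply]
  have hinj : Function.Injective (aeval g : MvPolynomial ι k →ₐ[k] MvPolynomial ι k) :=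
    fun p q hpq => by
      have hp := AlgHom.congr_fun hinv p
      have hq := AlgHom.congr_fun hinv q
      rw [AlgHom.comp_apply, AlgHom.id_apply] at hp hq
      rw [← hp, hpq, hq]
  refine ⟨IsFractionRing.liftAlgHom (K := FractionRing (MvPolynomial ι k))
    (g := (IsScalarTower.toAlgHom k (MvPolynomial ι k)
      (FractionRing (MvPolynomial ι k))).comp (aeval g))
    ((IsFractionRing.injective _ _).comp hinj), fun p => ?_⟩
  simp

/-- An endomorphism fixing generators of an intermediate field sends every element to a root of
its minimal polynomial over that field. -/
theorem aeval_minpoly_adjoin_algHom_apply {k L : Type*} [Field k] [Field L] [Algebra k L]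
    (S : Set L) (φ : L →ₐ[k] L) (hφ : ∀ s ∈ S, φ s = s) (a : L) :
    Polynomial.aeval (φ a) (minpoly (IntermediateField.adjoin k S) a) = 0 := by
  have hfix : ∀ b ∈ IntermediateField.adjoin k S, φ b = b := fun b hb => by
    induction hb using IntermediateField.adjoin_induction with
    | mem s hs => exact hφ s hs
    | algebraMap c => exact φ.commutes c
    | add b c _ _ hb hc => rw [map_add, hb, hc]
    | inv b _ hb => rw [map_inv₀, hb]
    | mul b c _ _ hb hc => rw [map_mul, hb, hc]
  let ψ : L →ₐ[IntermediateField.adjoin k S] L :=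
    { φ.toRingHom with commutes' := fun b => hfix b b.2 }
  change Polynomial.aeval (ψ a) _ = 0
  rw [Polynomial.aeval_algHom_apply, minpoly.aeval, map_zero]

/-- The number of distinct roots of a nonzero polynomial in an extension field is at most its
degree. -/
theorem card_le_natDegree_of_injective_of_aeval_eq_zero {K L ι : Type*} [Field K] [Field L]
    [Algebra K L] [Fintype ι] {p : Polynomial K} (hp : p ≠ 0) (f : ι → L)
    (hf : Function.Injective f) (hroot : ∀ i, Polynomial.aeval (f i) p = 0) :
    Fintype.card ι ≤ p.natDegree := by
  rw [← Polynomial.natDegree_map (algebraMap K L), ← Finset.card_univ,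
    ← Finset.card_map ⟨f, hf⟩]
  refine Polynomial.card_le_degree_of_subset_roots fun a ha => ?_
  obtain ⟨i, -, rfl⟩ := Finset.mem_map.mp (Finset.mem_val.mp ha)
  rw [Polynomial.mem_roots (Polynomial.map_ne_zero hp), Polynomial.IsRoot,
    Polynomial.eval_map_algebraMap]
  exact hroot i

open MvPolynomial in
/-- The images of `X 0 * X 2 + X 1 * X 3` under sign changes of `X 2`, `X 3` and the swap of
`X 0`, `X 1`. -/
noncomputable def eulerConjugate (k : Type*) [Field k] (i : Bool × ℤˣ × ℤˣ) :
    MvPolynomial (Fin 4) k :=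
  (if i.1 then X 1 else X 0) * (((i.2.1 : ℤ) : MvPolynomial (Fin 4) k) * X 2) +
    (if i.1 then X 0 else X 1) * (((i.2.2 : ℤ) : MvPolynomial (Fin 4) k) * X 3)

theorem eulerConjugate_injective (k : Type*) [Field k] [CharZero k] :
    Function.Injective (eulerConjugate k) := by
  have heval : ∀ i, MvPolynomial.eval ![1, 3, 1, 10] (eulerConjugate k i) =
      (((if i.1 then 3 else 1) * i.2.1 + (if i.1 then 1 else 3) * (i.2.2 * 10) : ℤ) : k) := by
    rintro ⟨s, u, v⟩
    cases s <;> simp [eulerConjugate]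
  have hinteg : Function.Injective fun i : Bool × ℤˣ × ℤˣ =>
      ((if i.1 then 3 else 1) * i.2.1 + (if i.1 then 1 else 3) * (i.2.2 * 10) : ℤ) := by
    decide
  intro i j hij
  apply hinteg
  have h := congrArg (MvPolynomial.eval ![1, 3, 1, 10]) hij
  rw [heval, heval] at h
  exact_mod_cast h

open MvPolynomial in
/-- The substitutions realising `eulerConjugate`. -/
theorem exists_algHom_eulerConjugate (k : Type*) [Field k] (i : Bool × ℤˣ × ℤˣ) :
    ∃ φ : FractionRing (MvPolynomial (Fin 4) k) →ₐ[k] FractionRing (MvPolynomial (Fin 4) k),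
      φ (algebraMap (MvPolynomial (Fin 4) k) _ (X 0 * X 2 + X 1 * X 3)) =
        algebraMap (MvPolynomial (Fin 4) k) _ (eulerConjugate k i) ∧
      ∀ p ∈ ({X 0 ^ 2 + X 1 ^ 2, X 0 ^ 2 * X 1 ^ 2, X 2 ^ 2 + X 3 ^ 2, X 2 ^ 2 * X 3 ^ 2} :
        Set (MvPolynomial (Fin 4) k)),
        φ (algebraMap (MvPolynomial (Fin 4) k) _ p) = algebraMap (MvPolynomial (Fin 4) k) _ p := by
  obtain ⟨s, u, v⟩ := i
  have hsq : ∀ w : ℤˣ, ((w : ℤ) : MvPolynomial (Fin 4) k) ^ 2 = 1 := fun w => by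
    rcases Int.units_eq_one_or w with rfl | rfl <;> simp
  obtain ⟨φ, hφ⟩ := exists_algHom_fractionRing_of_involutive (k := k)
    ![if s then X 1 else X 0, if s then X 0 else X 1, ((u : ℤ) : MvPolynomial (Fin 4) k) * X 2,
      ((v : ℤ) : MvPolynomial (Fin 4) k) * X 3] (fun j => by
      fin_cases j
      · cases s <;> simp
      · cases s <;> simp
      · simp [← mul_assoc, ← pow_two, hsq]
      · simp [← mul_assoc, ← pow_two, hsq])
  refine ⟨φ, ?_, ?_⟩
  · rw [hφ]
    simp [eulerConjugate]
  · rintro p (rfl | rfl | rfl | rfl) <;> rw [hφ] <;> congr 1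
    · cases s <;> simp [add_comm]
    · cases s <;> simp [mul_comm]
    · simp [mul_pow, hsq]
    · simp [mul_pow, hsq]

/-- Let `k` be a field of characteristic `0` and `k(x,y,X,Y)` the field of fractions of the
polynomial ring `k[x,y,X,Y]`.  With `σ = x²+y²`, `π = x²y²`, `Σ = X²+Y²`, `Π = X²Y²` and
`eu₀ = xX+yY`, the minimal polynomial of `eu₀` over the subfield `k(σ,π,Σ,Π)` is
`t⁸ − 2σΣ·t⁶ + (σ²Σ² + 2(σ²Π + Σ²π − 8πΠ))·t⁴ − 2σΣ(σ²Π + Σ²π − 8πΠ)·t² + (σ²Π − Σ²π)²`;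
in particular `eu₀` has degree `8` over `k(σ,π,Σ,Π)`. -/
theorem stmt_4 (k : Type) [Field k] [CharZero k]
    (x y X Y : FractionRing (MvPolynomial (Fin 4) k))
    (hx : x = algebraMap (MvPolynomial (Fin 4) k) (FractionRing (MvPolynomial (Fin 4) k))
      (MvPolynomial.X 0))
    (hy : y = algebraMap (MvPolynomial (Fin 4) k) (FractionRing (MvPolynomial (Fin 4) k))
      (MvPolynomial.X 1))
    (hX : X = algebraMap (MvPolynomial (Fin 4) k) (FractionRing (MvPolynomial (Fin 4) k))
      (MvPolynomial.X 2))
    (hY : Y = algebraMap (MvPolynomial (Fin 4) k) (FractionRing (MvPolynomial (Fin 4) k))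
      (MvPolynomial.X 3))
    (sig pii Sig Pii : FractionRing (MvPolynomial (Fin 4) k))
    (hsig : sig = x ^ 2 + y ^ 2) (hpii : pii = x ^ 2 * y ^ 2)
    (hSig : Sig = X ^ 2 + Y ^ 2) (hPii : Pii = X ^ 2 * Y ^ 2)
    (K₀ : IntermediateField k (FractionRing (MvPolynomial (Fin 4) k)))
    (hK₀ : K₀ = IntermediateField.adjoin k
      ({sig, pii, Sig, Pii} : Set (FractionRing (MvPolynomial (Fin 4) k)))) :
    Polynomial.map (algebraMap ↥K₀ (FractionRing (MvPolynomial (Fin 4) k)))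
        (minpoly ↥K₀ (x * X + y * Y)) =
      Polynomial.X ^ 8 - Polynomial.C (2 * sig * Sig) * Polynomial.X ^ 6 +
        Polynomial.C (sig ^ 2 * Sig ^ 2 +
          2 * (sig ^ 2 * Pii + Sig ^ 2 * pii - 8 * pii * Pii)) * Polynomial.X ^ 4 -
        Polynomial.C (2 * sig * Sig *
          (sig ^ 2 * Pii + Sig ^ 2 * pii - 8 * pii * Pii)) * Polynomial.X ^ 2 +
        Polynomial.C ((sig ^ 2 * Pii - Sig ^ 2 * pii) ^ 2) ∧
      (minpoly ↥K₀ (x * X + y * Y)).natDegree = 8 := by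
  have hmem : ∀ a ∈ ({sig, pii, Sig, Pii} : Set (FractionRing (MvPolynomial (Fin 4) k))),
      a ∈ K₀ := fun a ha => hK₀ ▸ IntermediateField.subset_adjoin k _ ha
  let s : K₀ := ⟨sig, hmem _ (by simp)⟩
  let p : K₀ := ⟨pii, hmem _ (by simp)⟩
  let S : K₀ := ⟨Sig, hmem _ (by simp)⟩
  let P : K₀ := ⟨Pii, hmem _ (by simp)⟩
  let F : Polynomial K₀ := Polynomial.X ^ 8 - Polynomial.C (2 * s * S) * Polynomial.X ^ 6 +
        Polynomial.C (s ^ 2 * S ^ 2 +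
          2 * (s ^ 2 * P + S ^ 2 * p - 8 * p * P)) * Polynomial.X ^ 4 -
        Polynomial.C (2 * s * S *
          (s ^ 2 * P + S ^ 2 * p - 8 * p * P)) * Polynomial.X ^ 2 +
        Polynomial.C ((s ^ 2 * P - S ^ 2 * p) ^ 2)
  have hdeg : F.natDegree = 8 := by
    simp only [F]
    compute_degree!
  have hmonic : F.Monic := by
    simp only [F]
    monicity!
  have hmap : Polynomial.map (algebraMap K₀ (FractionRing (MvPolynomial (Fin 4) k))) F =
      Polynomial.X ^ 8 - Polynomial.C (2 * sig * Sig) * Polynomial.X ^ 6 +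
        Polynomial.C (sig ^ 2 * Sig ^ 2 +
          2 * (sig ^ 2 * Pii + Sig ^ 2 * pii - 8 * pii * Pii)) * Polynomial.X ^ 4 -
        Polynomial.C (2 * sig * Sig *
          (sig ^ 2 * Pii + Sig ^ 2 * pii - 8 * pii * Pii)) * Polynomial.X ^ 2 +
        Polynomial.C ((sig ^ 2 * Pii - Sig ^ 2 * pii) ^ 2) := by
    have hs : algebraMap K₀ (FractionRing (MvPolynomial (Fin 4) k)) s = sig := rfl
    have hp : algebraMap K₀ (FractionRing (MvPolynomial (Fin 4) k)) p = pii := rfl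
    have hS : algebraMap K₀ (FractionRing (MvPolynomial (Fin 4) k)) S = Sig := rfl
    have hP : algebraMap K₀ (FractionRing (MvPolynomial (Fin 4) k)) P = Pii := rfl
    simp only [F, Polynomial.map_add, Polynomial.map_sub, Polynomial.map_mul, Polynomial.map_pow,
      Polynomial.map_X, Polynomial.map_C, map_add, map_sub, map_mul, map_pow, map_ofNat,
      Polynomial.map_ofNat,
      hs, hp, hS, hP]
  have hroot : Polynomial.aeval (x * X + y * Y) F = 0 := by
    rw [← Polynomial.eval_map_algebraMap, hmap, hsig, hpii, hSig, hPii]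
    simp only [Polynomial.eval_add, Polynomial.eval_sub, Polynomial.eval_mul, Polynomial.eval_pow,
      Polynomial.eval_X, Polynomial.eval_C]
    ring
  clear_value F
  have hinteg : IsIntegral K₀ (x * X + y * Y) := ⟨F, hmonic, hroot⟩
  have hconj : ∀ i, Polynomial.aeval (algebraMap _ (FractionRing (MvPolynomial (Fin 4) k))
      (eulerConjugate k i)) (minpoly K₀ (x * X + y * Y)) = 0 := fun i => by
    obtain ⟨φ, hφ, hfix⟩ := exists_algHom_eulerConjugate k i
    subst hK₀
    rw [← hφ]
    simp only [map_add, map_mul, ← hx, ← hy, ← hX, ← hY]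
    rw [← map_mul, ← map_mul, ← map_add]
    refine aeval_minpoly_adjoin_algHom_apply _ φ ?_ _
    simp only [Set.mem_insert_iff, Set.mem_singleton_iff, forall_eq_or_imp, forall_eq, map_add,
      map_mul, map_pow, ← hx, ← hy, ← hX, ← hY] at hfix ⊢
    simpa [hsig, hpii, hSig, hPii] using hfix
  have hle : 8 ≤ (minpoly K₀ (x * X + y * Y)).natDegree := by
    have hinj := (IsFractionRing.injective (MvPolynomial (Fin 4) k)
      (FractionRing (MvPolynomial (Fin 4) k))).comp (eulerConjugate_injective k)
    have hcard : Fintype.card (Bool × ℤˣ × ℤˣ) = 8 := rfl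
    rw [← hcard]
    exact card_le_natDegree_of_injective_of_aeval_eq_zero (minpoly.ne_zero hinteg) _ hinj hconj
  have hF : F = minpoly K₀ (x * X + y * Y) :=
    Polynomial.eq_of_monic_of_dvd_of_natDegree_le (minpoly.monic hinteg) hmonic
      (minpoly.dvd _ _ hroot) (hdeg.le.trans hle)
  rw [← hF]
  exact ⟨hmap, hdeg⟩
end

section
/- If Q = ⊕_{i∈ℤ} Q̃_i and Q = ⊕_{i∈ℤ} Q̂_i are two ℤ-gradings of the ring Q, both extending the grading of P (i.e., P_i = Q̃_i ∩ P = Q̂_i ∩ P for all i ∈ ℤ), then Q̃_i = Q̂_i for all i ∈ ℤ. -/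
set_option maxHeartbeats 1000000
set_option synthInstance.maxHeartbeats 1000000

open LaurentPolynomial in
/-- The coaction `x ↦ ∑ i, xᵢ Tⁱ` of the multiplicative group attached to a `ℤ`-grading. -/
noncomputable def laurentCoaction {Q : Type*} [CommRing Q] (𝒜 : ℤ → AddSubgroup Q)
    [GradedRing 𝒜] : Q →+* Q[T;T⁻¹] :=
  (DirectSum.toSemiring
    (fun i => (AddMonoidAlgebra.singleAddHom i).comp (𝒜 i).subtype) rfl
    (fun a b => (AddMonoidAlgebra.single_mul_single _ _ (a : Q) (b : Q)).symm)).comp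
    (DirectSum.decomposeRingEquiv 𝒜).toRingHom

open LaurentPolynomial in
theorem laurentCoaction_of_mem {Q : Type*} [CommRing Q] (𝒜 : ℤ → AddSubgroup Q)
    [GradedRing 𝒜] {i : ℤ} {x : Q} (hx : x ∈ 𝒜 i) :
    laurentCoaction 𝒜 x = AddMonoidAlgebra.single i x := by
  have h : DirectSum.decomposeRingEquiv 𝒜 x = DirectSum.of (fun i => 𝒜 i) i ⟨x, hx⟩ :=
    DirectSum.decompose_of_mem 𝒜 hx
  rw [laurentCoaction, RingHom.comp_apply]
  exact (congrArg _ h).trans (DirectSum.toSemiring_of _ _ _ _ _)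

open LaurentPolynomial in
theorem coeff_laurentCoaction {Q : Type*} [CommRing Q] (𝒜 : ℤ → AddSubgroup Q)
    [GradedRing 𝒜] (x : Q) (j : ℤ) :
    (laurentCoaction 𝒜 x).coeff j = DirectSum.decompose 𝒜 x j := by
  induction x using DirectSum.Decomposition.inductionOn 𝒜 with
  | zero => simp
  | @homogeneous i m =>
    rw [laurentCoaction_of_mem 𝒜 m.2, DirectSum.decompose_coe, DirectSum.coe_of_apply]
    simp only [AddMonoidAlgebra.coeff_single, Finsupp.single_apply]
    split_ifs <;> rfl
  | add a b ha hb => simp [ha, hb]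

open LaurentPolynomial in
/-- The composite of the coaction of `𝒜` with the inverse of the automorphism of `Q[T;T⁻¹]`
induced by the coaction of `ℬ`. -/
noncomputable def laurentTransition {Q : Type*} [CommRing Q] (𝒜 ℬ : ℤ → AddSubgroup Q)
    [GradedRing 𝒜] [GradedRing ℬ] : Q →+* Q[T;T⁻¹] :=
  (AddMonoidAlgebra.liftNCRingHom
    ((invert (R := Q)).toRingEquiv.toRingHom.comp (laurentCoaction ℬ))
    (AddMonoidAlgebra.of Q ℤ) (fun _ _ => Commute.all _ _)).comp (laurentCoaction 𝒜)

open LaurentPolynomial in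
theorem laurentTransition_of_mem {Q : Type*} [CommRing Q] (𝒜 ℬ : ℤ → AddSubgroup Q)
    [GradedRing 𝒜] [GradedRing ℬ] {i : ℤ} {x : Q} (hx : x ∈ 𝒜 i) :
    laurentTransition 𝒜 ℬ x = invert (laurentCoaction ℬ x) * T i := by
  rw [laurentTransition, RingHom.comp_apply, laurentCoaction_of_mem 𝒜 hx,
    AddMonoidAlgebra.liftNCRingHom_single]
  rfl

open LaurentPolynomial in
theorem laurentTransition_of_mem_of_mem {Q : Type*} [CommRing Q] (𝒜 ℬ : ℤ → AddSubgroup Q)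
    [GradedRing 𝒜] [GradedRing ℬ] {i : ℤ} {x : Q} (hx : x ∈ 𝒜 i) (hx' : x ∈ ℬ i) :
    laurentTransition 𝒜 ℬ x = C x := by
  rw [laurentTransition_of_mem 𝒜 ℬ hx, laurentCoaction_of_mem ℬ hx', single_eq_C_mul_T,
    map_mul, invert_C, invert_T, mul_T_assoc, neg_add_cancel, T_zero, mul_one]

open LaurentPolynomial in
/-- A Laurent polynomial over a domain that is integral over the constants is constant. -/
theorem LaurentPolynomial.coeff_eq_zero_of_isIntegralElem_C {Q : Type*} [CommRing Q] [IsDomain Q]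
    {z : Q[T;T⁻¹]} (hz : (C : Q →+* Q[T;T⁻¹]).IsIntegralElem z) {m : ℤ} (hm : m ≠ 0) :
    z.coeff m = 0 := by
  classical
  obtain ⟨p, hp, hpz⟩ := hz
  by_contra hne
  let φ (k : ℕ) : ℤ →+ ℤ := AddMonoidHom.mulLeft ((k : ℤ) + 1)
  have hφ (k : ℕ) : Function.Injective (φ k) :=
    mul_right_injective₀ (by positivity)
  let σ (k : ℕ) : Q[T;T⁻¹] →+* Q[T;T⁻¹] := AddMonoidAlgebra.mapDomainRingHom Q (φ k)
  have hσC (k : ℕ) : (σ k).comp C = C := by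
    ext a : 1
    exact AddMonoidAlgebra.mapDomain_single.trans (by rw [map_zero, single_eq_C])
  have hroot (k : ℕ) : σ k z ∈ (p.map C).roots := by
    rw [Polynomial.mem_roots (hp.map C).ne_zero, Polynomial.IsRoot.def, Polynomial.eval_map,
      ← hσC k, ← Polynomial.hom_eval₂, hpz, map_zero]
  have hcoeff (k : ℕ) : (σ k z).coeff (φ k m) = z.coeff m := by
    simp [σ, AddMonoidAlgebra.mapDomain, Finsupp.mapDomain_apply (hφ k)]
  refine Set.infinite_of_injective_forall_mem (f := fun k : ℕ => φ k m)
    (s := ((p.map C).roots.toFinset.biUnion fun w => w.coeff.support : Finset ℤ)) ?_ ?_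
    (Finset.finite_toSet _)
  · intro k l hkl
    have := mul_right_cancel₀ hm (show ((k : ℤ) + 1) * m = ((l : ℤ) + 1) * m from hkl)
    lia
  · intro k
    rw [Finset.mem_coe, Finset.mem_biUnion]
    exact ⟨σ k z, by simpa using hroot k, by rw [Finsupp.mem_support_iff, hcoeff]; exact hne⟩

open LaurentPolynomial in
/-- If two gradings of a domain `Q` agree on the homogeneous elements of a graded ring over which
`Q` is integral, then each piece of the first is contained in that of the second. -/
theorem gradedPiece_le_of_isIntegral {P Q : Type*} [CommRing P] [CommRing Q] [IsDomain Q]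
    (f : P →+* Q) (hint : f.IsIntegral) (𝒟 : ℤ → AddSubgroup P) [GradedRing 𝒟]
    (𝒜 ℬ : ℤ → AddSubgroup Q) [GradedRing 𝒜] [GradedRing ℬ]
    (h𝒜 : ∀ i, ∀ a ∈ 𝒟 i, f a ∈ 𝒜 i) (hℬ : ∀ i, ∀ a ∈ 𝒟 i, f a ∈ ℬ i) (i : ℤ) :
    𝒜 i ≤ ℬ i := by
  classical
  intro x hx
  have hcomp : (laurentTransition 𝒜 ℬ).comp f = C.comp f := by
    ext1 a
    induction a using DirectSum.Decomposition.inductionOn 𝒟 with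
    | zero => simp
    | homogeneous m =>
      exact laurentTransition_of_mem_of_mem 𝒜 ℬ (h𝒜 _ _ m.2) (hℬ _ _ m.2)
    | add a b ha hb => rw [map_add, map_add, ha, hb]
  have hz : (C : Q →+* Q[T;T⁻¹]).IsIntegralElem (laurentTransition 𝒜 ℬ x) := by
    obtain ⟨p, hp, hpx⟩ := hint x
    refine ⟨p.map f, hp.map f, ?_⟩
    rw [Polynomial.eval₂_map, ← hcomp, ← Polynomial.hom_eval₂, hpx, map_zero]
  have hzero (j : ℤ) (hj : j ≠ i) : (DirectSum.decompose ℬ x j : Q) = 0 := by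
    have h := LaurentPolynomial.coeff_eq_zero_of_isIntegralElem_C hz (m := -j + i) (by lia)
    rw [laurentTransition_of_mem 𝒜 ℬ hx, T, AddMonoidAlgebra.coeff_mul_single_add] at h
    simpa [coeff_laurentCoaction] using h
  rw [← DirectSum.sum_support_decompose ℬ x]
  refine AddSubgroup.sum_mem _ fun j _ => ?_
  rcases eq_or_ne j i with rfl | hj
  · exact SetLike.coe_mem _
  · rw [hzero j hj]
    exact zero_mem _

/-- Let `P` be a `ℤ`-graded integral domain and `Q` an integral domain containing `P`
(via an injective ring homomorphism `f`) and integral over `P`.  If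
`Q = ⊕ Q̃_i` and `Q = ⊕ Q̂_i` are two `ℤ`-gradings of `Q` extending the grading of `P`
(i.e. `P_i = Q̃_i ∩ P = Q̂_i ∩ P` for all `i`), then `Q̃_i = Q̂_i` for all `i`. -/
theorem stmt_11 {P Q : Type*} [CommRing P] [IsDomain P] [CommRing Q] [IsDomain Q]
    (f : P →+* Q) (hinj : Function.Injective f) (hint : f.IsIntegral)
    (PGr : ℤ → AddSubgroup P) [GradedRing PGr]
    (QGr QGr2 : ℤ → AddSubgroup Q) [GradedRing QGr] [GradedRing QGr2]
    (h1 : ∀ i : ℤ, (QGr i).comap f.toAddMonoidHom = PGr i)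
    (h2 : ∀ i : ℤ, (QGr2 i).comap f.toAddMonoidHom = PGr i) :
    ∀ i : ℤ, QGr i = QGr2 i := by
  have hA : ∀ i, ∀ a ∈ PGr i, f a ∈ QGr i := fun i a ha => by
    rwa [← h1 i] at ha
  have hB : ∀ i, ∀ a ∈ PGr i, f a ∈ QGr2 i := fun i a ha => by
    rwa [← h2 i] at ha
  exact fun i => le_antisymm
    (gradedPiece_le_of_isIntegral f hint PGr QGr QGr2 hA hB i)
    (gradedPiece_le_of_isIntegral f hint PGr QGr2 QGr hB hA i)
end

section
/- Suppose Q = ⊕_{i∈ℤ} Q_i is a ℤ-grading of the ring Q extending that of P, and suppose that P_i = 0 for all i < 0. Then Q_i = 0 for all i < 0. -/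
set_option maxHeartbeats 1000000
set_option synthInstance.maxHeartbeats 1000000

/-- A ring homomorphism that sends each graded piece into the piece of the same degree sends a
ring without elements of degree `j` to elements whose component of degree `j` vanishes. -/
theorem GradedRing.decompose_map_eq_zero {P Q : Type*} [CommRing P] [CommRing Q]
    (f : P →+* Q) (PGr : ℤ → AddSubgroup P) [GradedRing PGr]
    (QGr : ℤ → AddSubgroup Q) [GradedRing QGr]
    (hf : ∀ i, ∀ a ∈ PGr i, f a ∈ QGr i) {j : ℤ} (hj : PGr j = ⊥) (a : P) :
    (DirectSum.decompose QGr (f a) j : Q) = 0 := by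
  induction a using DirectSum.Decomposition.inductionOn PGr with
  | zero => simp
  | @homogeneous i m =>
    by_cases hij : i = j
    · subst hij
      have hm : (m : P) = 0 := by simpa [hj] using m.2
      simp [hm]
    · exact DirectSum.decompose_of_mem_ne QGr (hf i m m.2) hij
  | add a b ha hb => simp [DirectSum.decompose_add, ha, hb]

/-- Let `P` be a `ℤ`-graded integral domain and `Q` an integral domain containing `P`
(via an injective ring homomorphism `f`) and integral over `P`, and let `Q = ⊕ Q_i` be a
`ℤ`-grading of `Q` extending that of `P` (i.e. `P_i = Q_i ∩ P` for all `i`).  If `P_i = 0`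
for all `i < 0`, then `Q_i = 0` for all `i < 0`. -/
theorem stmt_12 {P Q : Type*} [CommRing P] [IsDomain P] [CommRing Q] [IsDomain Q]
    (f : P →+* Q) (hinj : Function.Injective f) (hint : f.IsIntegral)
    (PGr : ℤ → AddSubgroup P) [GradedRing PGr]
    (QGr : ℤ → AddSubgroup Q) [GradedRing QGr]
    (h1 : ∀ i : ℤ, (QGr i).comap f.toAddMonoidHom = PGr i)
    (hP : ∀ i : ℤ, i < 0 → PGr i = ⊥) :
    ∀ i : ℤ, i < 0 → QGr i = ⊥ := by
  have hf : ∀ i, ∀ a ∈ PGr i, f a ∈ QGr i := by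
    intro i a ha
    rw [← h1 i] at ha
    exact ha
  intro i hi
  rw [eq_bot_iff]
  intro q hq
  obtain ⟨p, hp, hpq⟩ := hint q
  set n := p.natDegree with hn
  have hterm : ∀ k : ℕ, k < n →
      (DirectSum.decompose QGr (f (p.coeff k) * q ^ k) (n • i) : Q) = 0 := by
    intro k hk
    have hki : (n • i : ℤ) = ((n : ℤ) - k) * i + k • i := by
      simp only [nsmul_eq_mul]
      ring
    have hneg : ((n : ℤ) - k) * i < 0 := mul_neg_of_pos_of_neg (by omega) hi
    rw [hki, DirectSum.coe_decompose_mul_add_of_right_mem QGr (SetLike.pow_mem_graded k hq),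
      GradedRing.decompose_map_eq_zero f PGr QGr hf (hP _ hneg), zero_mul]
  have hlead : (DirectSum.decompose QGr (q ^ n) (n • i) : Q) = q ^ n :=
    DirectSum.decompose_of_mem_same QGr (SetLike.pow_mem_graded n hq)
  have hsum := congrArg (GradedRing.proj QGr (n • i)) hpq
  rw [Polynomial.eval₂_eq_sum_range, Finset.sum_range_succ, map_add, map_sum, map_zero, ← hn,
    Finset.sum_eq_zero, zero_add, hn, hp.coeff_natDegree, ← hn, map_one, one_mul,
    GradedRing.proj_apply, hlead] at hsum
  · exact AddSubgroup.mem_bot.mpr (eq_zero_of_pow_eq_zero hsum)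
  · intro k hk
    exact hterm k (Finset.mem_range.mp hk)
end
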